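/- Let μ ∈ Γ₁ := {a + ib ∈ ℂ : 0 < a < 1, 0 < b < √(3a(1−a)²/(4−3a))}. Then there exists an admissible shear flow U_s and K > 0 such that for every integer k ≥ K there exists μ_k ∈ ℂ with Im μ_k > 0, μ_k → μ as k → ∞, and a smooth function φ_k : [0,∞) → ℂ satisfying (μ_k − U_s)φ_k' + U_s' φ_k − (i/k) φ_k''' = F, φ_k(0) = 0, φ_k'(0) = 1, φ_k'(y) → 0 and φ_k(y) → Δ_s as y → ∞. Equivalently, the eigenvalues λ_k := −i k μ_k satisfy λ_k ∼ −i k μ and the PDT system displays (λ_k, k) instabilities. -/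

import Mathlib

open MeasureTheory Filter Set

noncomputable section

/-- The source term `F(y) = 1 - U(y) + y U'(y)` of the eigenmode ODE. -/
def srcF (U : ℝ → ℝ) (y : ℝ) : ℝ := 1 - U y + y * deriv U y

/-- The displacement thickness `Δ_s = ∫₀^∞ (1 - U)`. -/
def deltaS (U : ℝ → ℝ) : ℝ := ∫ y in Ioi (0:ℝ), (1 - U y)

/-- An admissible shear flow: smooth, monotone, `U(0) = 0`, `U → 1`,
`U''(0) ≠ 0`, finitely many inflexion points, and the decay conditions of the paper. -/
structure AdmissibleShearFlow (U : ℝ → ℝ) : Prop where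
  smooth : ContDiff ℝ (⊤ : ℕ∞) U
  mem_Ico : ∀ y, 0 ≤ y → U y ∈ Ico (0:ℝ) 1
  zero_val : U 0 = 0
  deriv_pos : ∀ y, 0 ≤ y → 0 < deriv U y
  tendsto_one : Tendsto U atTop (nhds 1)
  snd_deriv_zero_ne : iteratedDeriv 2 U 0 ≠ 0
  finite_inflexions : {y : ℝ | 0 < y ∧ iteratedDeriv 2 U y = 0}.Finite
  integrable_defect : IntegrableOn (fun y => 1 - U y) (Ioi (0:ℝ))
  derivs_bounded : ∀ j : ℕ, 1 ≤ j → j ≤ 3 →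
    ∃ M : ℝ, ∀ y, 0 ≤ y → |iteratedDeriv j U y| ≤ M
  decay_ratio₁ : Tendsto (fun y => (1 - U y) ^ 2 / deriv U y) atTop (nhds 0)
  decay_ratio₂ : Tendsto (fun y => y * (1 - U y)) atTop (nhds 0)
  decay_ratio₃ : IntegrableOn
    (fun y => (1 - U y) ^ 2 * iteratedDeriv 2 U y / (deriv U y) ^ 2) (Ioi (0:ℝ))
  kappa_decay : ∃ κ : ℝ, 0 < κ ∧ κ < 1/2 ∧ ∃ yκ > (0:ℝ), ∃ cκ > (0:ℝ),
    ∀ y, yκ ≤ y →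
      (1 - U y) ^ ((2:ℝ) - κ) * iteratedDeriv 2 U y ≤ -cκ * (deriv U y) ^ 3

/-- `φ` is a smooth solution of the eigenmode problem
`(μ - U_s)φ' + U_s'φ - (i/k)φ''' = F`, `φ(0) = 0`, `φ'(0) = 1`, `φ' → 0`, `φ → L`. -/
def IsEigSolution (U : ℝ → ℝ) (μ : ℂ) (k : ℝ) (L : ℂ) (φ : ℝ → ℂ) : Prop :=
  ContDiff ℝ (⊤ : ℕ∞) φ ∧
  (∀ y, 0 ≤ y →
    (μ - (U y : ℂ)) * deriv φ y + ((deriv U y : ℝ) : ℂ) * φ y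
      - Complex.I / (k : ℂ) * iteratedDeriv 3 φ y = (srcF U y : ℂ)) ∧
  φ 0 = 0 ∧ deriv φ 0 = 1 ∧
  Tendsto (deriv φ) atTop (nhds 0) ∧
  Tendsto φ atTop (nhds L)

/-- Same problem without the prescribed limit at infinity. -/
def IsBLSolution (U : ℝ → ℝ) (μ : ℂ) (k : ℝ) (φ : ℝ → ℂ) : Prop :=
  ContDiff ℝ (⊤ : ℕ∞) φ ∧
  (∀ y, 0 ≤ y →
    (μ - (U y : ℂ)) * deriv φ y + ((deriv U y : ℝ) : ℂ) * φ y
      - Complex.I / (k : ℂ) * iteratedDeriv 3 φ y = (srcF U y : ℂ)) ∧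
  φ 0 = 0 ∧ deriv φ 0 = 1 ∧ Tendsto (deriv φ) atTop (nhds 0)

/-- Cauchy principal value `PV ∫₀¹ h(u)/(u - a) du`. -/
def pvIntegral (h : ℝ → ℝ) (a : ℝ) : ℝ :=
  limUnder (nhdsWithin (0:ℝ) (Ioi 0))
    (fun ε => ∫ u in Ioo (0:ℝ) 1 \ Ioo (a - ε) (a + ε), h u / (u - a))

/-- Inverse of the shear flow on `[0, ∞)`. -/
def shearInv (U : ℝ → ℝ) (u : ℝ) : ℝ := Function.invFunOn U (Ici 0) u

/-- `g(u) = (1-u)² U''(U⁻¹(u)) / (U'(U⁻¹(u)))³`. -/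
def gfun (U : ℝ → ℝ) (u : ℝ) : ℝ :=
  (1 - u) ^ 2 * iteratedDeriv 2 U (shearInv U u) / (deriv U (shearInv U u)) ^ 3

/-- `G(a) = 1/(a U'(0)) + PV ∫₀¹ g(u)/(u-a) du + iπ g(a)`. -/
def Gfun (U : ℝ → ℝ) (a : ℝ) : ℂ :=
  ((1 / (a * deriv U 0) + pvIntegral (gfun U) a : ℝ) : ℂ)
    + Complex.I * ((Real.pi * gfun U a : ℝ) : ℂ)

/-- Crossing abscissa `χ(y) = Re G(U(y))`. -/
def chiAbscissa (U : ℝ → ℝ) (y : ℝ) : ℝ := (Gfun U (U y)).re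

/-- `ξ(γ)`: number of zeros of `U''` in `(0,∞)` with `χ(yᵢ) = γ`. -/
def xiEq (U : ℝ → ℝ) (γ : ℝ) : ℕ :=
  {y : ℝ | 0 < y ∧ iteratedDeriv 2 U y = 0 ∧ chiAbscissa U y = γ}.ncard

/-- `ξ₊(γ)`: zeros of `U''` with `χ(yᵢ) < γ`, `U'' < 0` on the left and `U'' > 0`
on the right. -/
def xiPlus (U : ℝ → ℝ) (γ : ℝ) : ℕ :=
  {y : ℝ | 0 < y ∧ iteratedDeriv 2 U y = 0 ∧ chiAbscissa U y < γ ∧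
    ∃ δ > (0:ℝ), (∀ z ∈ Ioo (y - δ) y, iteratedDeriv 2 U z < 0) ∧
      (∀ z ∈ Ioo y (y + δ), 0 < iteratedDeriv 2 U z)}.ncard

/-- `ξ₋(γ)`: zeros of `U''` with `χ(yᵢ) < γ`, `U'' > 0` on the left and `U'' < 0`
on the right. -/
def xiMinus (U : ℝ → ℝ) (γ : ℝ) : ℕ :=
  {y : ℝ | 0 < y ∧ iteratedDeriv 2 U y = 0 ∧ chiAbscissa U y < γ ∧
    ∃ δ > (0:ℝ), (∀ z ∈ Ioo (y - δ) y, 0 < iteratedDeriv 2 U z) ∧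
      (∀ z ∈ Ioo y (y + δ), iteratedDeriv 2 U z < 0)}.ncard

/-- `Φ_inv(μ) = (μ - 1) ∫₀^∞ F(y)/(μ - U(y))² dy`. -/
def PhiInv (U : ℝ → ℝ) (μ : ℂ) : ℂ :=
  (μ - 1) * ∫ y in Ioi (0:ℝ), (srcF U y : ℂ) / (μ - (U y : ℂ)) ^ 2

/-- A weight function `ω ≥ 1` with `C_ω < ∞`. -/
structure WeightFn (ω : ℝ → ℝ) : Prop where
  pos : ∀ y, 0 ≤ y → 0 < ω y
  contDiff : ContDiff ℝ 1 ω
  one_le : ∀ y, 0 ≤ y → 1 ≤ ω y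
  integrable_inv : IntegrableOn (fun y => 1 / ω y) (Ioi (0:ℝ))
  deriv_ratio_bdd : ∃ M : ℝ, ∀ y, 0 ≤ y → |deriv ω y / ω y| ≤ M
  log_ratio_bdd : ∃ M : ℝ, ∀ y, 0 ≤ y → Real.log (ω y) / (1 + y) ≤ M

/-- Weighted decay conditions: `(1-U_s) ∈ L²(ω)` and `(1+y)U_s^{(j)} ∈ L²(ω)`, `j = 1,2,3`. -/
def WeightedDecay (U ω : ℝ → ℝ) : Prop :=
  IntegrableOn (fun y => (1 - U y) ^ 2 * ω y) (Ioi (0:ℝ)) ∧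
  ∀ j : ℕ, 1 ≤ j → j ≤ 3 →
    IntegrableOn (fun y => ((1 + y) * iteratedDeriv j U y) ^ 2 * ω y) (Ioi (0:ℝ))

/-- Membership in the weighted space `L²(ω)`. -/
def MemL2w (ω : ℝ → ℝ) (f : ℝ → ℂ) : Prop :=
  IntegrableOn (fun y => ‖f y‖ ^ 2 * ω y) (Ioi (0:ℝ))

/-- The `L²(ω)` norm. -/
def wNorm (ω : ℝ → ℝ) (f : ℝ → ℂ) : ℝ :=
  Real.sqrt (∫ y in Ioi (0:ℝ), ‖f y‖ ^ 2 * ω y)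

/-- `φ` solves the homogeneous-boundary-conditions resolvent problem with forcing `f`. -/
def SolvesHom (U : ℝ → ℝ) (μ : ℂ) (k : ℝ) (f φ : ℝ → ℂ) : Prop :=
  ContDiff ℝ 2 φ ∧
  (∀ᵐ y ∂(volume.restrict (Ioi (0:ℝ))),
    (μ - (U y : ℂ)) * deriv φ y + ((deriv U y : ℝ) : ℂ) * φ y
      - Complex.I / (k : ℂ) * iteratedDeriv 3 φ y = f y) ∧
  φ 0 = 0 ∧ deriv φ 0 = 0 ∧ Tendsto (deriv φ) atTop (nhds 0)

/-- Parameterization on `[0,1]` of the contour `C_η`: the segment from `iη` to `1 + iη`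
followed by the upper half-circle of radius `1/2` centered at `1/2 + iη`. -/
def Ceta (η : ℝ) (t : ℝ) : ℂ :=
  if t ≤ 1/2 then ((2*t : ℝ) : ℂ) + (η : ℂ) * Complex.I
  else (1/2 : ℂ) + (η : ℂ) * Complex.I
    + (1/2 : ℂ) * Complex.exp (((Real.pi * (2*t - 1) : ℝ)) * Complex.I)

/-- Winding number `(1/2πi) ∮ dz/(z - p)` of a closed curve parameterized on `[0,1]`. -/
def windingNumber (c : ℝ → ℂ) (p : ℂ) : ℂ :=
  (((2 * Real.pi : ℝ) : ℂ) * Complex.I)⁻¹ * ∫ t in (0:ℝ)..1, deriv c t / (c t - p)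

/-- `q_μ(x) = |μ - x|⁴ - (2μ - 1 - x)(μ̄ - x)²`. -/
def qmu (μ : ℂ) (x : ℝ) : ℂ :=
  ((‖μ - (x:ℂ)‖ ^ 4 : ℝ) : ℂ) - (2*μ - 1 - (x:ℂ)) * ((starRingEnd ℂ) μ - (x:ℂ))^2

/-- `f(α) = -2iΔ_s/α + 1/√α`, principal square root (positive real part for `Re α > 0`). -/
def fIBL (Δ : ℝ) (α : ℂ) : ℂ := (-2 * Complex.I * (Δ:ℂ)) / α + 1 / (α ^ (1/2 : ℂ))

set_option linter.unusedVariables false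

/-! ### Weighted sup-norm spaces and Volterra-type operators -/

/-- The Banach space in which the viscous problem is solved. -/
abbrev XSp := BoundedContinuousFunction NNReal ℂ

/-- Extension of an element of `XSp` to the real line, multiplied by the weight. -/
def wx (W : ℝ → ℝ) (x : XSp) (s : ℝ) : ℂ := (W s : ℂ) * x (Real.toNNReal s)

lemma wx_continuous {W : ℝ → ℝ} (hW : Continuous W) (x : XSp) : Continuous (wx W x) := by
  unfold wx
  exact (Complex.continuous_ofReal.comp hW).mul (x.continuous.comp continuous_real_toNNReal)

lemma wx_norm_le {W : ℝ → ℝ} (hW : ∀ y, 0 < W y) (x : XSp) (s : ℝ) :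
    ‖wx W x s‖ ≤ ‖x‖ * W s := by
  unfold wx
  rw [norm_mul, Complex.norm_real, Real.norm_eq_abs, abs_of_pos (hW s), mul_comm]
  exact mul_le_mul_of_nonneg_right (x.norm_coe_le_norm _) (hW s).le

lemma wx_add (W : ℝ → ℝ) (x y : XSp) (s : ℝ) : wx W (x + y) s = wx W x s + wx W y s := by
  simp [wx, mul_add]

lemma wx_smul (W : ℝ → ℝ) (c : ℂ) (x : XSp) (s : ℝ) : wx W (c • x) s = c * wx W x s := by
  simp [wx]; ring

/-- General construction of bounded operators in the weighted space. -/
lemma exists_op (W : ℝ → ℝ) (hWc : Continuous W) (hW : ∀ y, 0 < W y)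
    (T : XSp → ℝ → ℂ) (c : ℝ) (hc : 0 ≤ c)
    (hadd : ∀ x x' y, T (x + x') y = T x y + T x' y)
    (hsmul : ∀ (a : ℂ) x y, T (a • x) y = a * T x y)
    (hcont : ∀ x, Continuous (T x))
    (hbd : ∀ x y, 0 ≤ y → ‖T x y‖ ≤ c * ‖x‖ * W y) :
    ∃ L : XSp →L[ℂ] XSp, ‖L‖ ≤ c ∧ ∀ x y, 0 ≤ y → wx W (L x) y = T x y := by
  have hW' : ∀ y : ℝ, (W y : ℂ) ≠ 0 := fun y => by exact_mod_cast (hW y).ne'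
  let L0 : XSp →ₗ[ℂ] XSp :=
    { toFun := fun x => BoundedContinuousFunction.ofNormedAddCommGroup
        (fun y : NNReal => T x y / (W y : ℂ))
        (((hcont x).comp NNReal.continuous_coe).div
          (Complex.continuous_ofReal.comp (hWc.comp NNReal.continuous_coe)) (fun y => hW' _))
        (c * ‖x‖)
        (fun y => by
          rw [norm_div, Complex.norm_real, Real.norm_eq_abs, abs_of_pos (hW _), div_le_iff₀ (hW _)]
          exact hbd x y y.2)
      map_add' := fun x x' => by
        ext y
        simp [hadd, add_div]
      map_smul' := fun a x => by
        ext y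
        simp [hsmul, mul_div_assoc] }
  refine ⟨L0.mkContinuous c (fun x => ?_), LinearMap.mkContinuous_norm_le _ hc _, ?_⟩
  · refine (BoundedContinuousFunction.norm_le (by positivity)).2 fun y => ?_
    show ‖T x y / (W y : ℂ)‖ ≤ _
    rw [norm_div, Complex.norm_real, Real.norm_eq_abs, abs_of_pos (hW _), div_le_iff₀ (hW _)]
    exact hbd x y y.2
  · intro x y hy
    simp only [wx, LinearMap.mkContinuous_apply]
    show (W y : ℂ) * (T x (Real.toNNReal y) / (W (Real.toNNReal y) : ℂ)) = _
    rw [Real.coe_toNNReal y hy, mul_div_cancel₀ _ (hW' y)]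

lemma wx_inj {W : ℝ → ℝ} (hW : ∀ y, 0 < W y) {x x' : XSp}
    (h : ∀ y, 0 ≤ y → wx W x y = wx W x' y) : x = x' := by
  ext y
  have := h y y.2
  simp only [wx, Real.toNNReal_coe] at this
  exact mul_left_cancel₀ (by exact_mod_cast (hW y).ne') this

lemma exists_toX (b : ℝ → ℂ) (hb : Continuous b) (K : ℝ) (hK : 0 ≤ K)
    (hbd : ∀ y, 0 ≤ y → ‖b y‖ ≤ K) :
    ∃ x : XSp, ‖x‖ ≤ K ∧ ∀ y, 0 ≤ y → x (Real.toNNReal y) = b y := by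
  refine ⟨BoundedContinuousFunction.ofNormedAddCommGroup (fun y : NNReal => b y)
    (hb.comp NNReal.continuous_coe) K (fun y => hbd y y.2),
    BoundedContinuousFunction.norm_ofNormedAddCommGroup_le _ hK _, ?_⟩
  intro y hy
  show b (Real.toNNReal y) = b y
  rw [Real.coe_toNNReal y hy]

/-- Element of `XSp` representing a function dominated by the weight. -/
lemma exists_toWX (W : ℝ → ℝ) (hWc : Continuous W) (hW : ∀ y, 0 < W y)
    (b : ℝ → ℂ) (hb : Continuous b) (K : ℝ) (hK : 0 ≤ K)
    (hbd : ∀ y, 0 ≤ y → ‖b y‖ ≤ K * W y) :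
    ∃ x : XSp, ‖x‖ ≤ K ∧ ∀ y, 0 ≤ y → wx W x y = b y := by
  have hW' : ∀ y : ℝ, (W y : ℂ) ≠ 0 := fun y => by exact_mod_cast (hW y).ne'
  obtain ⟨x, hx, hx'⟩ := exists_toX (fun y => b y / (W y : ℂ))
    (hb.div (Complex.continuous_ofReal.comp hWc) (fun y => hW' _)) K hK (fun y hy => by
      rw [norm_div, Complex.norm_real, Real.norm_eq_abs, abs_of_pos (hW _), div_le_iff₀ (hW _)]
      exact hbd y hy)
  refine ⟨x, hx, fun y hy => ?_⟩
  simp only [wx, hx' y hy]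
  rw [mul_div_cancel₀ _ (hW' y)]

def Pfn (E : ℝ → ℂ) (r : ℝ → ℂ) (y : ℝ) : ℂ :=
  Complex.exp (-E y) * ∫ s in (0:ℝ)..y, Complex.exp (E s) * r s

/-- Backward Volterra operator. -/
def Qfn (E : ℝ → ℂ) (r : ℝ → ℂ) (y : ℝ) : ℂ :=
  Complex.exp (E y) * ((∫ s in Ioi (0:ℝ), Complex.exp (-E s) * r s)
    - ∫ s in (0:ℝ)..y, Complex.exp (-E s) * r s)

lemma Pfn_hasDerivAt {E e r : ℝ → ℂ} (hE : ∀ y, HasDerivAt E (e y) y) (hr : Continuous r) (y : ℝ) :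
    HasDerivAt (Pfn E r) (r y - e y * Pfn E r y) y := by
  have hEc : Continuous E := continuous_iff_continuousAt.2 fun y => (hE y).continuousAt
  have hc : Continuous (fun s => Complex.exp (E s) * r s) := (Complex.continuous_exp.comp hEc).mul hr
  have h1 : HasDerivAt (fun y => ∫ s in (0:ℝ)..y, Complex.exp (E s) * r s)
      (Complex.exp (E y) * r y) y :=
    intervalIntegral.integral_hasDerivAt_right (hc.intervalIntegrable _ _)
      (hc.stronglyMeasurableAtFilter _ _) hc.continuousAt
  have h2 := ((hE y).neg.cexp).mul h1
  refine h2.congr_deriv ?_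
  have : Complex.exp (-E y) * Complex.exp (E y) = 1 := by rw [← Complex.exp_add]; simp
  simp only [Pfn]
  linear_combination (r y) * this

lemma Qfn_hasDerivAt {E e r : ℝ → ℂ} (hE : ∀ y, HasDerivAt E (e y) y) (hr : Continuous r) (y : ℝ) :
    HasDerivAt (Qfn E r) (e y * Qfn E r y - r y) y := by
  have hEc : Continuous E := continuous_iff_continuousAt.2 fun y => (hE y).continuousAt
  have hc : Continuous (fun s => Complex.exp (-E s) * r s) :=
    (Complex.continuous_exp.comp hEc.neg).mul hr
  have h1 : HasDerivAt (fun y => ∫ s in (0:ℝ)..y, Complex.exp (-E s) * r s)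
      (Complex.exp (-E y) * r y) y :=
    intervalIntegral.integral_hasDerivAt_right (hc.intervalIntegrable _ _)
      (hc.stronglyMeasurableAtFilter _ _) hc.continuousAt
  have h2 := ((hE y).cexp).mul (h1.const_sub (∫ s in Ioi (0:ℝ), Complex.exp (-E s) * r s))
  refine h2.congr_deriv ?_
  have : Complex.exp (E y) * Complex.exp (-E y) = 1 := by rw [← Complex.exp_add]; simp
  simp only [Qfn]
  linear_combination (-r y) * this

/-- Reproducing formula for the forward operator. -/
lemma Pfn_repr {E e θ θ' : ℝ → ℂ} (hE : ∀ y, HasDerivAt E (e y) y) (he : Continuous e)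
    (hE0 : E 0 = 0)
    (hθ : ∀ y, HasDerivAt θ (θ' y) y) (hθ' : Continuous θ') (y : ℝ) :
    θ y = Complex.exp (-E y) * θ 0 + Pfn E (fun s => θ' s + e s * θ s) y := by
  have hEc : Continuous E := continuous_iff_continuousAt.2 fun y => (hE y).continuousAt
  have hθc : Continuous θ := continuous_iff_continuousAt.2 fun y => (hθ y).continuousAt
  have h1 : ∀ s, HasDerivAt (fun s => Complex.exp (E s) * θ s)
      (Complex.exp (E s) * (θ' s + e s * θ s)) s := fun s => by
    refine (((hE s).cexp).mul (hθ s)).congr_deriv ?_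
    ring
  have h2 : ∫ s in (0:ℝ)..y, Complex.exp (E s) * (θ' s + e s * θ s)
      = Complex.exp (E y) * θ y - Complex.exp (E 0) * θ 0 :=
    intervalIntegral.integral_eq_sub_of_hasDerivAt (fun s _ => h1 s)
      (Continuous.intervalIntegrable
        ((Complex.continuous_exp.comp hEc).mul (hθ'.add (he.mul hθc))) _ _)
  have : Complex.exp (-E y) * Complex.exp (E y) = 1 := by rw [← Complex.exp_add]; simp
  simp only [Pfn]
  rw [h2, hE0, Complex.exp_zero]
  linear_combination (-θ y) * this

section bounds
variable {W : ℝ → ℝ} {E : ℝ → ℂ} {q : ℝ}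

lemma norm_exp_le (hq : ∀ s y, 0 ≤ s → s ≤ y → q * (y - s) ≤ (E y - E s).re) {s y : ℝ}
    (hs : 0 ≤ s) (hsy : s ≤ y) : ‖Complex.exp (-E y) * Complex.exp (E s)‖ ≤ Real.exp (-(q * (y - s))) := by
  rw [← Complex.exp_add, Complex.norm_exp]
  apply Real.exp_le_exp.2
  have := hq s y hs hsy
  simp only [Complex.add_re, Complex.neg_re, Complex.sub_re] at this ⊢
  linarith

lemma Pfn_bound (hEc : Continuous E) (hWc : Continuous W)
    (hq : ∀ s y, 0 ≤ s → s ≤ y → q * (y - s) ≤ (E y - E s).re) {c : ℝ}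
    (hW1 : ∀ y, 0 ≤ y → ∫ s in (0:ℝ)..y, Real.exp (-(q * (y - s))) * W s ≤ c * W y)
    {r : ℝ → ℂ} {K : ℝ} (hK : 0 ≤ K)
    (hbd : ∀ y, 0 ≤ y → ‖r y‖ ≤ K * W y) {y : ℝ} (hy : 0 ≤ y) :
    ‖Pfn E r y‖ ≤ c * K * W y := by
  have : Pfn E r y = ∫ s in (0:ℝ)..y, Complex.exp (-E y) * Complex.exp (E s) * r s := by
    rw [Pfn, ← intervalIntegral.integral_const_mul]
    simp only [mul_assoc]
  rw [this]
  calc _ ≤ ∫ s in (0:ℝ)..y, K * (Real.exp (-(q * (y - s))) * W s) := by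
        refine intervalIntegral.norm_integral_le_of_norm_le hy ?_ ?_
        · refine Eventually.of_forall fun s hs => ?_
          rw [norm_mul]
          calc _ ≤ Real.exp (-(q * (y - s))) * (K * W s) := by
                gcongr
                · exact norm_exp_le hq hs.1.le hs.2
                · exact hbd s hs.1.le
            _ = _ := by ring
        · apply Continuous.intervalIntegrable
          fun_prop
    _ = K * ∫ s in (0:ℝ)..y, Real.exp (-(q * (y - s))) * W s := intervalIntegral.integral_const_mul _ _
    _ ≤ K * (c * W y) := by gcongr; exact hW1 y hy
    _ = _ := by ring

lemma Qint (hEc : Continuous E) (hq0 : 0 < q) (hWa : Antitone W) (hW : ∀ y, 0 < W y)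
    (hq : ∀ s y, 0 ≤ s → s ≤ y → q * (y - s) ≤ (E y - E s).re)
    {r : ℝ → ℂ} (hr : Continuous r) {K : ℝ} (hK : 0 ≤ K)
    (hbd : ∀ y, 0 ≤ y → ‖r y‖ ≤ K * W y) :
    IntegrableOn (fun s => Complex.exp (-E s) * r s) (Ioi 0) := by
  have hi : IntegrableOn (fun s => Real.exp (-(E 0).re) * K * W 0 * Real.exp (-q * s)) (Ioi 0) :=
    (integrableOn_exp_mul_Ioi (by linarith) 0).const_mul _
  refine hi.mono' ?_ ?_
  · exact ((Complex.continuous_exp.comp hEc.neg).mul hr).aestronglyMeasurable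
  · refine (ae_restrict_mem measurableSet_Ioi).mono fun s hs => ?_
    have hs : 0 ≤ s := le_of_lt hs
    rw [norm_mul, Complex.norm_exp]
    have h1 : ‖r s‖ ≤ K * W 0 := (hbd s hs).trans (by gcongr; exact hWa hs)
    have h2 : (-E s).re ≤ -(E 0).re + -q * s := by
      have := hq 0 s le_rfl hs
      simp only [Complex.neg_re, Complex.sub_re] at this ⊢
      linarith
    have h3 := Real.exp_le_exp.2 h2
    rw [Real.exp_add] at h3
    calc _ ≤ (Real.exp (-(E 0).re) * Real.exp (-q * s)) * (K * W 0) := by gcongr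
      _ = _ := by ring

lemma Qfn_eq (hEc : Continuous E) (hq0 : 0 < q) (hWa : Antitone W) (hW : ∀ y, 0 < W y)
    (hq : ∀ s y, 0 ≤ s → s ≤ y → q * (y - s) ≤ (E y - E s).re)
    {r : ℝ → ℂ} (hr : Continuous r) {K : ℝ} (hK : 0 ≤ K)
    (hbd : ∀ y, 0 ≤ y → ‖r y‖ ≤ K * W y) {y : ℝ} (hy : 0 ≤ y) :
    Qfn E r y = ∫ s in Ioi y, Complex.exp (E y) * (Complex.exp (-E s) * r s) := by
  have hi := Qint hEc hq0 hWa hW hq hr hK hbd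
  rw [integral_const_mul, Qfn]
  congr 1
  rw [sub_eq_iff_eq_add, add_comm]
  exact (intervalIntegral.integral_interval_add_Ioi hi (hi.mono_set (Ioi_subset_Ioi hy))).symm

lemma Qfn_bound (hEc : Continuous E) (hq0 : 0 < q) (hWa : Antitone W) (hW : ∀ y, 0 < W y)
    (hq : ∀ s y, 0 ≤ s → s ≤ y → q * (y - s) ≤ (E y - E s).re)
    {r : ℝ → ℂ} (hr : Continuous r) {K : ℝ} (hK : 0 ≤ K)
    (hbd : ∀ y, 0 ≤ y → ‖r y‖ ≤ K * W y) {y : ℝ} (hy : 0 ≤ y) :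
    ‖Qfn E r y‖ ≤ q⁻¹ * K * W y := by
  rw [Qfn_eq hEc hq0 hWa hW hq hr hK hbd hy]
  have hintg : ∫ s in Ioi y, Real.exp (-q * s) = Real.exp (-q * y) / q := by
    rw [integral_exp_mul_Ioi (by linarith : -q < 0) y]
    field_simp
  have h1 : Real.exp (q * y) * Real.exp (-q * y) = 1 := by rw [← Real.exp_add]; simp
  calc _ ≤ ∫ s in Ioi y, (Real.exp (q * y) * K * W y) * Real.exp (-q * s) := by
        refine norm_integral_le_of_norm_le
          ((integrableOn_exp_mul_Ioi (by linarith) y).const_mul _) ?_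
        refine (ae_restrict_mem measurableSet_Ioi).mono fun s hs => ?_
        have hs' : y ≤ s := le_of_lt hs
        have h2 := norm_exp_le hq hy hs'
        rw [show -(q * (s - y)) = q * y + -q * s by ring, Real.exp_add] at h2
        rw [← mul_assoc, norm_mul, mul_comm (Complex.exp (E y))]
        have h3 : ‖r s‖ ≤ K * W y := (hbd s (hy.trans hs')).trans (by gcongr; exact hWa hs')
        calc _ ≤ (Real.exp (q * y) * Real.exp (-q * s)) * (K * W y) := by gcongr
          _ = _ := by ring
    _ = _ := by
        rw [integral_const_mul, hintg]
        linear_combination (q⁻¹ * K * W y) * h1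

/-- Reproducing formula for the backward operator. -/
lemma Qfn_repr {e z z' : ℝ → ℂ} (hE : ∀ y, HasDerivAt E (e y) y) (he : Continuous e)
    (hq0 : 0 < q) (hWa : Antitone W) (hW : ∀ y, 0 < W y)
    (hq : ∀ s y, 0 ≤ s → s ≤ y → q * (y - s) ≤ (E y - E s).re)
    (hz : ∀ y, HasDerivAt z (z' y) y) (hz' : Continuous z') {K : ℝ} (hK : 0 ≤ K)
    (hbd : ∀ y, 0 ≤ y → ‖z y‖ ≤ K * W y) (hbd' : ∀ y, 0 ≤ y → ‖e y * z y - z' y‖ ≤ K * W y)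
    {y : ℝ} (hy : 0 ≤ y) :
    z y = Qfn E (fun s => e s * z s - z' s) y := by
  have hEc : Continuous E := continuous_iff_continuousAt.2 fun y => (hE y).continuousAt
  have hzc : Continuous z := continuous_iff_continuousAt.2 fun y => (hz y).continuousAt
  have hr : Continuous (fun s => e s * z s - z' s) := (he.mul hzc).sub hz'
  have hi := Qint hEc hq0 hWa hW hq hr hK hbd'
  have h1 : ∀ s, HasDerivAt (fun s => -(Complex.exp (-E s) * z s))
      (Complex.exp (-E s) * (e s * z s - z' s)) s := fun s => by
    refine (((hE s).neg.cexp).mul (hz s)).neg.congr_deriv ?_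
    simp only [Pi.neg_apply]
    ring
  have hlim : Tendsto (fun s => -(Complex.exp (-E s) * z s)) atTop (nhds 0) := by
    rw [tendsto_zero_iff_norm_tendsto_zero]
    have h0 : Tendsto (fun s => Real.exp (-(E 0).re) * K * W 0 * Real.exp (-(q * s))) atTop (nhds 0) := by
      have : Tendsto (fun s : ℝ => Real.exp (-(q * s))) atTop (nhds 0) :=
        Real.tendsto_exp_neg_atTop_nhds_zero.comp (tendsto_id.const_mul_atTop hq0)
      simpa using this.const_mul (Real.exp (-(E 0).re) * K * W 0)
    refine squeeze_zero' (Eventually.of_forall fun _ => norm_nonneg _) ?_ h0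
    filter_upwards [eventually_ge_atTop 0] with s hs
    rw [norm_neg, norm_mul, Complex.norm_exp]
    have h1 : ‖z s‖ ≤ K * W 0 := (hbd s hs).trans (by gcongr; exact hWa hs)
    have h2 : (-E s).re ≤ -(E 0).re + -(q * s) := by
      have := hq 0 s le_rfl hs
      simp only [Complex.neg_re, Complex.sub_re] at this ⊢
      linarith
    have h3 := Real.exp_le_exp.2 h2
    rw [Real.exp_add] at h3
    calc _ ≤ (Real.exp (-(E 0).re) * Real.exp (-(q * s))) * (K * W 0) := by gcongr
      _ = _ := by ring
  have h2 : ∫ s in Ioi y, Complex.exp (-E s) * (e s * z s - z' s) = 0 - -(Complex.exp (-E y) * z y) :=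
    integral_Ioi_of_hasDerivAt_of_tendsto (h1 y).continuousAt.continuousWithinAt
      (fun s _ => h1 s) (hi.mono_set (Ioi_subset_Ioi hy)) hlim
  rw [Qfn_eq hEc hq0 hWa hW hq hr hK hbd' hy, integral_const_mul, h2]
  have : Complex.exp (E y) * Complex.exp (-E y) = 1 := by rw [← Complex.exp_add]; simp
  linear_combination (-z y) * this

lemma exists_Pop (hEd : ∃ e : ℝ → ℂ, ∀ y, HasDerivAt E (e y) y) (hWc : Continuous W) (hW : ∀ y, 0 < W y)
    (hq : ∀ s y, 0 ≤ s → s ≤ y → q * (y - s) ≤ (E y - E s).re) {c : ℝ} (hc : 0 ≤ c)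
    (hW1 : ∀ y, 0 ≤ y → ∫ s in (0:ℝ)..y, Real.exp (-(q * (y - s))) * W s ≤ c * W y) :
    ∃ L : XSp →L[ℂ] XSp, ‖L‖ ≤ c ∧ ∀ x y, 0 ≤ y → wx W (L x) y = Pfn E (wx W x) y := by
  obtain ⟨e, hE⟩ := hEd
  have hEc : Continuous E := continuous_iff_continuousAt.2 fun y => (hE y).continuousAt
  refine exists_op W hWc hW (fun x => Pfn E (wx W x)) c hc ?_ ?_ ?_ ?_
  · intro x x' y
    simp only [Pfn, wx_add, mul_add]
    rw [intervalIntegral.integral_add, mul_add]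
    · exact ((Complex.continuous_exp.comp hEc).mul (wx_continuous hWc x)).intervalIntegrable _ _
    · exact ((Complex.continuous_exp.comp hEc).mul (wx_continuous hWc x')).intervalIntegrable _ _
  · intro a x y
    simp only [Pfn, wx_smul]
    simp only [mul_left_comm _ a]
    rw [intervalIntegral.integral_const_mul]
    ring
  · intro x
    exact continuous_iff_continuousAt.2 fun y =>
      (Pfn_hasDerivAt hE (wx_continuous hWc x) y).continuousAt
  · intro x y hy
    exact Pfn_bound hEc hWc hq hW1 (norm_nonneg x) (fun y _ => wx_norm_le hW x y) hy

lemma exists_Qop (hEd : ∃ e : ℝ → ℂ, ∀ y, HasDerivAt E (e y) y) (hWc : Continuous W) (hW : ∀ y, 0 < W y)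
    (hWa : Antitone W) (hq0 : 0 < q)
    (hq : ∀ s y, 0 ≤ s → s ≤ y → q * (y - s) ≤ (E y - E s).re) :
    ∃ L : XSp →L[ℂ] XSp, ‖L‖ ≤ q⁻¹ ∧ ∀ x y, 0 ≤ y → wx W (L x) y = Qfn E (wx W x) y := by
  obtain ⟨e, hE⟩ := hEd
  have hEc : Continuous E := continuous_iff_continuousAt.2 fun y => (hE y).continuousAt
  have hI : ∀ x, IntegrableOn (fun s => Complex.exp (-E s) * wx W x s) (Ioi 0) := fun x =>
    Qint hEc hq0 hWa hW hq (wx_continuous hWc x) (norm_nonneg x) (fun y _ => wx_norm_le hW x y)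
  refine exists_op W hWc hW (fun x => Qfn E (wx W x)) q⁻¹ (by positivity) ?_ ?_ ?_ ?_
  · intro x x' y
    simp only [Qfn, wx_add, mul_add]
    rw [intervalIntegral.integral_add, integral_add (hI x) (hI x')]
    · ring
    · exact ((Complex.continuous_exp.comp hEc.neg).mul (wx_continuous hWc x)).intervalIntegrable _ _
    · exact ((Complex.continuous_exp.comp hEc.neg).mul (wx_continuous hWc x')).intervalIntegrable _ _
  · intro a x y
    simp only [Qfn, wx_smul, mul_left_comm _ a]
    rw [intervalIntegral.integral_const_mul, integral_const_mul]
    ring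
  · intro x
    exact continuous_iff_continuousAt.2 fun y =>
      (Qfn_hasDerivAt hE (wx_continuous hWc x) y).continuousAt
  · intro x y hy
    exact Qfn_bound hEc hq0 hWa hW hq (wx_continuous hWc x) (norm_nonneg x)
      (fun y _ => wx_norm_le hW x y) hy

lemma wx_integrable (hWc : Continuous W) (hW : ∀ y, 0 < W y)
    (hWi : IntegrableOn W (Ioi 0)) (x : XSp) : IntegrableOn (wx W x) (Ioi 0) :=
  (hWi.const_mul ‖x‖).mono' (wx_continuous hWc x).aestronglyMeasurable
    (Eventually.of_forall fun s => wx_norm_le hW x s)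

lemma wx_prim_bound (hWc : Continuous W) (hW : ∀ y, 0 < W y)
    (hWi : IntegrableOn W (Ioi 0)) {I : ℝ} (hI : ∫ s in Ioi (0:ℝ), W s ≤ I) (x : XSp) {y : ℝ}
    (hy : 0 ≤ y) : ‖∫ s in (0:ℝ)..y, wx W x s‖ ≤ I * ‖x‖ := by
  calc _ ≤ ∫ s in (0:ℝ)..y, ‖x‖ * W s :=
        intervalIntegral.norm_integral_le_of_norm_le hy
          (Eventually.of_forall fun s _ => wx_norm_le hW x s)
          ((hWc.const_mul _).intervalIntegrable _ _)
    _ = ‖x‖ * ∫ s in (0:ℝ)..y, W s := intervalIntegral.integral_const_mul _ _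
    _ ≤ ‖x‖ * I := by
        gcongr
        refine le_trans ?_ hI
        rw [intervalIntegral.integral_of_le hy]
        exact setIntegral_mono_set hWi (Eventually.of_forall fun s => (hW s).le)
          (LE.le.eventuallyLE Ioc_subset_Ioi_self)
    _ = _ := mul_comm _ _

lemma exists_Gop (hWc : Continuous W) (hW : ∀ y, 0 < W y)
    (hWi : IntegrableOn W (Ioi 0)) {I : ℝ} (hI : ∫ s in Ioi (0:ℝ), W s ≤ I) (hI0 : 0 ≤ I)
    {b : ℝ → ℂ} (hb : Continuous b) {K : ℝ} (hK : 0 ≤ K) (hbd : ∀ y, 0 ≤ y → ‖b y‖ ≤ K * W y) :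
    ∃ L : XSp →L[ℂ] XSp, ‖L‖ ≤ K * I ∧
      ∀ x y, 0 ≤ y → wx W (L x) y = b y * ∫ s in (0:ℝ)..y, wx W x s := by
  have hc := fun x => wx_continuous hWc x
  refine exists_op W hWc hW (fun x y => b y * ∫ s in (0:ℝ)..y, wx W x s) (K * I) (by positivity)
    ?_ ?_ ?_ ?_
  · intro x x' y
    simp only [wx_add]
    rw [intervalIntegral.integral_add ((hc x).intervalIntegrable _ _)
      ((hc x').intervalIntegrable _ _), mul_add]
  · intro a x y
    simp only [wx_smul]
    rw [intervalIntegral.integral_const_mul]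
    ring
  · intro x
    refine hb.mul (intervalIntegral.continuous_primitive
      (fun a b => (hc x).intervalIntegrable _ _) _)
  · intro x y hy
    rw [norm_mul]
    calc _ ≤ (K * W y) * (I * ‖x‖) := by
          have := wx_prim_bound hWc hW hWi hI x hy
          have := hbd y hy
          have := hW y
          gcongr
      _ = _ := by ring

lemma exists_ell (hWc : Continuous W) (hW : ∀ y, 0 < W y)
    (hWi : IntegrableOn W (Ioi 0)) {I : ℝ} (hI : ∫ s in Ioi (0:ℝ), W s ≤ I) (hI0 : 0 ≤ I) :
    ∃ L : XSp →L[ℂ] ℂ, ‖L‖ ≤ I ∧ ∀ x, L x = ∫ s in Ioi (0:ℝ), wx W x s := by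
  let L0 : XSp →ₗ[ℂ] ℂ :=
    { toFun := fun x => ∫ s in Ioi (0:ℝ), wx W x s
      map_add' := fun x x' => by
        simp only [wx_add]
        exact integral_add (wx_integrable hWc hW hWi x) (wx_integrable hWc hW hWi x')
      map_smul' := fun a x => by
        simp only [wx_smul, RingHom.id_apply, smul_eq_mul]
        exact integral_const_mul _ _ }
  refine ⟨L0.mkContinuous I (fun x => ?_), LinearMap.mkContinuous_norm_le _ hI0 _, fun x => rfl⟩
  show ‖∫ s in Ioi (0:ℝ), wx W x s‖ ≤ _
  refine le_of_tendsto (intervalIntegral_tendsto_integral_Ioi 0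
    (wx_integrable hWc hW hWi x) tendsto_id).norm ?_
  filter_upwards [eventually_ge_atTop 0] with y hy
  exact wx_prim_bound hWc hW hWi hI x hy

end bounds

/-! ### The boundary layer weight -/

/-- Weight adapted to boundary layers of size `1/q`. -/
def blW (δ q y : ℝ) : ℝ := Real.exp (-δ * y) + q * Real.exp (-(q/2) * y)

lemma blW_continuous (δ q : ℝ) : Continuous (blW δ q) := by
  unfold blW; fun_prop

lemma blW_pos {δ q : ℝ} (hq : 0 < q) (y : ℝ) : 0 < blW δ q y := by
  unfold blW; positivity

lemma blW_antitone {δ q : ℝ} (hδ : 0 < δ) (hq : 0 < q) : Antitone (blW δ q) := by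
  intro a b hab
  unfold blW
  have h1 : -δ * b ≤ -δ * a := by nlinarith
  have h2 : -(q/2) * b ≤ -(q/2) * a := by nlinarith
  gcongr

lemma exp_le_blW {δ q : ℝ} (hq : 0 < q) (y : ℝ) : Real.exp (-δ * y) ≤ blW δ q y := by
  unfold blW
  have := Real.exp_pos (-(q/2) * y)
  nlinarith

lemma qexp_le_blW {δ q : ℝ} (hq : 0 < q) {y : ℝ} (hy : 0 ≤ y) : q * Real.exp (-(q * y)) ≤ blW δ q y := by
  unfold blW
  have h1 : Real.exp (-(q * y)) ≤ Real.exp (-(q/2) * y) := Real.exp_le_exp.2 (by nlinarith)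
  have h2 := Real.exp_pos (-δ * y)
  nlinarith

lemma blW_integrable {δ q : ℝ} (hδ : 0 < δ) (hq : 0 < q) : IntegrableOn (blW δ q) (Ioi 0) := by
  unfold blW
  exact (integrableOn_exp_mul_Ioi (by linarith) 0).add
    ((integrableOn_exp_mul_Ioi (by linarith) 0).const_mul q)

lemma blW_integral {δ q : ℝ} (hδ : 0 < δ) (hq : 0 < q) :
    ∫ s in Ioi (0:ℝ), blW δ q s ≤ 1 / δ + 2 := by
  unfold blW
  rw [integral_add (integrableOn_exp_mul_Ioi (by linarith) 0)
    ((integrableOn_exp_mul_Ioi (by linarith) 0).const_mul q), integral_const_mul,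
    integral_exp_mul_Ioi (by linarith), integral_exp_mul_Ioi (by linarith)]
  simp
  field_simp
  rfl

lemma conv_exp_le {q α : ℝ} (hq : 0 < q) (hα : α ≤ q / 2) {y : ℝ} (hy : 0 ≤ y) :
    ∫ s in (0:ℝ)..y, Real.exp (-(q * (y - s))) * Real.exp (-α * s) ≤ 2 / q * Real.exp (-α * y) := by
  have hpos : 0 < q - α := by linarith
  have h1 : ∀ s, HasDerivAt (fun s => Real.exp (-(q * (y - s))) * Real.exp (-α * s) / (q - α))
      (Real.exp (-(q * (y - s))) * Real.exp (-α * s)) s := by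
    intro s
    have ha : HasDerivAt (fun s => -(q * (y - s))) q s := by
      have := (((hasDerivAt_id s).const_sub y).const_mul q).neg
      refine this.congr_deriv ?_
      ring
    have hb : HasDerivAt (fun s => -α * s) (-α) s := by
      simpa using (hasDerivAt_id s).const_mul (-α)
    refine ((ha.exp.mul hb.exp).div_const (q - α)).congr_deriv ?_
    field_simp
    ring
  rw [intervalIntegral.integral_eq_sub_of_hasDerivAt (fun s _ => h1 s)
    (Continuous.intervalIntegrable (by fun_prop) _ _)]
  have h2 : Real.exp (-(q * (y - y))) * Real.exp (-α * y) / (q - α) ≤ 2 / q * Real.exp (-α * y) := by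
    simp only [sub_self, mul_zero, neg_zero, Real.exp_zero, one_mul]
    rw [div_eq_inv_mul]
    gcongr
    rw [inv_le_comm₀ hpos (by positivity), inv_div]
    linarith
  have h3 : 0 ≤ Real.exp (-(q * (y - 0))) * Real.exp (-α * 0) / (q - α) := by positivity
  linarith

lemma blW_conv {δ q : ℝ} (hδ : 0 < δ) (hq : 2 * δ ≤ q) {y : ℝ} (hy : 0 ≤ y) :
    ∫ s in (0:ℝ)..y, Real.exp (-(q * (y - s))) * blW δ q s ≤ 2 / q * blW δ q y := by
  have hq0 : 0 < q := by linarith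
  unfold blW
  have h1 := conv_exp_le hq0 (by linarith : δ ≤ q / 2) hy
  have h2 := conv_exp_le hq0 (le_refl (q/2)) hy
  have : ∫ s in (0:ℝ)..y, Real.exp (-(q * (y - s))) * (Real.exp (-δ * s) + q * Real.exp (-(q/2) * s))
      = (∫ s in (0:ℝ)..y, Real.exp (-(q * (y - s))) * Real.exp (-δ * s))
        + q * ∫ s in (0:ℝ)..y, Real.exp (-(q * (y - s))) * Real.exp (-(q/2) * s) := by
    rw [← intervalIntegral.integral_const_mul, ← intervalIntegral.integral_add]
    · congr 1; ext s; ring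
    · exact Continuous.intervalIntegrable (by fun_prop) _ _
    · exact Continuous.intervalIntegrable (by fun_prop) _ _
  rw [this]
  nlinarith

/-! ### Abstract Hurwitz-type argument -/

/-- If `f n → g` uniformly near `0`, `g` has an isolated zero at `0`, then `f n` has zeros
converging to `0`. -/
lemma hurwitz_zeros {r : ℝ} (hr : 0 < r) (f : ℕ → ℂ → ℂ) (g : ℂ → ℂ) (K : ℕ) (ε : ℕ → ℝ)
    (hε : Tendsto ε atTop (nhds 0))
    (hf : ∀ n, K ≤ n → DifferentiableOn ℂ (f n) (Metric.ball 0 r))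
    (hg : ContinuousOn g (Metric.ball 0 r)) (hg0 : g 0 = 0)
    (hiso : ∀ᶠ z in nhdsWithin (0:ℂ) {0}ᶜ, g z ≠ 0)
    (hfg : ∀ n, K ≤ n → ∀ z ∈ Metric.ball (0:ℂ) r, ‖f n z - g z‖ ≤ ε n) :
    ∃ (N : ℕ) (ν : ℕ → ℂ), Tendsto ν atTop (nhds 0) ∧ ∀ n, N ≤ n → ν n ∈ Metric.ball (0:ℂ) r ∧ f n (ν n) = 0 := by
  -- a zero in every small ball, for large n
  have key : ∀ η : ℝ, 0 < η → ∀ᶠ n in atTop, ∃ z, ‖z‖ < η ∧ z ∈ Metric.ball (0:ℂ) r ∧ f n z = 0 := by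
    intro η hη
    rw [eventually_nhdsWithin_iff, Metric.eventually_nhds_iff] at hiso
    obtain ⟨ρ, hρ, hiso⟩ := hiso
    set s := min (min (ρ/2) (r/2)) (η/2) with hs
    have hs0 : 0 < s := by positivity
    have hsρ : s < ρ := lt_of_le_of_lt ((min_le_left _ _).trans (min_le_left _ _)) (by linarith)
    have hsr : s < r := lt_of_le_of_lt ((min_le_left _ _).trans (min_le_right _ _)) (by linarith)
    have hsη : s < η := lt_of_le_of_lt (min_le_right _ _) (by linarith)
    have hsub : Metric.closedBall (0:ℂ) s ⊆ Metric.ball 0 r := Metric.closedBall_subset_ball hsr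
    have hcomp : IsCompact (Metric.sphere (0:ℂ) s) := isCompact_sphere _ _
    have hne : (Metric.sphere (0:ℂ) s).Nonempty := NormedSpace.sphere_nonempty.2 hs0.le
    obtain ⟨z0, hz0, hmin⟩ := hcomp.exists_isMinOn hne
      ((hg.mono (Metric.sphere_subset_closedBall.trans hsub)).norm)
    have hm : 0 < ‖g z0‖ := by
      refine norm_pos_iff.2 (hiso ?_ ?_)
      · rw [mem_sphere_iff_norm, sub_zero] at hz0
        rw [dist_zero_right, hz0]; exact hsρ
      · rw [mem_sphere_iff_norm, sub_zero] at hz0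
        intro h
        rw [mem_singleton_iff] at h
        rw [h, norm_zero] at hz0
        exact hs0.ne hz0
    set m := ‖g z0‖
    filter_upwards [eventually_ge_atTop K, hε.eventually (gt_mem_nhds (show (0:ℝ) < m/3 by positivity))]
      with n hn hεn
    by_contra hcon
    push Not at hcon
    have hnz : ∀ z ∈ Metric.closedBall (0:ℂ) s, f n z ≠ 0 := by
      intro z hz
      refine hcon z ?_ (hsub hz)
      rw [mem_closedBall_zero_iff] at hz
      linarith
    have hd : DifferentiableOn ℂ (fun z => (f n z)⁻¹) (Metric.closedBall 0 s) :=
      ((hf n hn).mono hsub).inv hnz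
    have hdc : DiffContOnCl ℂ (fun z => (f n z)⁻¹) (Metric.ball 0 s) := by
      apply DifferentiableOn.diffContOnCl
      rwa [closure_ball _ hs0.ne']
    have hb := Complex.norm_le_of_forall_mem_frontier_norm_le (C := 3 / (2 * m)) Metric.isBounded_ball hdc
      (fun z hz => by
        rw [frontier_ball _ hs0.ne'] at hz
        have h1 : m ≤ ‖g z‖ := hmin hz
        have h2 := hfg n hn z (hsub (Metric.sphere_subset_closedBall hz))
        have h3 : ‖g z‖ - ‖f n z‖ ≤ ‖f n z - g z‖ := by
          rw [norm_sub_rev]; exact norm_sub_norm_le _ _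
        rw [norm_inv, inv_le_comm₀ (norm_pos_iff.2 (hnz z (Metric.sphere_subset_closedBall hz))) (by positivity),
          inv_div]
        linarith) (subset_closure (Metric.mem_ball_self hs0))
    have h4 := hfg n hn 0 (Metric.mem_ball_self hr)
    rw [hg0, sub_zero] at h4
    rw [norm_inv, inv_le_comm₀ (norm_pos_iff.2 (hnz 0 (Metric.mem_closedBall_self hs0.le))) (by positivity),
      inv_div] at hb
    linarith
  -- pick an almost optimal zero
  classical
  have key1 := key r hr
  obtain ⟨N, hN⟩ := eventually_atTop.1 key1
  have hch : ∀ n, ∃ z : ℂ, (N ≤ n → z ∈ Metric.ball (0:ℂ) r ∧ f n z = 0) ∧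
      (K ≤ n → ∀ z', z' ∈ Metric.ball (0:ℂ) r → f n z' = 0 → ‖z‖ ≤ 2 * ‖z'‖) := by
    intro n
    by_cases hKn : K ≤ n
    swap
    · by_cases h : N ≤ n
      · obtain ⟨z, _, hz⟩ := hN n h
        exact ⟨z, fun _ => hz, fun h' => absurd h' hKn⟩
      · exact ⟨0, fun h' => absurd h' h, fun h' => absurd h' hKn⟩
    by_cases hn : ∃ z, z ∈ Metric.ball (0:ℂ) r ∧ f n z = 0
    · by_cases h0 : f n 0 = 0
      · exact ⟨0, fun _ => ⟨Metric.mem_ball_self hr, h0⟩, fun _ z' _ _ => by simp⟩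
      · set S := (fun z : ℂ => ‖z‖) '' {z | z ∈ Metric.ball (0:ℂ) r ∧ f n z = 0}
        have hSne : S.Nonempty := by obtain ⟨z, hz⟩ := hn; exact ⟨‖z‖, z, hz, rfl⟩
        have hSb : BddBelow S := ⟨0, by rintro _ ⟨z, _, rfl⟩; exact norm_nonneg z⟩
        have hI0 : 0 ≤ sInf S := le_csInf hSne (by rintro _ ⟨z, _, rfl⟩; exact norm_nonneg z)
        by_cases hI : sInf S = 0
        · -- zeros accumulate at 0, impossible by continuity
          exfalso
          have hcont : ContinuousAt (f n) 0 :=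
            ((hf n hKn).continuousOn).continuousAt (Metric.ball_mem_nhds 0 hr)
          have hev := hcont.eventually_ne h0
          rw [Metric.eventually_nhds_iff] at hev
          obtain ⟨ρ, hρ, hev⟩ := hev
          obtain ⟨_, ⟨z, hz, rfl⟩, hlt⟩ := exists_lt_of_csInf_lt hSne (by rw [hI]; exact hρ : sInf S < ρ)
          exact hev (by simpa using hlt) hz.2
        · obtain ⟨_, ⟨z, hz, rfl⟩, hlt⟩ := exists_lt_of_csInf_lt hSne
            (show sInf S < 2 * sInf S by have := lt_of_le_of_ne hI0 (Ne.symm hI); linarith)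
          refine ⟨z, fun _ => hz, fun _ z' h1 h2 => hlt.le.trans ?_⟩
          have := csInf_le hSb ⟨z', ⟨h1, h2⟩, rfl⟩
          simpa using this
    · refine ⟨0, fun h => ?_, fun _ z' h1 h2 => absurd ⟨z', h1, h2⟩ hn⟩
      obtain ⟨z, _, hz⟩ := hN n h
      exact absurd ⟨z, hz⟩ hn
  choose ν hν1 hν2 using hch
  refine ⟨N, ν, ?_, hν1⟩
  rw [Metric.tendsto_atTop]
  intro η hη
  obtain ⟨M, hM⟩ := eventually_atTop.1 (key (η/2) (by positivity))
  refine ⟨max M K, fun n hn => ?_⟩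
  obtain ⟨z, hz1, hz2, hz3⟩ := hM n ((le_max_left _ _).trans hn)
  have := hν2 n ((le_max_right _ _).trans hn) z hz2 hz3
  rw [dist_zero_right]
  linarith

lemma Pfn_congr {E r r' : ℝ → ℂ} {y : ℝ} (hy : 0 ≤ y) (h : ∀ s, 0 ≤ s → r s = r' s) :
    Pfn E r y = Pfn E r' y := by
  unfold Pfn
  congr 1
  refine intervalIntegral.integral_congr fun s hs => ?_
  rw [uIcc_of_le hy] at hs
  simp only [h s hs.1]

lemma Qfn_congr {E r r' : ℝ → ℂ} {y : ℝ} (hy : 0 ≤ y) (h : ∀ s, 0 ≤ s → r s = r' s) :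
    Qfn E r y = Qfn E r' y := by
  unfold Qfn
  congr 2
  · refine setIntegral_congr_fun measurableSet_Ioi fun s hs => ?_
    simp only [h s (le_of_lt hs)]
  · refine intervalIntegral.integral_congr fun s hs => ?_
    rw [uIcc_of_le hy] at hs
    simp only [h s hs.1]

lemma exists_Mop {W : ℝ → ℝ} (hWc : Continuous W) (hW : ∀ y, 0 < W y)
    {b : ℝ → ℂ} (hb : Continuous b) {K : ℝ} (hK : 0 ≤ K) (hbd : ∀ y, 0 ≤ y → ‖b y‖ ≤ K) :
    ∃ L : XSp →L[ℂ] XSp, ‖L‖ ≤ K ∧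
      ∀ x y, 0 ≤ y → wx W (L x) y = b y * wx W x y := by
  refine exists_op W hWc hW (fun x y => b y * wx W x y) K hK ?_ ?_ ?_ ?_
  · intro x x' y
    simp only [wx_add]; ring
  · intro a x y
    simp only [wx_smul]; ring
  · intro x
    exact hb.mul (wx_continuous hWc x)
  · intro x y hy
    rw [norm_mul, mul_assoc]
    exact mul_le_mul (hbd y hy) (wx_norm_le hW x y) (norm_nonneg _) hK

/-- Perturbation of the identity: analytic resolvent family. -/
lemma resolvent_family {V : Type*} [NormedAddCommGroup V] [NormedSpace ℂ V] [CompleteSpace V]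
    (A B : V →L[ℂ] V) (S : V) {r α : ℝ} (hα : ‖A‖ ≤ α) (hα0 : 0 < α)
    (hB : ‖B‖ ≤ 1/4) (hr : r * α ≤ 1/4) :
    ∃ X : ℂ → V, DifferentiableOn ℂ X (Metric.ball 0 r) ∧
      ∀ ν ∈ Metric.ball (0:ℂ) r, X ν = S + B (X ν) + ν • A (X ν) ∧
        ∀ x : V, ‖X ν - x‖ ≤ 2 * ‖S + B x + ν • A x - x‖ := by
  have hn : ∀ ν ∈ Metric.ball (0:ℂ) r, ‖B + ν • A‖ ≤ 1/2 := by
    intro ν hν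
    rw [mem_ball_zero_iff] at hν
    calc _ ≤ ‖B‖ + ‖ν • A‖ := norm_add_le _ _
      _ ≤ 1/4 + r * α := by
        rw [norm_smul]
        have := (norm_nonneg ν).trans hν.le
        gcongr
      _ ≤ 1/2 := by linarith
  have hlt : ∀ ν ∈ Metric.ball (0:ℂ) r, ‖B + ν • A‖ < 1 := fun ν hν => (hn ν hν).trans_lt (by norm_num)
  refine ⟨fun ν => (Ring.inverse (1 - (B + ν • A))) S, ?_, ?_⟩
  · intro ν hν
    apply DifferentiableAt.differentiableWithinAt
    have h1 : DifferentiableAt ℂ (fun ν : ℂ => (1 : V →L[ℂ] V) - (B + ν • A)) ν := by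
      exact ((differentiableAt_id.smul_const A).const_add B).const_sub 1
    have h2 : DifferentiableAt ℂ (Ring.inverse : (V →L[ℂ] V) → _) (1 - (B + ν • A)) := by
      have := differentiableAt_inverse (𝕜 := ℂ) (Units.oneSub (B + ν • A) (hlt ν hν)).isUnit
      simpa using this
    have h3 : DifferentiableAt ℂ (fun ν : ℂ => Ring.inverse ((1 : V →L[ℂ] V) - (B + ν • A))) ν :=
      DifferentiableAt.comp (g := Ring.inverse) ν h2 h1
    exact h3.clm_apply (differentiableAt_const S)
  · intro ν hν
    have hu : IsUnit ((1 : V →L[ℂ] V) - (B + ν • A)) := (Units.oneSub (B + ν • A) (hlt ν hν)).isUnit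
    set X := (Ring.inverse ((1 : V →L[ℂ] V) - (B + ν • A))) S with hX
    have h1 : X = S + B X + ν • A X := by
      have h := Ring.mul_inverse_cancel _ hu
      have h' : X - (B X + ν • A X) = S := congrArg (fun T : V →L[ℂ] V => T S) h
      rw [sub_eq_iff_eq_add] at h'
      rw [add_assoc]
      exact h'
    refine ⟨h1, fun x => ?_⟩
    have h2 : X - x = (B + ν • A) (X - x) + (S + B x + ν • A x - x) := by
      have : (B + ν • A) (X - x) = B X + ν • A X - (B x + ν • A x) := by
        simp [map_sub]
      rw [this]
      nth_rewrite 1 [h1]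
      abel
    have h3 : ‖X - x‖ ≤ 1/2 * ‖X - x‖ + ‖S + B x + ν • A x - x‖ := by
      conv_lhs => rw [h2]
      refine (norm_add_le _ _).trans ?_
      gcongr
      exact (ContinuousLinearMap.le_opNorm _ _).trans (by gcongr; exact hn ν hν)
    linarith

lemma re_incr {E e : ℝ → ℂ} {q : ℝ} (hE : ∀ y, HasDerivAt E (e y) y)
    (he : ∀ y, 0 ≤ y → q ≤ (e y).re) (s y : ℝ) (hs : 0 ≤ s) (hsy : s ≤ y) :
    q * (y - s) ≤ (E y - E s).re := by
  have hd : ∀ y, HasDerivAt (fun y => (E y).re) ((e y).re) y := fun y =>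
    (Complex.reCLM.hasFDerivAt.comp_hasDerivAt y (hE y))
  have := (convex_Ici (0:ℝ)).mul_sub_le_image_sub_of_le_deriv (f := fun y => (E y).re)
    (fun y _ => (hd y).continuousAt.continuousWithinAt)
    (fun y _ => (hd y).differentiableAt.differentiableWithinAt) (C := q)
    (fun y hy => by
      rw [(hd y).deriv]
      rw [interior_Ici] at hy
      exact he y (le_of_lt hy)) s hs y (hs.trans hsy) hsy
  simpa using this

lemma wx_neg (W : ℝ → ℝ) (x : XSp) (s : ℝ) : wx W (-x) s = - wx W x s := by
  simp [wx]

lemma wx_sub (W : ℝ → ℝ) (x y : XSp) (s : ℝ) : wx W (x - y) s = wx W x s - wx W y s := by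
  simp [wx, mul_sub]

/-- The right-hand side of the transformed viscous problem. -/
def rhoV (n n1 a b1 b2 b3 fs : ℝ → ℂ) (κ : ℝ) (ν : ℂ) (x : ℝ → ℂ) (s : ℝ) : ℂ :=
  ((κ:ℂ) * (n1 s - a s * n s) + b1 s) * x s + b2 s * (∫ t in (0:ℝ)..s, x t)
    - Complex.I * (κ:ℂ)^2 * ν * (x s - b3 s * ∫ t in (0:ℝ)..s, x t)
    + Complex.I * (κ:ℂ)^2 * fs s

set_option maxHeartbeats 1600000 in
lemma core_kappa {n n1 a b1 b2 b3 fs N Aa : ℝ → ℂ} {n0 δ C D α κ r : ℝ} (c0 : ℂ)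
    (hn : ∀ y, HasDerivAt n (n1 y) y) (hn1 : Continuous n1) (ha : Continuous a)
    (hb1 : Continuous b1) (hb2 : Continuous b2) (hb3 : Continuous b3) (hfs : Continuous fs)
    (hN : ∀ y, HasDerivAt N (n y) y) (hN0 : N 0 = 0) (hAa : ∀ y, HasDerivAt Aa (a y) y)
    (hn0 : 0 < n0) (hδ : 0 < δ) (hC : 0 ≤ C) (hD : D = 1/δ + 2)
    (hnre : ∀ y, 0 ≤ y → n0 ≤ (n y).re) (hnb : ∀ y, 0 ≤ y → ‖n y‖ ≤ C)
    (hn1b : ∀ y, 0 ≤ y → ‖n1 y‖ ≤ C * Real.exp (-δ * y))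
    (hab : ∀ y, 0 ≤ y → ‖a y‖ ≤ C * Real.exp (-δ * y))
    (hb1b : ∀ y, 0 ≤ y → ‖b1 y‖ ≤ C * Real.exp (-δ * y))
    (hb2b : ∀ y, 0 ≤ y → ‖b2 y‖ ≤ C * Real.exp (-δ * y))
    (hb3b : ∀ y, 0 ≤ y → ‖b3 y‖ ≤ C * Real.exp (-δ * y))
    (hfsb : ∀ y, 0 ≤ y → ‖fs y‖ ≤ C * Real.exp (-δ * y))
    (hα : α = 4 / n0^2 * (1 + C * D)) (hκ1 : 1 ≤ κ) (hκ2 : 2 * δ ≤ κ * n0)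
    (hκ3 : 2 * C ≤ κ * n0) (hβ : 4 / n0^2 * (2 * C + C^2 + C * D) ≤ κ / 4)
    (hr : r * α ≤ 1/4) :
    ∃ X : ℂ → XSp, ∃ ℓ : XSp →L[ℂ] ℂ,
      (∀ x, ℓ x = ∫ s in Ioi (0:ℝ), wx (blW δ (κ * n0)) x s) ∧
      DifferentiableOn ℂ X (Metric.ball 0 r) ∧
      ∀ ν ∈ Metric.ball (0:ℂ) r,
        (∀ y, 0 ≤ y → wx (blW δ (κ * n0)) (X ν) y = c0 * Complex.exp (-((κ:ℂ) * N y)) +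
          Pfn (fun y => (κ:ℂ) * N y) (fun s => - Qfn (fun y => (κ:ℂ) * N y + Aa y)
            (rhoV n n1 a b1 b2 b3 fs κ ν (wx (blW δ (κ * n0)) (X ν))) s) y) ∧
        ∀ (x0 t1 : ℝ → ℂ) (C4 : ℝ), 0 ≤ C4 → (∀ y, HasDerivAt x0 (t1 y) y) → Continuous t1 →
          (∀ y, 0 ≤ y → ‖x0 y‖ ≤ C4 * Real.exp (-δ * y)) →
          (∀ y, 0 ≤ y → ‖t1 y‖ ≤ C4 * Real.exp (-δ * y)) →
          (∀ y, 0 ≤ y → Complex.I * n y ^ 2 * x0 y + ν * (x0 y - b3 y * ∫ t in (0:ℝ)..y, x0 t)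
            = fs y) →
          ‖ℓ (X ν) - ∫ s in Ioi (0:ℝ), x0 s‖ ≤
            (2 * D * ((‖c0‖ + 3 * C4) / n0 + 4 / n0^2 * (2 * C * C4 + C * D * C4))) / κ := by
  set q := κ * n0 with hq
  set W := blW δ q with hWdef
  have hκ : 0 < κ := by linarith
  have hq0 : 0 < q := by positivity
  have hWc : Continuous W := blW_continuous δ q
  have hW : ∀ y, 0 < W y := fun y => blW_pos hq0 y
  have hWa : Antitone W := blW_antitone hδ hq0
  have hWi : IntegrableOn W (Ioi 0) := blW_integrable hδ hq0
  have hD0 : 0 ≤ D := by rw [hD]; positivity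
  have hWI : ∫ s in Ioi (0:ℝ), W s ≤ D := by rw [hD]; exact blW_integral hδ hq0
  have hexpW : ∀ y, Real.exp (-δ * y) ≤ W y := fun y => exp_le_blW hq0 y
  have hCW : ∀ (K : ℝ), 0 ≤ K → ∀ (f : ℝ → ℂ), (∀ y, 0 ≤ y → ‖f y‖ ≤ K * Real.exp (-δ * y)) →
      ∀ y, 0 ≤ y → ‖f y‖ ≤ K * W y := fun K hK f hf y hy =>
    (hf y hy).trans (mul_le_mul_of_nonneg_left (hexpW y) hK)
  have hC1 : ∀ (K : ℝ), 0 ≤ K → ∀ (f : ℝ → ℂ), (∀ y, 0 ≤ y → ‖f y‖ ≤ K * Real.exp (-δ * y)) →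
      ∀ y, 0 ≤ y → ‖f y‖ ≤ K := fun K hK f hf y hy =>
    (hf y hy).trans (mul_le_of_le_one_right hK (Real.exp_le_one_iff.2 (by nlinarith)))
  have hnc : Continuous n := continuous_iff_continuousAt.2 fun y => (hn y).continuousAt
  set E1 : ℝ → ℂ := fun y => (κ:ℂ) * N y with hE1
  set E2 : ℝ → ℂ := fun y => (κ:ℂ) * N y + Aa y with hE2
  have hE1d : ∀ y, HasDerivAt E1 ((κ:ℂ) * n y) y := fun y => (hN y).const_mul _
  have hE2d : ∀ y, HasDerivAt E2 ((κ:ℂ) * n y + a y) y := fun y => ((hN y).const_mul _).add (hAa y)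
  have hq1 : ∀ s y, 0 ≤ s → s ≤ y → q * (y - s) ≤ (E1 y - E1 s).re :=
    re_incr hE1d (fun y hy => by
      rw [Complex.re_ofReal_mul]; exact mul_le_mul_of_nonneg_left (hnre y hy) hκ.le)
  have hq2 : ∀ s y, 0 ≤ s → s ≤ y → (q/2) * (y - s) ≤ (E2 y - E2 s).re :=
    re_incr hE2d (fun y hy => by
      rw [Complex.add_re, Complex.re_ofReal_mul]
      have h1 := mul_le_mul_of_nonneg_left (hnre y hy) hκ.le
      have h2 := (Complex.abs_re_le_norm (a y)).trans (hC1 C hC a hab y hy)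
      have h3 := (abs_le.1 h2).1
      linarith)
  obtain ⟨P, hPn, hP⟩ := exists_Pop ⟨_, hE1d⟩ hWc hW hq1 (c := 2/q) (by positivity)
    (fun y hy => blW_conv hδ hκ2 hy)
  obtain ⟨Q, hQn, hQ⟩ := exists_Qop ⟨_, hE2d⟩ hWc hW hWa (half_pos hq0) hq2
  have hQn' : ‖Q‖ ≤ 2/q := by rw [show (2/q:ℝ) = (q/2)⁻¹ by field_simp]; exact hQn
  obtain ⟨M, hMn, hM⟩ := exists_Mop hWc hW
    (b := fun s => (κ:ℂ) * (n1 s - a s * n s) + b1 s) (by fun_prop) (K := κ * (C + C*C) + C)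
    (by positivity) (fun y hy => by
      have h1 := hC1 C hC n1 hn1b y hy
      have h2 := hC1 C hC a hab y hy
      have h3 := hC1 C hC b1 hb1b y hy
      refine (norm_add_le _ _).trans (add_le_add ?_ h3)
      rw [norm_mul, Complex.norm_real, Real.norm_of_nonneg hκ.le]
      refine mul_le_mul_of_nonneg_left ?_ hκ.le
      refine (norm_sub_le _ _).trans (add_le_add h1 ?_)
      rw [norm_mul]
      exact mul_le_mul h2 (hnb y hy) (norm_nonneg _) hC)
  obtain ⟨M1, hM1n, hM1⟩ := exists_Mop hWc hW hb1 hC (hC1 C hC b1 hb1b)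
  obtain ⟨G2, hG2n, hG2⟩ := exists_Gop hWc hW hWi hWI hD0 hb2 hC (hCW C hC b2 hb2b)
  obtain ⟨G3, hG3n, hG3⟩ := exists_Gop hWc hW hWi hWI hD0 hb3 hC (hCW C hC b3 hb3b)
  obtain ⟨f, hfn, hf⟩ := exists_toWX W hWc hW fs hfs C hC (hCW C hC fs hfsb)
  obtain ⟨ℓ, hℓn, hℓ⟩ := exists_ell hWc hW hWi hWI hD0
  obtain ⟨ê, hên, hê⟩ := exists_toWX W hWc hW (fun y => Complex.exp (-E1 y))
    (by have : Continuous E1 := continuous_iff_continuousAt.2 fun y => (hE1d y).continuousAt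
        fun_prop) (1/q) (by positivity) (fun y hy => by
      rw [Complex.norm_exp]
      have h1 := hq1 0 y le_rfl hy
      have h2 : E1 0 = 0 := by simp [hE1, hN0]
      rw [h2] at h1
      have h3 : Real.exp ((-E1 y).re) ≤ Real.exp (-(q*y)) := by
        apply Real.exp_le_exp.2
        simp only [sub_zero] at h1
        simp only [Complex.neg_re]; linarith
      refine h3.trans ?_
      rw [one_div, inv_mul_eq_div, le_div_iff₀ hq0, mul_comm]
      exact qexp_le_blW hq0 hy)
  set B : XSp →L[ℂ] XSp := -(P.comp (Q.comp (M + G2))) with hB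
  set A : XSp →L[ℂ] XSp := (Complex.I * (κ:ℂ)^2) • (P.comp (Q.comp (1 - G3))) with hA
  set S : XSp := c0 • ê - (Complex.I * (κ:ℂ)^2) • P (Q f) with hS
  have hPQ : ∀ T : XSp →L[ℂ] XSp, ‖P.comp (Q.comp T)‖ ≤ 4/q^2 * ‖T‖ := fun T => by
    refine (ContinuousLinearMap.opNorm_comp_le _ _).trans ?_
    calc _ ≤ (2/q) * ((2/q) * ‖T‖) := by
          refine mul_le_mul hPn ((ContinuousLinearMap.opNorm_comp_le _ _).trans ?_) (norm_nonneg _)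
            (by positivity)
          exact mul_le_mul_of_nonneg_right hQn' (norm_nonneg _)
      _ = _ := by ring
  have hAn : ‖A‖ ≤ α := by
    rw [hA, norm_smul]
    have h1 : ‖Complex.I * (κ:ℂ)^2‖ = κ^2 := by simp
    rw [h1]
    have h2 : ‖(1 : XSp →L[ℂ] XSp) - G3‖ ≤ 1 + C * D :=
      (norm_sub_le _ _).trans (add_le_add ContinuousLinearMap.norm_id_le hG3n)
    calc _ ≤ κ^2 * (4/q^2 * (1 + C*D)) := by
          refine mul_le_mul_of_nonneg_left ((hPQ _).trans ?_) (by positivity)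
          exact mul_le_mul_of_nonneg_left h2 (by positivity)
      _ = α := by rw [hα, hq]; field_simp
  have hα0 : 0 < α := by rw [hα]; positivity
  have hBn : ‖B‖ ≤ 1/4 := by
    rw [hB, norm_neg]
    have h2 : ‖M + G2‖ ≤ κ * (2 * C + C^2 + C * D) := by
      refine (norm_add_le _ _).trans ((add_le_add hMn hG2n).trans ?_)
      have h1 := mul_le_mul_of_nonneg_right hκ1 hC
      have h2 := mul_le_mul_of_nonneg_right hκ1 (mul_nonneg hC hD0)
      nlinarith
    calc _ ≤ 4/q^2 * (κ * (2 * C + C^2 + C * D)) :=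
          (hPQ _).trans (mul_le_mul_of_nonneg_left h2 (by positivity))
      _ = (4 / n0^2 * (2 * C + C^2 + C * D)) / κ := by rw [hq]; field_simp
      _ ≤ (κ/4)/κ := by gcongr
      _ = 1/4 := by field_simp
  obtain ⟨X, hXd, hX⟩ := resolvent_family A B S hAn hα0 hBn hr
  have key : ∀ (ν : ℂ) (x : XSp), S + B x + ν • A x = c0 • ê - P (Q (M x + G2 x
      - (Complex.I * (κ:ℂ)^2 * ν) • (x - G3 x) + (Complex.I * (κ:ℂ)^2) • f)) := by
    intro ν x
    rw [hS, hB, hA]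
    simp only [_root_.neg_apply, ContinuousLinearMap.comp_apply,
      _root_.add_apply, _root_.smul_apply, _root_.sub_apply,
      one_apply_eq_self, map_add, map_sub, map_smul]
    module
  refine ⟨X, ℓ, hℓ, hXd, fun ν hν => ⟨?_, ?_⟩⟩
  · intro y hy
    have h1 := (hX ν hν).1
    rw [key] at h1
    rw [h1, wx_sub, wx_smul, hê y hy, hP _ y hy]
    rw [← h1, sub_eq_add_neg]
    congr 1
    rw [Pfn, Pfn, ← mul_neg, ← intervalIntegral.integral_neg]
    congr 1
    refine intervalIntegral.integral_congr fun s hs => ?_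
    rw [uIcc_of_le hy] at hs
    rw [hQ _ s hs.1, ← mul_neg]
    congr 2
    refine Qfn_congr hs.1 fun t ht => ?_
    rw [wx_add, wx_sub, wx_add, wx_smul, wx_smul, wx_sub, hM _ t ht, hG2 _ t ht, hG3 _ t ht, hf t ht]
    rfl
  · intro x0 t1 C4 hC4 hx0 ht1 hx0b ht1b hinv
    have hx0c : Continuous x0 := continuous_iff_continuousAt.2 fun y => (hx0 y).continuousAt
    obtain ⟨x, hxn, hx⟩ := exists_toWX W hWc hW x0 hx0c C4 hC4 (hCW C4 hC4 x0 hx0b)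
    obtain ⟨t, htn, ht⟩ := exists_toWX W hWc hW t1 ht1 C4 hC4 (hCW C4 hC4 t1 ht1b)
    have hkn : ∀ y, 0 ≤ y → ‖(κ:ℂ) * n y‖ ≤ κ * C := fun y hy => by
      rw [norm_mul, Complex.norm_real, Real.norm_of_nonneg hκ.le]
      exact mul_le_mul_of_nonneg_left (hnb y hy) hκ.le
    obtain ⟨Mn, hMnn, hMn'⟩ := exists_Mop hWc hW (b := fun y => (κ:ℂ) * n y) (by fun_prop)
      (K := κ * C) (by positivity) hkn
    obtain ⟨Mn1, hMn1n, hMn1⟩ := exists_Mop hWc hW (b := fun y => (κ:ℂ) * n1 y) (by fun_prop)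
      (K := κ * C) (by positivity) (fun y hy => by
        rw [norm_mul, Complex.norm_real, Real.norm_of_nonneg hκ.le]
        exact mul_le_mul_of_nonneg_left (hC1 C hC n1 hn1b y hy) hκ.le)
    obtain ⟨Ma, hMan, hMa⟩ := exists_Mop hWc hW ha hC (hC1 C hC a hab)
    have hintg : ∀ y, 0 ≤ y → ∫ t in (0:ℝ)..y, wx W x t = ∫ t in (0:ℝ)..y, x0 t := fun y hy => by
      refine intervalIntegral.integral_congr fun s hs => ?_
      rw [uIcc_of_le hy] at hs
      exact hx s hs.1
    set v1 : XSp := Mn (Mn x) + Ma (Mn x) - (Mn1 x + Mn t) with hv1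
    have hv1e : ∀ y, 0 ≤ y → wx W v1 y = ((κ:ℂ) * n y + a y) * ((κ:ℂ) * n y * x0 y)
        - ((κ:ℂ) * n1 y * x0 y + (κ:ℂ) * n y * t1 y) := by
      intro y hy
      rw [hv1, wx_sub, wx_add, wx_add, hMn' _ y hy, hMn' _ y hy, hMa _ y hy, hMn' _ y hy,
        hMn1 _ y hy, hMn' _ y hy, hx y hy, ht y hy]
      ring
    have I2 : Q v1 = Mn x := by
      refine wx_inj hW fun y hy => ?_
      rw [hQ _ y hy, hMn' _ y hy, hx y hy]
      have hKa : ∀ y, 0 ≤ y → ‖(κ:ℂ) * n y * x0 y‖ ≤ max ‖Mn x‖ ‖v1‖ * W y := fun y hy => by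
        rw [← hx y hy, ← hMn' x y hy]
        exact (wx_norm_le hW _ y).trans (mul_le_mul_of_nonneg_right (le_max_left _ _) (hW y).le)
      have hKb : ∀ y, 0 ≤ y → ‖((κ:ℂ) * n y + a y) * ((κ:ℂ) * n y * x0 y)
        - ((κ:ℂ) * n1 y * x0 y + (κ:ℂ) * n y * t1 y)‖ ≤ max ‖Mn x‖ ‖v1‖ * W y := fun y hy => by
        rw [← hv1e y hy]
        exact (wx_norm_le hW _ y).trans (mul_le_mul_of_nonneg_right (le_max_right _ _) (hW y).le)
      have := Qfn_repr (E := E2) (q := q/2) (W := W) hE2d (by fun_prop) (half_pos hq0) hWa hW hq2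
        (z := fun y => (κ:ℂ) * n y * x0 y)
        (z' := fun y => (κ:ℂ) * n1 y * x0 y + (κ:ℂ) * n y * t1 y)
        (fun y => ((hn y).const_mul (κ:ℂ)).mul (hx0 y)) (by fun_prop)
        (K := max ‖Mn x‖ ‖v1‖) (le_max_of_le_left (norm_nonneg _)) hKa hKb hy
      rw [this]
      exact Qfn_congr hy fun s hs => hv1e s hs
    have I1 : x = x0 0 • ê + P (t + Mn x) := by
      refine wx_inj hW fun y hy => ?_
      rw [wx_add, wx_smul, hê y hy, hP _ y hy, hx y hy]
      have := Pfn_repr (E := E1) hE1d (by fun_prop) (by simp [hE1, hN0]) hx0 ht1 y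
      rw [this, mul_comm (x0 0)]
      congr 1
      refine Pfn_congr hy fun s hs => ?_
      rw [wx_add, ht s hs, hMn' _ s hs, hx s hs]
    have I3 : M x + G2 x - (Complex.I * (κ:ℂ)^2 * ν) • (x - G3 x) + (Complex.I * (κ:ℂ)^2) • f
        = -(v1 + Mn t) + (M1 x + G2 x) := by
      refine wx_inj hW fun y hy => ?_
      rw [wx_add, wx_sub, wx_add, wx_smul, wx_smul, wx_sub, hM _ y hy, hG2 _ y hy, hG3 _ y hy,
        hf y hy, wx_add, wx_neg, wx_add, wx_add, hv1e y hy, hMn' _ y hy, hM1 _ y hy, hG2 _ y hy,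
        hx y hy, ht y hy, hintg y hy, ← hinv y hy]
      linear_combination ((κ:ℂ)^2 * n y ^2 * x0 y) * Complex.I_sq
    have hres : S + B x + ν • A x - x = (c0 - x0 0) • ê - P t + P (Q (Mn t)) - P (Q (M1 x + G2 x)) := by
      rw [key, I3]
      rw [map_add P] at I1
      rw [map_add Q, map_neg Q, map_add Q v1, I2]
      simp only [map_add, map_neg]
      refine (congrArg (HSub.hSub _) I1).trans ?_
      module
    have hPv : ∀ v, ‖P v‖ ≤ 2/q * ‖v‖ := fun v =>
      (P.le_opNorm v).trans (mul_le_mul_of_nonneg_right hPn (norm_nonneg _))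
    have hQv : ∀ v, ‖Q v‖ ≤ 2/q * ‖v‖ := fun v =>
      (Q.le_opNorm v).trans (mul_le_mul_of_nonneg_right hQn' (norm_nonneg _))
    have hPQv : ∀ v K, ‖v‖ ≤ K → ‖P (Q v)‖ ≤ 2/q * (2/q * K) := fun v K hK =>
      (hPv _).trans (mul_le_mul_of_nonneg_left ((hQv v).trans
        (mul_le_mul_of_nonneg_left hK (by positivity))) (by positivity))
    have hx00 : ‖x0 0‖ ≤ C4 := hC1 C4 hC4 x0 hx0b 0 le_rfl
    have hMnt : ‖Mn t‖ ≤ κ * C * C4 := (Mn.le_opNorm t).trans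
      (mul_le_mul hMnn htn (norm_nonneg _) (by positivity))
    have hMG : ‖M1 x + G2 x‖ ≤ C * C4 + C * D * C4 :=
      (norm_add_le _ _).trans (add_le_add
        ((M1.le_opNorm x).trans (mul_le_mul hM1n hxn (norm_nonneg _) hC))
        ((G2.le_opNorm x).trans (mul_le_mul hG2n hxn (norm_nonneg _) (by positivity))))
    have hMG' : ‖M1 x + G2 x‖ ≤ κ * (C * C4 + C * D * C4) :=
      hMG.trans (le_mul_of_one_le_left (by positivity) hκ1)
    have hbound : ‖S + B x + ν • A x - x‖ ≤
        ((‖c0‖ + 3 * C4) / n0 + 4 / n0^2 * (2 * C * C4 + C * D * C4)) / κ := by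
      rw [hres]
      have e1 : ‖(c0 - x0 0) • ê‖ ≤ (‖c0‖ + C4) * (1/q) := by
        rw [norm_smul]
        exact mul_le_mul ((norm_sub_le _ _).trans (by linarith)) hên (norm_nonneg _) (by positivity)
      have e2 : ‖P t‖ ≤ 2/q * C4 := (hPv t).trans (mul_le_mul_of_nonneg_left htn (by positivity))
      have e3 := hPQv _ _ hMnt
      have e4 := hPQv _ _ hMG'
      have e5 : ‖(c0 - x0 0) • ê - P t + P (Q (Mn t)) - P (Q (M1 x + G2 x))‖ ≤
          ‖(c0 - x0 0) • ê‖ + ‖P t‖ + ‖P (Q (Mn t))‖ + ‖P (Q (M1 x + G2 x))‖ :=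
        (norm_sub_le _ _).trans (add_le_add ((norm_add_le _ _).trans
          (add_le_add (norm_sub_le _ _) le_rfl)) le_rfl)
      refine e5.trans ((add_le_add (add_le_add (add_le_add e1 e2) e3) e4).trans (le_of_eq ?_))
      rw [hq]
      field_simp
      ring
    have hℓx : ∫ s in Ioi (0:ℝ), x0 s = ℓ x := by
      rw [hℓ]
      exact setIntegral_congr_fun measurableSet_Ioi fun s hs => (hx s (le_of_lt hs)).symm
    rw [hℓx, ← map_sub]
    calc ‖ℓ (X ν - x)‖ ≤ D * (2 * (((‖c0‖ + 3 * C4) / n0 + 4 / n0^2 * (2 * C * C4 + C * D * C4)) / κ)) := by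
          refine (ℓ.le_opNorm _).trans (mul_le_mul hℓn (((hX ν hν).2 x).trans ?_) (norm_nonneg _) hD0)
          linarith
      _ = _ := by ring

lemma inv_shear_norm {U : ℝ → ℝ} {μ : ℂ} {c : ℝ} (hc : 0 < c) (hμ : c ≤ μ.im) (y : ℝ) :
    (μ - (U y : ℂ)) ≠ 0 ∧ ‖(μ - (U y : ℂ))⁻¹‖ ≤ 1 / c := by
  have h1 : c ≤ ‖μ - (U y : ℂ)‖ := by
    have := Complex.abs_im_le_norm (μ - (U y : ℂ))
    have h2 : (μ - (U y : ℂ)).im = μ.im := by simp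
    rw [h2, abs_of_nonneg (by linarith)] at this
    linarith
  refine ⟨fun h => ?_, ?_⟩
  · rw [h] at h1; simp at h1; linarith
  · rw [norm_inv, one_div]
    exact inv_anti₀ hc h1

lemma inv_shear_deriv {U U1 : ℝ → ℝ} (hU : ∀ y, HasDerivAt U (U1 y) y) {μ : ℂ} (hμ : 0 < μ.im) (y : ℝ) :
    HasDerivAt (fun y => (μ - (U y : ℂ))⁻¹) ((U1 y : ℂ) * ((μ - (U y : ℂ))⁻¹)^2) y := by
  have h := (((hU y).ofReal_comp).const_sub μ).inv (inv_shear_norm (U := U) hμ le_rfl y).1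
  refine h.congr_deriv ?_
  field_simp

set_option maxHeartbeats 1000000 in
lemma inviscid {U U1 U2 : ℝ → ℝ} {C δ : ℝ} {μ0 : ℂ} (hC : 0 ≤ C) (hδ : 0 < δ)
    (hU : ∀ y, HasDerivAt U (U1 y) y) (hU1 : ∀ y, HasDerivAt U1 (U2 y) y) (hU2c : Continuous U2)
    (hb0 : ∀ y, 0 ≤ y → (1 + y) * |1 - U y| ≤ C * Real.exp (-δ * y))
    (hb1 : ∀ y, 0 ≤ y → (1 + y) * |U1 y| ≤ C * Real.exp (-δ * y))
    (hb2 : ∀ y, 0 ≤ y → (1 + y) * |U2 y| ≤ C * Real.exp (-δ * y))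
    (hμ : 0 < μ0.im) :
    ∃ C4, 0 ≤ C4 ∧ ∀ ν : ℂ, ‖ν‖ ≤ μ0.im / 2 → ‖ν‖ ≤ 1 → ∃ x0 t1 : ℝ → ℂ,
      (∀ y, HasDerivAt x0 (t1 y) y) ∧ Continuous t1 ∧
      (∀ y, 0 ≤ y → ‖x0 y‖ ≤ C4 * Real.exp (-δ * y)) ∧
      (∀ y, 0 ≤ y → ‖t1 y‖ ≤ C4 * Real.exp (-δ * y)) ∧
      (∀ y, 0 ≤ y → (μ0 - (U y:ℂ)) * x0 y + ν * (x0 y - (U1 y:ℂ) / (μ0 - (U y:ℂ)) *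
        ∫ t in (0:ℝ)..y, x0 t) = ((1 - U y + y * U1 y : ℝ) : ℂ) / (μ0 - (U y:ℂ))) ∧
      ∀ L : ℂ, Tendsto (fun y => ∫ s in (0:ℝ)..y,
          ((1 - U s + s * U1 s : ℝ) : ℂ) / (μ0 + ν - (U s:ℂ))^2) atTop (nhds L) →
        (μ0 - 1) * ∫ s in Ioi (0:ℝ), x0 s = (μ0 + ν - 1) * L := by
  set b := μ0.im with hb
  set H : ℝ := 2 / b with hH
  have hH0 : 0 < H := by positivity
  set JB : ℝ := 2 * C * H^2 / δ with hJB
  have hJB0 : 0 ≤ JB := by positivity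
  set K1 : ℝ := 2 * C * H * H + 1 * C * H^2 * JB with hK1
  set K2 : ℝ := C * H * H + 2 * C * (C * H^2) * H + 2 * C * H * (C * H^2) + 1 * C * H^2 * JB
    + 2 * 1 * C * C * H^3 * JB + 1 * C * H^2 * (2 * C * H^2) with hK2
  have hK10 : 0 ≤ K1 := by positivity
  have hK20 : 0 ≤ K2 := by positivity
  have hUc : Continuous U := continuous_iff_continuousAt.2 fun y => (hU y).continuousAt
  have hU1c : Continuous U1 := continuous_iff_continuousAt.2 fun y => (hU1 y).continuousAt
  have hdiv : ∀ (f : ℝ → ℝ), (∀ y, 0 ≤ y → (1 + y) * |f y| ≤ C * Real.exp (-δ * y)) →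
      ∀ y, 0 ≤ y → |f y| ≤ C * Real.exp (-δ * y) ∧ |y * f y| ≤ C * Real.exp (-δ * y) := by
    intro f hf y hy
    have h1 := hf y hy
    have h2 := abs_nonneg (f y)
    rw [abs_mul, abs_of_nonneg hy]
    constructor <;> nlinarith
  have hexp1 : ∀ y, 0 ≤ y → Real.exp (-δ * y) ≤ 1 := fun y hy =>
    Real.exp_le_one_iff.2 (by nlinarith)
  refine ⟨K1 + K2, by positivity, fun ν hν hν1 => ?_⟩
  have hνim : b/2 ≤ (μ0 + ν).im := by
    have := (abs_le.1 ((Complex.abs_im_le_norm ν).trans hν)).1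
    simp only [Complex.add_im]; linarith
  set F : ℝ → ℂ := fun y => ((1 - U y + y * U1 y : ℝ) : ℂ) with hF
  set h0 : ℝ → ℂ := fun y => (μ0 - (U y : ℂ))⁻¹ with hh0
  set h : ℝ → ℂ := fun y => (μ0 + ν - (U y : ℂ))⁻¹ with hh
  have hh0d : ∀ y, HasDerivAt h0 ((U1 y : ℂ) * h0 y^2) y := inv_shear_deriv hU hμ
  have hhd : ∀ y, HasDerivAt h ((U1 y : ℂ) * h y^2) y := inv_shear_deriv hU (by linarith)
  have hFd : ∀ y, HasDerivAt F ((y * U2 y : ℝ) : ℂ) y := fun y => by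
    have h1 : HasDerivAt (fun y => 1 - U y + y * U1 y) (y * U2 y) y := by
      refine (((hU y).const_sub 1).add ((hasDerivAt_id y).mul (hU1 y))).congr_deriv ?_
      simp
    exact h1.ofReal_comp
  have hFc : Continuous F := continuous_iff_continuousAt.2 fun y => (hFd y).continuousAt
  have hh0c : Continuous h0 := continuous_iff_continuousAt.2 fun y => (hh0d y).continuousAt
  have hhc : Continuous h := continuous_iff_continuousAt.2 fun y => (hhd y).continuousAt
  have hh0b : ∀ y, ‖h0 y‖ ≤ H := fun y =>
    (inv_shear_norm hμ le_rfl y).2.trans (by rw [hH]; gcongr; norm_num)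
  have hhb : ∀ y, ‖h y‖ ≤ H := fun y =>
    (inv_shear_norm (by positivity) hνim y).2.trans (by rw [hH]; apply le_of_eq; field_simp)
  have hFb : ∀ y, 0 ≤ y → ‖F y‖ ≤ 2 * C * Real.exp (-δ * y) := fun y hy => by
    simp only [hF, Complex.norm_real, Real.norm_eq_abs]
    refine (abs_add_le _ _).trans ?_
    have h1 := (hdiv _ hb0 y hy).1
    have h2 := (hdiv _ hb1 y hy).2
    linarith
  set J : ℝ → ℂ := fun y => ∫ s in (0:ℝ)..y, F s * h s^2 with hJ
  have hJd : ∀ y, HasDerivAt J (F y * h y^2) y := fun y =>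
    intervalIntegral.integral_hasDerivAt_right ((hFc.mul (hhc.pow 2)).intervalIntegrable _ _)
      ((hFc.mul (hhc.pow 2)).stronglyMeasurableAtFilter _ _) (hFc.mul (hhc.pow 2)).continuousAt
  have hJc : Continuous J := continuous_iff_continuousAt.2 fun y => (hJd y).continuousAt
  have hJb : ∀ y, 0 ≤ y → ‖J y‖ ≤ JB := fun y hy => by
    have hi : IntegrableOn (fun s => Real.exp (-δ * s)) (Ioi 0) :=
      integrableOn_exp_mul_Ioi (by linarith) 0
    calc _ ≤ ∫ s in (0:ℝ)..y, 2 * C * H^2 * Real.exp (-δ * s) := by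
          refine intervalIntegral.norm_integral_le_of_norm_le hy ?_ (by
            apply Continuous.intervalIntegrable; fun_prop)
          refine Eventually.of_forall fun s hs => ?_
          rw [norm_mul, norm_pow]
          have h1 := hFb s hs.1.le
          have h2 := hhb s
          calc _ ≤ (2 * C * Real.exp (-δ * s)) * H^2 := by gcongr
            _ = _ := by ring
      _ = 2 * C * H^2 * ∫ s in (0:ℝ)..y, Real.exp (-δ * s) := intervalIntegral.integral_const_mul _ _
      _ ≤ 2 * C * H^2 * (1/δ) := by
          gcongr
          rw [intervalIntegral.integral_of_le hy]
          have h2 := setIntegral_mono_set hi (Eventually.of_forall fun s => (Real.exp_pos _).le)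
            (HasSubset.Subset.eventuallyLE (Ioc_subset_Ioi_self : Ioc 0 y ⊆ Ioi 0))
          refine h2.trans (le_of_eq ?_)
          rw [integral_exp_mul_Ioi (by linarith) 0]
          simp
      _ = JB := by rw [hJB]; ring
  set x0 : ℝ → ℂ := fun y => F y * h0 y * h y + ν * (U1 y : ℂ) * h0 y^2 * J y with hx0
  set t1 : ℝ → ℂ := fun y => ((y * U2 y : ℝ):ℂ) * h0 y * h y + F y * ((U1 y : ℂ) * h0 y^2) * h y
    + F y * h0 y * ((U1 y : ℂ) * h y^2) + ν * (U2 y : ℂ) * h0 y^2 * J y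
    + 2 * ν * (U1 y:ℂ) * (U1 y : ℂ) * h0 y^3 * J y + ν * (U1 y:ℂ) * h0 y^2 * (F y * h y^2) with ht1
  have hx0d : ∀ y, HasDerivAt x0 (t1 y) y := fun y => by
    have e1 := ((hFd y).mul (hh0d y)).mul (hhd y)
    have e2 := ((((hU1 y).ofReal_comp).const_mul ν).mul ((hh0d y).pow 2)).mul (hJd y)
    refine (e1.add e2).congr_deriv ?_
    simp only [ht1, Pi.mul_apply, Pi.pow_apply]
    push_cast
    ring
  have hx0c : Continuous x0 := continuous_iff_continuousAt.2 fun y => (hx0d y).continuousAt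
  have hx0b : ∀ y, 0 ≤ y → ‖x0 y‖ ≤ K1 * Real.exp (-δ * y) := fun y hy => by
    have f1 := hFb y hy
    have f2 := hh0b y
    have f3 := hhb y
    have f4 := hJb y hy
    have f5 : ‖(U1 y:ℂ)‖ ≤ C * Real.exp (-δ * y) := by
      rw [Complex.norm_real, Real.norm_eq_abs]; exact (hdiv _ hb1 y hy).1
    have e1 : ‖F y * h0 y * h y‖ ≤ (2 * C * Real.exp (-δ * y)) * H * H := by
      simp only [norm_mul]; gcongr
    have e2 : ‖ν * (U1 y : ℂ) * h0 y^2 * J y‖ ≤ 1 * (C * Real.exp (-δ * y)) * H^2 * JB := by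
      simp only [norm_mul, norm_pow]; gcongr
    refine (norm_add_le _ _).trans ((add_le_add e1 e2).trans (le_of_eq ?_))
    rw [hK1]; ring
  have ht1b : ∀ y, 0 ≤ y → ‖t1 y‖ ≤ K2 * Real.exp (-δ * y) := fun y hy => by
    have f1 := hFb y hy
    have f2 := hh0b y
    have f3 := hhb y
    have f4 := hJb y hy
    have f5 : ‖(U1 y:ℂ)‖ ≤ C * Real.exp (-δ * y) := by
      rw [Complex.norm_real, Real.norm_eq_abs]; exact (hdiv _ hb1 y hy).1
    have f5' : ‖(U1 y:ℂ)‖ ≤ C := f5.trans (mul_le_of_le_one_right hC (hexp1 y hy))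
    have f6 : ‖(U2 y:ℂ)‖ ≤ C * Real.exp (-δ * y) := by
      rw [Complex.norm_real, Real.norm_eq_abs]; exact (hdiv _ hb2 y hy).1
    have f7 : ‖((y * U2 y : ℝ):ℂ)‖ ≤ C * Real.exp (-δ * y) := by
      rw [Complex.norm_real, Real.norm_eq_abs]; exact (hdiv _ hb2 y hy).2
    set e := Real.exp (-δ * y) with he
    have he0 : 0 < e := Real.exp_pos _
    have f1' : ‖F y‖ ≤ 2 * C := f1.trans (mul_le_of_le_one_right (by positivity) (hexp1 y hy))
    have e1 : ‖((y * U2 y : ℝ):ℂ) * h0 y * h y‖ ≤ (C * e) * H * H := by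
      simp only [norm_mul] at *; gcongr
    have e2 : ‖F y * ((U1 y : ℂ) * h0 y^2) * h y‖ ≤ (2 * C * e) * (C * H^2) * H := by
      simp only [norm_mul, norm_pow]; gcongr
    have e3 : ‖F y * h0 y * ((U1 y : ℂ) * h y^2)‖ ≤ (2 * C * e) * H * (C * H^2) := by
      simp only [norm_mul, norm_pow]; gcongr
    have e4 : ‖ν * (U2 y : ℂ) * h0 y^2 * J y‖ ≤ 1 * (C * e) * H^2 * JB := by
      simp only [norm_mul, norm_pow]; gcongr
    have e5 : ‖2 * ν * (U1 y:ℂ) * (U1 y : ℂ) * h0 y^3 * J y‖ ≤ 2 * 1 * C * (C * e) * H^3 * JB := by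
      simp only [norm_mul, norm_pow, Complex.norm_ofNat]; gcongr
    have e6 : ‖ν * (U1 y:ℂ) * h0 y^2 * (F y * h y^2)‖ ≤ 1 * C * H^2 * ((2 * C * e) * H^2) := by
      simp only [norm_mul, norm_pow]; gcongr
    have := (norm_add_le_of_le (norm_add_le_of_le (norm_add_le_of_le (norm_add_le_of_le
      (norm_add_le_of_le e1 e2) e3) e4) e5) e6)
    refine this.trans (le_of_eq ?_)
    rw [hK2]; ring
  have hne0 : ∀ y, μ0 - (U y:ℂ) ≠ 0 := fun y => (inv_shear_norm hμ le_rfl y).1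
  have hne : ∀ y, μ0 + ν - (U y:ℂ) ≠ 0 := fun y => (inv_shear_norm (half_pos hμ) hνim y).1
  have hg0 : ∀ y, ∫ t in (0:ℝ)..y, x0 t = (1 + ν * h0 y) * J y := fun y => by
    have hd : ∀ y, HasDerivAt (fun y => (1 + ν * h0 y) * J y) (x0 y) y := fun y => by
      refine ((((hh0d y).const_mul ν).const_add 1).mul (hJd y)).congr_deriv ?_
      simp only [hx0]
      have key : (1 + ν * h0 y) * h y = h0 y := by
        simp only [hh0, hh]
        have := hne0 y; have := hne y
        field_simp
        ring
      linear_combination (F y * h y) * key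
    rw [intervalIntegral.integral_eq_sub_of_hasDerivAt (fun y _ => hd y)
      (hx0c.intervalIntegrable _ _)]
    simp [hJ]
  refine ⟨x0, t1, hx0d, by fun_prop, ?_, ?_, ?_, ?_⟩
  · intro y hy
    refine (hx0b y hy).trans ?_
    gcongr; linarith
  · intro y hy
    refine (ht1b y hy).trans ?_
    gcongr; linarith
  · intro y hy
    rw [hg0 y]
    have := hne0 y; have := hne y
    show _ = F y / _
    simp only [hx0, hh0, hh]
    field_simp
    ring
  · intro L hL
    have hL' : Tendsto J atTop (nhds L) := by
      refine hL.congr fun y => ?_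
      simp only [hJ]
      congr 1; ext s
      simp only [hF, hh]
      rw [inv_pow, div_eq_mul_inv]
    have hxi : IntegrableOn x0 (Ioi 0) := by
      have hi : IntegrableOn (fun s => K1 * Real.exp (-δ * s)) (Ioi 0) :=
        (integrableOn_exp_mul_Ioi (by linarith) 0).const_mul _
      refine hi.mono' hx0c.aestronglyMeasurable ?_
      exact (ae_restrict_mem measurableSet_Ioi).mono fun s hs => hx0b s (le_of_lt hs)
    have t1' := intervalIntegral_tendsto_integral_Ioi 0 hxi tendsto_id
    have hU1t : Tendsto (fun y => (U y:ℂ)) atTop (nhds 1) := by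
      have hexp : Tendsto (fun y => C * Real.exp (-δ * y)) atTop (nhds 0) := by
        have h1 : Tendsto (fun y : ℝ => -δ * y) atTop atBot :=
          tendsto_id.const_mul_atTop_of_neg (by linarith)
        have := (Real.tendsto_exp_atBot.comp h1).const_mul C
        simpa using this
      have h2 : Tendsto (fun y => 1 - U y) atTop (nhds 0) := by
        refine squeeze_zero_norm' ?_ hexp
        filter_upwards [eventually_ge_atTop 0] with y hy
        exact (hdiv _ hb0 y hy).1
      have h3 := h2.const_sub 1
      simp only [sub_sub_cancel, sub_zero] at h3
      have := (Complex.continuous_ofReal.tendsto 1).comp h3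
      rw [Complex.ofReal_one] at this
      exact this
    have hm : μ0 - 1 ≠ 0 := fun h => by
      have := congrArg Complex.im h
      simp at this; linarith
    have t2 : Tendsto (fun y => (1 + ν * h0 y) * J y) atTop (nhds ((1 + ν * (μ0 - 1)⁻¹) * L)) :=
      ((((hU1t.const_sub μ0).inv₀ hm).const_mul ν).const_add 1).mul hL'
    have t3 : ∫ s in Ioi (0:ℝ), x0 s = (1 + ν * (μ0 - 1)⁻¹) * L := by
      refine tendsto_nhds_unique t1' (t2.congr fun y => ?_)
      rw [← hg0]; rfl
    rw [t3]
    field_simp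
    ring

lemma primitive_hasDerivAt {f : ℝ → ℂ} (hf : Continuous f) (y : ℝ) :
    HasDerivAt (fun y => ∫ s in (0:ℝ)..y, f s) (f y) y :=
  intervalIntegral.integral_hasDerivAt_right (hf.intervalIntegrable _ _)
    (hf.stronglyMeasurableAtFilter _ _) hf.continuousAt

lemma blW_tendsto {δ q : ℝ} (hδ : 0 < δ) (hq : 0 < q) : Tendsto (blW δ q) atTop (nhds 0) := by
  have h : ∀ c : ℝ, 0 < c → Tendsto (fun y => Real.exp (-c * y)) atTop (nhds 0) := fun c hc => by
    have h1 : Tendsto (fun y : ℝ => -c * y) atTop atBot :=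
      tendsto_id.const_mul_atTop_of_neg (by linarith)
    exact Real.tendsto_exp_atBot.comp h1
  have := (h δ hδ).add ((h (q/2) (by linarith)).const_mul q)
  simp only [mul_zero, add_zero] at this
  exact this

set_option maxHeartbeats 1600000 in
/-- The viscous problem with the condition at infinity left free, for `k = κ^2` large. -/
theorem viscous_family {U U1 U2 U3 : ℝ → ℝ} {C δ : ℝ} {μ0 : ℂ} (hC : 0 ≤ C) (hδ : 0 < δ)
    (hU00 : U 0 = 0)
    (hU : ∀ y, HasDerivAt U (U1 y) y) (hU1 : ∀ y, HasDerivAt U1 (U2 y) y)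
    (hU2 : ∀ y, HasDerivAt U2 (U3 y) y) (hU3c : Continuous U3)
    (hb0 : ∀ y, 0 ≤ y → (1 + y) * |1 - U y| ≤ C * Real.exp (-δ * y))
    (hb1 : ∀ y, 0 ≤ y → (1 + y) * |U1 y| ≤ C * Real.exp (-δ * y))
    (hb2 : ∀ y, 0 ≤ y → (1 + y) * |U2 y| ≤ C * Real.exp (-δ * y))
    (hb3 : ∀ y, 0 ≤ y → (1 + y) * |U3 y| ≤ C * Real.exp (-δ * y))
    (hμ : 0 < μ0.im) :
    ∃ r, 0 < r ∧ r ≤ μ0.im / 2 ∧ ∃ C' κ0 : ℝ, ∀ κ : ℝ, κ0 ≤ κ → ∃ f : ℂ → ℂ,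
      DifferentiableOn ℂ f (Metric.ball 0 r) ∧ ∀ ν ∈ Metric.ball (0:ℂ) r,
        (∀ L : ℂ, Tendsto (fun y => ∫ s in (0:ℝ)..y,
          ((1 - U s + s * U1 s : ℝ) : ℂ) / (μ0 + ν - (U s:ℂ))^2) atTop (nhds L) →
          ‖f ν - (μ0 + ν - 1) * L‖ ≤ C' / κ) ∧
        ∃ φ φ1 φ2 : ℝ → ℂ, (∀ y, 0 ≤ y → HasDerivAt φ (φ1 y) y) ∧
          (∀ y, 0 ≤ y → HasDerivAt φ1 (φ2 y) y) ∧
          (∀ y, 0 ≤ y → HasDerivAt φ2 (-Complex.I * (κ:ℂ)^2 * ((μ0 + ν - (U y:ℂ)) * φ1 y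
            + (U1 y:ℂ) * φ y - ((1 - U y + y * U1 y : ℝ) : ℂ))) y) ∧
          φ 0 = 0 ∧ φ1 0 = 1 ∧ Tendsto φ1 atTop (nhds 0) ∧ Tendsto φ atTop (nhds (f ν)) := by
  obtain ⟨C4, hC4, hinv⟩ := inviscid hC hδ hU hU1
    (continuous_iff_continuousAt.2 fun y => (hU2 y).continuousAt) hb0 hb1 hb2 hμ
  set b := μ0.im with hb
  have hUc : Continuous U := continuous_iff_continuousAt.2 fun y => (hU y).continuousAt
  have hU1c : Continuous U1 := continuous_iff_continuousAt.2 fun y => (hU1 y).continuousAt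
  have hU2c : Continuous U2 := continuous_iff_continuousAt.2 fun y => (hU2 y).continuousAt
  have hdiv : ∀ (f : ℝ → ℝ), (∀ y, 0 ≤ y → (1 + y) * |f y| ≤ C * Real.exp (-δ * y)) →
      ∀ y, 0 ≤ y → |f y| ≤ C * Real.exp (-δ * y) ∧ |y * f y| ≤ C * Real.exp (-δ * y) := by
    intro f hf y hy
    have h1 := hf y hy
    have h2 := abs_nonneg (f y)
    rw [abs_mul, abs_of_nonneg hy]
    constructor <;> nlinarith
  have hexp1 : ∀ y, 0 ≤ y → Real.exp (-δ * y) ≤ 1 := fun y hy =>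
    Real.exp_le_one_iff.2 (by nlinarith)
  set w : ℝ → ℂ := fun y => μ0 - (U y:ℂ) with hw
  have hwne : ∀ y, w y ≠ 0 := fun y => (inv_shear_norm hμ le_rfl y).1
  have hwi : ∀ y, ‖(w y)⁻¹‖ ≤ 1 / b := fun y => (inv_shear_norm hμ le_rfl y).2
  have hwd : ∀ y, HasDerivAt w (-(U1 y:ℂ)) y := fun y => ((hU y).ofReal_comp).const_sub μ0
  have hwc : Continuous w := continuous_iff_continuousAt.2 fun y => (hwd y).continuousAt
  set n : ℝ → ℂ := fun y => (-Complex.I * w y) ^ (2⁻¹:ℂ) with hn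
  have hzre : ∀ y, (-Complex.I * w y).re = b := fun y => by simp [hw, hb]
  have hn2 : ∀ y, n y ^ 2 = -Complex.I * w y := fun y => by
    simp only [hn]
    have := Complex.cpow_nat_inv_pow (-Complex.I * w y) (n := 2) (by norm_num)
    simpa using this
  set n0 := Real.sqrt b with hn0d
  have hn0 : 0 < n0 := Real.sqrt_pos.2 hμ
  have hnre : ∀ y, n0 ≤ (n y).re := fun y => by
    simp only [hn]
    rw [Complex.cpow_inv_two_re]
    apply Real.sqrt_le_sqrt
    have := Complex.re_le_norm (-Complex.I * w y)
    rw [hzre] at *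
    linarith
  have hnne : ∀ y, n y ≠ 0 := fun y h => by
    have := hnre y; rw [h] at this; simp at this; linarith
  have hnd : ∀ y, HasDerivAt n (Complex.I * (U1 y:ℂ) / (2 * n y)) y := fun y => by
    have hs : -Complex.I * w y ∈ Complex.slitPlane := Or.inl (by rw [hzre]; exact hμ)
    have h1 : HasDerivAt (fun y => -Complex.I * w y) (-Complex.I * -(U1 y:ℂ)) y :=
      (hwd y).const_mul _
    have h2 := ((Complex.hasStrictDerivAt_cpow_const (c := (2⁻¹:ℂ)) hs).hasDerivAt).comp y h1
    refine h2.congr_deriv ?_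
    have h3 : (-Complex.I * w y) ^ ((2⁻¹:ℂ) - 1) = n y / (-Complex.I * w y) := by
      rw [Complex.cpow_sub _ _ (Complex.slitPlane_ne_zero hs), Complex.cpow_one]
    rw [h3, ← hn2 y]
    have := hnne y
    field_simp
  have hnc : Continuous n := continuous_iff_continuousAt.2 fun y => (hnd y).continuousAt
  have hnn0 : ∀ y, n0 ≤ ‖n y‖ := fun y => (hnre y).trans (Complex.re_le_norm _)
  set C2 : ℝ := ‖μ0‖ + 2 + C + C / n0 + 3 * C / b with hC2
  have hC20 : 0 ≤ C2 := by positivity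
  have hwb : ∀ y, 0 ≤ y → ‖w y‖ ≤ ‖μ0‖ + 1 + C := fun y hy => by
    have h1 := (hdiv _ hb0 y hy).1
    have h2 := h1.trans (mul_le_of_le_one_right hC (hexp1 y hy))
    have h3 : ‖(U y:ℂ)‖ ≤ 1 + C := by
      rw [Complex.norm_real, Real.norm_eq_abs, abs_le]
      have := abs_le.1 h2
      constructor <;> linarith
    refine (norm_sub_le _ _).trans ?_
    linarith
  have hnb : ∀ y, 0 ≤ y → ‖n y‖ ≤ C2 := fun y hy => by
    have h1 : ‖n y‖^2 = ‖w y‖ := by rw [← norm_pow, hn2]; simp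
    have h2 := hwb y hy
    have h3 : 0 ≤ C / n0 := by positivity
    have h4 : 0 ≤ 3 * C / b := by positivity
    rw [hC2]
    nlinarith [sq_nonneg (‖n y‖ - 1)]
  set n1 : ℝ → ℂ := fun y => Complex.I * (U1 y:ℂ) / (2 * n y) with hn1
  have hn1c : Continuous n1 := by
    refine Continuous.div (by fun_prop) (by fun_prop) (fun y => ?_)
    exact mul_ne_zero two_ne_zero (hnne y)
  set F : ℝ → ℂ := fun y => ((1 - U y + y * U1 y : ℝ) : ℂ) with hF
  have hFc : Continuous F := by fun_prop
  set a : ℝ → ℂ := fun y => 3 * (U1 y:ℂ) / w y with ha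
  set b1 : ℝ → ℂ := fun y => 3 * (U2 y:ℂ) / w y with hb1d
  set b2 : ℝ → ℂ := fun y => (U3 y:ℂ) / w y with hb2d
  set b3 : ℝ → ℂ := fun y => (U1 y:ℂ) / w y with hb3d
  set fs : ℝ → ℂ := fun y => F y / w y with hfs
  have hac : Continuous a := Continuous.div (by fun_prop) hwc hwne
  have hb1c : Continuous b1 := Continuous.div (by fun_prop) hwc hwne
  have hb2c : Continuous b2 := Continuous.div (by fun_prop) hwc hwne
  have hb3c : Continuous b3 := Continuous.div (by fun_prop) hwc hwne
  have hfsc : Continuous fs := Continuous.div hFc hwc hwne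
  have hdivw : ∀ (v : ℂ) (y c : ℝ), 0 ≤ c → c ≤ 3 * C → ‖v‖ ≤ c * Real.exp (-δ * y) →
      ‖v / w y‖ ≤ C2 * Real.exp (-δ * y) := fun v y c hc0 hc hv => by
    rw [div_eq_mul_inv, norm_mul]
    have h1 := hwi y
    calc _ ≤ (c * Real.exp (-δ * y)) * (1/b) := by gcongr
      _ = (c / b) * Real.exp (-δ * y) := by ring
      _ ≤ C2 * Real.exp (-δ * y) := by
        gcongr
        have h2 : c / b ≤ 3 * C / b := by gcongr
        have h3 : 0 ≤ C / n0 := by positivity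
        have h4 := norm_nonneg μ0
        rw [hC2]; linarith
  have hre : ∀ (t : ℝ), ‖(t:ℂ)‖ = |t| := fun t => by rw [Complex.norm_real, Real.norm_eq_abs]
  have hab : ∀ y, 0 ≤ y → ‖a y‖ ≤ C2 * Real.exp (-δ * y) := fun y hy =>
    hdivw _ y (3*C) (by positivity) le_rfl (by
      rw [norm_mul, hre]; have := (hdiv _ hb1 y hy).1; rw [Complex.norm_ofNat]; linarith)
  have hb1b : ∀ y, 0 ≤ y → ‖b1 y‖ ≤ C2 * Real.exp (-δ * y) := fun y hy =>
    hdivw _ y (3*C) (by positivity) le_rfl (by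
      rw [norm_mul, hre]; have := (hdiv _ hb2 y hy).1; rw [Complex.norm_ofNat]; linarith)
  have hb2b : ∀ y, 0 ≤ y → ‖b2 y‖ ≤ C2 * Real.exp (-δ * y) := fun y hy =>
    hdivw _ y C hC (by linarith) (by rw [hre]; exact (hdiv _ hb3 y hy).1)
  have hb3b : ∀ y, 0 ≤ y → ‖b3 y‖ ≤ C2 * Real.exp (-δ * y) := fun y hy =>
    hdivw _ y C hC (by linarith) (by rw [hre]; exact (hdiv _ hb1 y hy).1)
  have hfsb : ∀ y, 0 ≤ y → ‖fs y‖ ≤ C2 * Real.exp (-δ * y) := fun y hy =>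
    hdivw _ y (2*C) (by positivity) (by linarith) (by
      simp only [hF]
      rw [hre]
      have h1 := (hdiv _ hb0 y hy).1
      have h2 := (hdiv _ hb1 y hy).2
      refine (abs_add_le _ _).trans ?_
      linarith)
  have hn1b : ∀ y, 0 ≤ y → ‖n1 y‖ ≤ C2 * Real.exp (-δ * y) := fun y hy => by
    simp only [hn1]
    rw [norm_div, norm_mul, norm_mul, hre, Complex.norm_I, one_mul, Complex.norm_ofNat]
    have h1 := (hdiv _ hb1 y hy).1
    have h2 := hnn0 y
    calc _ ≤ (C * Real.exp (-δ * y)) / n0 := by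
          gcongr
          linarith
      _ = (C/n0) * Real.exp (-δ * y) := by ring
      _ ≤ _ := by
        gcongr
        have h3 : 0 ≤ 3 * C / b := by positivity
        have h4 := norm_nonneg μ0
        rw [hC2]; linarith
  set N : ℝ → ℂ := fun y => ∫ s in (0:ℝ)..y, n s with hN
  set Aa : ℝ → ℂ := fun y => ∫ s in (0:ℝ)..y, a s with hAa
  have hNd : ∀ y, HasDerivAt N (n y) y := primitive_hasDerivAt hnc
  have hAd : ∀ y, HasDerivAt Aa (a y) y := primitive_hasDerivAt hac
  set D : ℝ := 1/δ + 2 with hD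
  have hD0 : 0 ≤ D := by positivity
  set α : ℝ := 4 / n0^2 * (1 + C2 * D) with hα
  have hα0 : 0 < α := by positivity
  set r : ℝ := min (1/(4*α)) (min (b/2) 1) with hr
  have hr1 : r ≤ 1/(4*α) := min_le_left _ _
  have hr2 : r ≤ b/2 := (min_le_right _ _).trans (min_le_left _ _)
  have hr3 : r ≤ 1 := (min_le_right _ _).trans (min_le_right _ _)
  have hr0 : 0 < r := by
    rw [hr]; refine lt_min (by positivity) (lt_min (by positivity) one_pos)
  have hrα : r * α ≤ 1/4 := by
    calc _ ≤ 1/(4*α) * α := by gcongr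
      _ = 1/4 := by field_simp
  set c0 : ℂ := μ0⁻¹ with hc0
  have hμ0 : μ0 ≠ 0 := fun h => by rw [hb, h] at hμ; simp at hμ
  set CC : ℝ := 2 * D * ((‖c0‖ + 3 * C4) / n0 + 4 / n0^2 * (2 * C2 * C4 + C2 * D * C4)) with hCC
  set κ0 : ℝ := 1 + 2 * δ / n0 + 2 * C2 / n0 + 4 * (4 / n0^2 * (2 * C2 + C2^2 + C2 * D)) with hκ0
  refine ⟨r, hr0, hr2, ‖μ0 - 1‖ * CC, κ0, fun κ hκ => ?_⟩
  have p1 : 0 ≤ 2 * δ / n0 := by positivity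
  have p2 : 0 ≤ 2 * C2 / n0 := by positivity
  have p3 : 0 ≤ 4 / n0^2 * (2 * C2 + C2^2 + C2 * D) := by positivity
  have k1 : 1 ≤ κ := by linarith
  have k2 : 2 * δ ≤ κ * n0 := by rw [← div_le_iff₀ hn0]; linarith
  have k3 : 2 * C2 ≤ κ * n0 := by rw [← div_le_iff₀ hn0]; linarith
  have k4 : 4 / n0^2 * (2 * C2 + C2^2 + C2 * D) ≤ κ / 4 := by linarith
  obtain ⟨X, ℓ, hℓ, hXd, hX⟩ := core_kappa (r := r) c0 hnd hn1c hac hb1c hb2c hb3c hfsc hNd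
    (by simp [hN]) hAd hn0 hδ hC20 hD (fun y _ => hnre y) hnb hn1b hab hb1b hb2b hb3b hfsb hα
    k1 k2 k3 k4 hrα
  refine ⟨fun ν => (μ0 - 1) * ℓ (X ν), ?_, fun ν hν => ⟨?_, ?_⟩⟩
  · exact (ℓ.differentiable.comp_differentiableOn hXd).const_mul _
  · intro L hL
    have hν' := mem_ball_zero_iff.1 hν
    obtain ⟨x0, t1, hx0, ht1, hx0b, ht1b, heq, hlim⟩ := hinv ν (hν'.le.trans hr2) (hν'.le.trans hr3)
    have h1 := (hX ν hν).2 x0 t1 C4 hC4 hx0 ht1 hx0b ht1b (fun y hy => by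
      have h2 := heq y hy
      have h3 : Complex.I * n y ^ 2 = w y := by
        rw [hn2]; linear_combination (-w y) * Complex.I_sq
      rw [h3]; exact h2)
    rw [← hlim L hL, ← mul_sub, norm_mul, mul_div_assoc]
    exact mul_le_mul_of_nonneg_left h1 (norm_nonneg _)
  · have hfix := (hX ν hν).1
    have hκp : 0 < κ := by linarith
    have hq0 : 0 < κ * n0 := by positivity
    set W := blW δ (κ * n0) with hW
    have hWc : Continuous W := blW_continuous _ _
    have hWp : ∀ y, 0 < W y := fun y => blW_pos hq0 y
    have hWi : IntegrableOn W (Ioi 0) := blW_integrable hδ hq0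
    set x := wx W (X ν) with hx
    have hxc : Continuous x := wx_continuous hWc _
    set ρ := rhoV n n1 a b1 b2 b3 fs κ ν x with hρ
    have hρc : Continuous ρ := by
      have hp : Continuous (fun s => ∫ t in (0:ℝ)..s, x t) :=
        continuous_iff_continuousAt.2 fun y => (primitive_hasDerivAt hxc y).continuousAt
      rw [hρ]; unfold rhoV
      fun_prop
    set E1 : ℝ → ℂ := fun y => (κ:ℂ) * N y with hE1
    set E2 : ℝ → ℂ := fun y => (κ:ℂ) * N y + Aa y with hE2
    have hE1d : ∀ y, HasDerivAt E1 ((κ:ℂ) * n y) y := fun y => (hNd y).const_mul _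
    have hE2d : ∀ y, HasDerivAt E2 ((κ:ℂ) * n y + a y) y := fun y => ((hNd y).const_mul _).add (hAd y)
    set Z : ℝ → ℂ := fun s => - Qfn E2 ρ s with hZ
    have hZd : ∀ y, HasDerivAt Z (((κ:ℂ) * n y + a y) * Z y + ρ y) y := fun y => by
      refine (Qfn_hasDerivAt hE2d hρc y).neg.congr_deriv ?_
      simp only [hZ]; ring
    have hZc : Continuous Z := continuous_iff_continuousAt.2 fun y => (hZd y).continuousAt
    set θ : ℝ → ℂ := fun y => c0 * Complex.exp (-E1 y) + Pfn E1 Z y with hθ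
    have hθd : ∀ y, HasDerivAt θ (-(κ:ℂ) * n y * θ y + Z y) y := fun y => by
      refine ((((hE1d y).neg.cexp).const_mul c0).add (Pfn_hasDerivAt hE1d hZc y)).congr_deriv ?_
      simp only [hθ, Pi.neg_apply]; ring
    have hθc : Continuous θ := continuous_iff_continuousAt.2 fun y => (hθd y).continuousAt
    have hxθ : ∀ y, 0 ≤ y → x y = θ y := hfix
    set g : ℝ → ℂ := fun y => ∫ s in (0:ℝ)..y, θ s with hg
    have hgd : ∀ y, HasDerivAt g (θ y) y := primitive_hasDerivAt hθc
    have hgx : ∀ y, 0 ≤ y → ∫ s in (0:ℝ)..y, x s = g y := fun y hy => by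
      refine intervalIntegral.integral_congr fun s hs => ?_
      rw [uIcc_of_le hy] at hs
      exact hxθ s hs.1
    set θ' : ℝ → ℂ := fun y => -(κ:ℂ) * n y * θ y + Z y with hθ'
    have hθ'd : ∀ y, HasDerivAt θ' (-(κ:ℂ) * n1 y * θ y + -(κ:ℂ) * n y * θ' y +
        (((κ:ℂ) * n y + a y) * Z y + ρ y)) y := fun y =>
      (((hnd y).const_mul _).mul (hθd y)).add (hZd y)
    have hgt : Tendsto g atTop (nhds (ℓ (X ν))) := by
      rw [hℓ]
      refine (intervalIntegral_tendsto_integral_Ioi 0 (wx_integrable hWc hWp hWi (X ν))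
        tendsto_id).congr' ?_
      filter_upwards [eventually_ge_atTop 0] with y hy
      exact hgx y hy
    have hexp : Tendsto (fun y => C * Real.exp (-δ * y)) atTop (nhds 0) := by
      have h1 : Tendsto (fun y : ℝ => -δ * y) atTop atBot :=
        tendsto_id.const_mul_atTop_of_neg (by linarith)
      have := (Real.tendsto_exp_atBot.comp h1).const_mul C
      simpa using this
    have hU1t : Tendsto (fun y => (U1 y:ℂ)) atTop (nhds 0) := by
      refine squeeze_zero_norm' ?_ hexp
      filter_upwards [eventually_ge_atTop 0] with y hy
      rw [hre]; exact (hdiv _ hb1 y hy).1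
    have hwt : Tendsto w atTop (nhds (μ0 - 1)) := by
      have h2 : Tendsto (fun y => ((1 - U y : ℝ) : ℂ)) atTop (nhds 0) := by
        refine squeeze_zero_norm' ?_ hexp
        filter_upwards [eventually_ge_atTop 0] with y hy
        rw [hre]; exact (hdiv _ hb0 y hy).1
      have h3 := h2.const_add (μ0 - 1)
      rw [add_zero] at h3
      refine h3.congr fun y => ?_
      simp only [hw]; push_cast; ring
    have hθt : Tendsto θ atTop (nhds 0) := by
      have h1 : Tendsto (fun y => ‖X ν‖ * W y) atTop (nhds 0) := by
        have := (blW_tendsto hδ hq0).const_mul ‖X ν‖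
        rw [mul_zero] at this
        exact this
      refine squeeze_zero_norm' ?_ h1
      filter_upwards [eventually_ge_atTop 0] with y hy
      rw [← hxθ y hy]; exact wx_norm_le hWp _ y
    refine ⟨fun y => w y * g y, fun y => w y * θ y - (U1 y:ℂ) * g y,
      fun y => w y * θ' y - 2 * (U1 y:ℂ) * θ y - (U2 y:ℂ) * g y, ?_, ?_, ?_, ?_, ?_, ?_, ?_⟩
    · intro y hy
      refine ((hwd y).mul (hgd y)).congr_deriv ?_
      ring
    · intro y hy
      refine (((hwd y).mul (hθd y)).sub (((hU1 y).ofReal_comp).mul (hgd y))).congr_deriv ?_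
      simp only [hθ']
      ring
    · intro y hy
      have d1 := (hwd y).mul (hθ'd y)
      have d2 := (((hU1 y).ofReal_comp).const_mul (2:ℂ)).mul (hθd y)
      have d3 := ((hU2 y).ofReal_comp).mul (hgd y)
      refine ((d1.sub d2).sub d3).congr_deriv ?_
      have r1 : ρ y = ((κ:ℂ) * (n1 y - a y * n y) + b1 y) * θ y + b2 y * g y
          - Complex.I * (κ:ℂ)^2 * ν * (θ y - b3 y * g y) + Complex.I * (κ:ℂ)^2 * fs y := by
        rw [hρ]; unfold rhoV
        rw [hgx y hy, hxθ y hy]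
      have q1 : a y * w y = 3 * (U1 y:ℂ) := div_mul_cancel₀ _ (hwne y)
      have q2 : b1 y * w y = 3 * (U2 y:ℂ) := div_mul_cancel₀ _ (hwne y)
      have q3 : b2 y * w y = (U3 y:ℂ) := div_mul_cancel₀ _ (hwne y)
      have q4 : b3 y * w y = (U1 y:ℂ) := div_mul_cancel₀ _ (hwne y)
      have q5 : fs y * w y = F y := div_mul_cancel₀ _ (hwne y)
      have q6 := hn2 y
      have q7 : μ0 + ν - (U y:ℂ) = w y + ν := by simp only [hw]; ring
      rw [r1, q7]
      show _ = -Complex.I * (κ:ℂ)^2 * ((w y + ν) * (w y * θ y - (U1 y:ℂ) * g y)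
            + (U1 y:ℂ) * (w y * g y) - F y)
      simp only [hθ']
      linear_combination ((κ:ℂ)^2 * θ y * w y) * q6 + (Z y - (κ:ℂ) * n y * θ y) * q1 + θ y * q2
        + g y * q3 + Complex.I * (κ:ℂ)^2 * ν * g y * q4 + Complex.I * (κ:ℂ)^2 * q5
    · simp [hg]
    · simp [hg, hθ, hw, hU00, Pfn, hE1, hN, hc0, hμ0]
    · have := (hwt.mul hθt).sub (hU1t.mul hgt)
      simpa using this
    · exact hwt.mul hgt

/-- Gluing of a function on the right half line with another one on the left. -/
def glueR (f g : ℝ → ℂ) (y : ℝ) : ℂ := if 0 ≤ y then f y else g y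

lemma glueR_hasDerivAt {f g f' g' : ℝ → ℂ} {η : ℝ} (hη : 0 < η)
    (hf : ∀ y, 0 ≤ y → HasDerivAt f (f' y) y)
    (hg : ∀ y ∈ Ioo (-η) η, HasDerivAt g (g' y) y)
    (h0 : g 0 = f 0) (h0' : g' 0 = f' 0) :
    ∀ y ∈ Ioi (-η), HasDerivAt (glueR f g) (glueR f' g' y) y := by
  intro y hy
  have hy' : -η < y := hy
  rcases lt_trichotomy y 0 with h | h | h
  · have h1 : glueR f' g' y = g' y := by simp [glueR, not_le.2 h]
    rw [h1]
    refine (hg y ⟨hy', by linarith⟩).congr_of_eventuallyEq ?_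
    filter_upwards [Iio_mem_nhds h] with z hz
    simp [glueR, not_le.2 (show z < 0 from hz)]
  · subst h
    have h1 : glueR f' g' 0 = f' 0 := by simp [glueR]
    rw [h1]
    have hr : HasDerivWithinAt (glueR f g) (f' 0) (Ici 0) 0 := by
      refine (hf 0 le_rfl).hasDerivWithinAt.congr (fun z hz => ?_) (by simp [glueR])
      simp [glueR, show (0:ℝ) ≤ z from hz]
    have hl : HasDerivWithinAt (glueR f g) (f' 0) (Iic 0) 0 := by
      rw [← h0']
      refine (hg 0 ⟨hy', hη⟩).hasDerivWithinAt.congr (fun z hz => ?_) (by simp [glueR, h0])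
      rcases eq_or_lt_of_le (show z ≤ 0 from hz) with h | h
      · subst h; simp [glueR, h0]
      · simp [glueR, not_le.2 h]
    have := hl.union hr
    rwa [Iic_union_Ici, hasDerivWithinAt_univ] at this
  · have h1 : glueR f' g' y = f' y := by simp [glueR, h.le]
    rw [h1]
    refine (hf y h.le).congr_of_eventuallyEq ?_
    filter_upwards [Ioi_mem_nhds h] with z hz
    simp [glueR, (show 0 < z from hz).le]

lemma hasDerivAt_fst_comp {E F : Type*} [NormedAddCommGroup E] [NormedSpace ℝ E]
    [NormedAddCommGroup F] [NormedSpace ℝ F] {β : ℝ → E × F} {β' : E × F} {t : ℝ}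
    (h : HasDerivAt β β' t) : HasDerivAt (fun t => (β t).1) β'.1 t :=
  (hasFDerivAt_fst (𝕜 := ℝ) (p := β t)).comp_hasDerivAt t h

lemma hasDerivAt_snd_comp {E F : Type*} [NormedAddCommGroup E] [NormedSpace ℝ E]
    [NormedAddCommGroup F] [NormedSpace ℝ F] {β : ℝ → E × F} {β' : E × F} {t : ℝ}
    (h : HasDerivAt β β' t) : HasDerivAt (fun t => (β t).2) β'.2 t :=
  (hasFDerivAt_snd (𝕜 := ℝ) (p := β t)).comp_hasDerivAt t h

/-- Local backward solution of a linear third order ODE. -/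
lemma local_backward {p0 p1 q : ℝ → ℂ} (hp0 : ContDiff ℝ 1 p0) (hp1 : ContDiff ℝ 1 p1)
    (hq : ContDiff ℝ 1 q) (x0 x1 x2 : ℂ) :
    ∃ η > 0, ∃ φ φ1 φ2 : ℝ → ℂ, φ 0 = x0 ∧ φ1 0 = x1 ∧ φ2 0 = x2 ∧
      ∀ y ∈ Ioo (-η) η, HasDerivAt φ (φ1 y) y ∧ HasDerivAt φ1 (φ2 y) y ∧
        HasDerivAt φ2 (p1 y * φ1 y + p0 y * φ y + q y) y := by
  let f : ℝ × ℂ × ℂ × ℂ → ℝ × ℂ × ℂ × ℂ := fun x =>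
    (1, x.2.2.1, x.2.2.2, p1 x.1 * x.2.2.1 + p0 x.1 * x.2.1 + q x.1)
  have hf : ContDiff ℝ 1 f := by
    have e1 : ContDiff ℝ 1 (fun x : ℝ × ℂ × ℂ × ℂ => x.2.2.1) := by fun_prop
    have e2 : ContDiff ℝ 1 (fun x : ℝ × ℂ × ℂ × ℂ => x.2.1) := by fun_prop
    have e3 : ContDiff ℝ 1 (fun x : ℝ × ℂ × ℂ × ℂ => x.2.2.2) := by fun_prop
    have e4 : ContDiff ℝ 1 (fun x : ℝ × ℂ × ℂ × ℂ => x.1) := by fun_prop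
    exact contDiff_const.prodMk (e1.prodMk (e3.prodMk
      ((((hp1.comp e4).mul e1).add ((hp0.comp e4).mul e2)).add (hq.comp e4))))
  obtain ⟨r, hr, ε, hε, H⟩ :=
    ContDiffAt.exists_forall_mem_closedBall_exists_eq_forall_mem_Ioo_hasDerivAt
      (hf.contDiffAt (x := ((0:ℝ), x0, x1, x2))) 0
  obtain ⟨α, hα0, hα⟩ := H _ (Metric.mem_closedBall_self hr.le)
  rw [zero_sub, zero_add] at hα
  have hd1 : ∀ t ∈ Ioo (-ε) ε, HasDerivAt (fun t => (α t).1) 1 t := fun t ht =>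
    hasDerivAt_fst_comp (hα t ht)
  have hd2 : ∀ t ∈ Ioo (-ε) ε, HasDerivAt (fun t => (α t).2) (f (α t)).2 t := fun t ht =>
    hasDerivAt_snd_comp (hα t ht)
  have hd21 : ∀ t ∈ Ioo (-ε) ε, HasDerivAt (fun t => (α t).2.1) (f (α t)).2.1 t := fun t ht =>
    hasDerivAt_fst_comp (hd2 t ht)
  have hd22 : ∀ t ∈ Ioo (-ε) ε, HasDerivAt (fun t => (α t).2.2) (f (α t)).2.2 t := fun t ht =>
    hasDerivAt_snd_comp (hd2 t ht)
  have hd221 : ∀ t ∈ Ioo (-ε) ε, HasDerivAt (fun t => (α t).2.2.1) (f (α t)).2.2.1 t :=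
    fun t ht => hasDerivAt_fst_comp (hd22 t ht)
  have hd222 : ∀ t ∈ Ioo (-ε) ε, HasDerivAt (fun t => (α t).2.2.2) (f (α t)).2.2.2 t :=
    fun t ht => hasDerivAt_snd_comp (hd22 t ht)
  have htime : ∀ t ∈ Ioo (-ε) ε, (α t).1 = t := fun t ht => by
    have h0 : (0:ℝ) ∈ Ioo (-ε) ε := ⟨by linarith, hε⟩
    have hd : ∀ t ∈ Ioo (-ε) ε, HasDerivAt (fun t => (α t).1 - t) 0 t := fun t ht => by
      exact ((hd1 t ht).fun_sub (hasDerivAt_id' t)).congr_deriv (sub_self 1)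
    have := isOpen_Ioo.is_const_of_deriv_eq_zero isPreconnected_Ioo
      (fun t ht => (hd t ht).differentiableAt.differentiableWithinAt)
      (fun t ht => (hd t ht).deriv) ht h0
    simp only [hα0] at this
    linarith
  refine ⟨ε, hε, fun t => (α t).2.1, fun t => (α t).2.2.1, fun t => (α t).2.2.2,
    by simp [hα0], by simp [hα0], by simp [hα0], fun y hy => ⟨hd21 y hy, hd221 y hy, ?_⟩⟩
  have := hd222 y hy
  simp only [f, htime y hy] at this
  exact this

/-- Solutions on the half line of linear ODEs with smooth coefficients extend smoothly. -/
lemma smooth_extension {p0 p1 q : ℝ → ℂ} (hp0 : ContDiff ℝ (⊤ : ℕ∞) p0)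
    (hp1 : ContDiff ℝ (⊤ : ℕ∞) p1) (hq : ContDiff ℝ (⊤ : ℕ∞) q) {φ φ1 φ2 : ℝ → ℂ}
    (h0 : ∀ y, 0 ≤ y → HasDerivAt φ (φ1 y) y) (h1 : ∀ y, 0 ≤ y → HasDerivAt φ1 (φ2 y) y)
    (h2 : ∀ y, 0 ≤ y → HasDerivAt φ2 (p1 y * φ1 y + p0 y * φ y + q y) y) :
    ∃ ψ : ℝ → ℂ, ContDiff ℝ (⊤ : ℕ∞) ψ ∧ ∀ y, 0 ≤ y → ψ y = φ y ∧ deriv ψ y = φ1 y ∧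
      iteratedDeriv 3 ψ y = p1 y * φ1 y + p0 y * φ y + q y := by
  have h1t : (1 : WithTop ℕ∞) ≤ ((⊤ : ℕ∞) : WithTop ℕ∞) := by exact_mod_cast le_top
  obtain ⟨η, hη, χ, χ1, χ2, e0, e1, e2, hχ⟩ := local_backward (hp0.of_le h1t) (hp1.of_le h1t)
    (hq.of_le h1t) (φ 0) (φ1 0) (φ2 0)
  set g := glueR φ χ with hg
  set g1 := glueR φ1 χ1 with hg1
  set g2 := glueR φ2 χ2 with hg2
  have d0 : ∀ y ∈ Ioi (-η), HasDerivAt g (g1 y) y :=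
    glueR_hasDerivAt hη h0 (fun y hy => (hχ y hy).1) e0 e1
  have d1 : ∀ y ∈ Ioi (-η), HasDerivAt g1 (g2 y) y :=
    glueR_hasDerivAt hη h1 (fun y hy => (hχ y hy).2.1) e1 e2
  have d2 : ∀ y ∈ Ioi (-η), HasDerivAt g2 (p1 y * g1 y + p0 y * g y + q y) y := by
    intro y hy
    have := glueR_hasDerivAt hη h2 (fun y hy => (hχ y hy).2.2) e2 (by rw [e0, e1]) y hy
    convert this using 1
    simp only [hg, hg1, glueR]
    split_ifs <;> rfl
  have hsm : ∀ n : ℕ, ContDiffOn ℝ n g (Ioi (-η)) ∧ ContDiffOn ℝ n g1 (Ioi (-η)) ∧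
      ContDiffOn ℝ n g2 (Ioi (-η)) := by
    have key : ∀ (n : ℕ) (u v : ℝ → ℂ), (∀ y ∈ Ioi (-η), HasDerivAt u (v y) y) →
        ContDiffOn ℝ n v (Ioi (-η)) → ContDiffOn ℝ (n+1 : ℕ) u (Ioi (-η)) := by
      intro n u v huv hv
      push_cast
      rw [contDiffOn_succ_iff_deriv_of_isOpen isOpen_Ioi]
      refine ⟨fun y hy => (huv y hy).differentiableAt.differentiableWithinAt, by simp, ?_⟩
      exact hv.congr fun y hy => (huv y hy).deriv
    intro n
    induction n with
    | zero =>
      simp only [Nat.cast_zero, contDiffOn_zero]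
      exact ⟨fun y hy => (d0 y hy).continuousAt.continuousWithinAt,
        fun y hy => (d1 y hy).continuousAt.continuousWithinAt,
        fun y hy => (d2 y hy).continuousAt.continuousWithinAt⟩
    | succ n ih =>
      obtain ⟨i0, i1, i2⟩ := ih
      have hn : ((n : ℕ∞) : WithTop ℕ∞) ≤ ((⊤ : ℕ∞) : WithTop ℕ∞) := by
        exact_mod_cast le_top
      refine ⟨key n _ _ d0 i1, key n _ _ d1 i2, key n _ _ d2 ?_⟩
      exact (((hp1.of_le hn).contDiffOn.mul i1).add ((hp0.of_le hn).contDiffOn.mul i0)).add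
        (hq.of_le hn).contDiffOn
  have hgs : ContDiffOn ℝ (⊤ : ℕ∞) g (Ioi (-η)) := contDiffOn_infty.2 fun n => (hsm n).1
  set c : ℝ → ℂ := fun y => ((Real.smoothTransition (4 / η * y + 2) : ℝ) : ℂ) with hc
  have hcs : ContDiff ℝ (⊤ : ℕ∞) c := by
    have : ContDiff ℝ (⊤ : ℕ∞) (fun y : ℝ => Real.smoothTransition (4 / η * y + 2)) :=
      Real.smoothTransition.contDiff.comp (by fun_prop)
    exact Complex.ofRealCLM.contDiff.comp this
  have hc1 : ∀ y, -η/4 < y → c y = 1 := fun y hy => by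
    simp only [hc]
    rw [Real.smoothTransition.one_of_one_le]; · simp
    have : 4 / η * y > 4/η * (-η/4) := by gcongr
    have h : 4/η * (-η/4) = -1 := by field_simp
    linarith
  have hc0 : ∀ y, y < -η/2 → c y = 0 := fun y hy => by
    simp only [hc]
    rw [Real.smoothTransition.zero_of_nonpos]; · simp
    have : 4 / η * y < 4/η * (-η/2) := by gcongr
    have h : 4/η * (-η/2) = -2 := by field_simp; norm_num
    linarith
  set ψ : ℝ → ℂ := fun y => c y * g y with hψ
  have hψe : ∀ y, -η/4 < y → ψ =ᶠ[nhds y] g := fun y hy => by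
    filter_upwards [Ioi_mem_nhds hy] with z hz
    simp [hψ, hc1 z hz]
  have hd0 : ∀ y, -η/4 < y → deriv ψ y = g1 y := fun y hy => by
    rw [(hψe y hy).deriv_eq]; exact (d0 y (by simp only [mem_Ioi]; linarith)).deriv
  have hd1 : ∀ y, -η/4 < y → deriv (deriv ψ) y = g2 y := fun y hy => by
    have : deriv ψ =ᶠ[nhds y] g1 := by
      filter_upwards [Ioi_mem_nhds hy] with z hz using hd0 z hz
    rw [this.deriv_eq]; exact (d1 y (by simp only [mem_Ioi]; linarith)).deriv
  have hd2 : ∀ y, -η/4 < y → deriv (deriv (deriv ψ)) y = p1 y * g1 y + p0 y * g y + q y :=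
    fun y hy => by
    have : deriv (deriv ψ) =ᶠ[nhds y] g2 := by
      filter_upwards [Ioi_mem_nhds hy] with z hz using hd1 z hz
    rw [this.deriv_eq]; exact (d2 y (by simp only [mem_Ioi]; linarith)).deriv
  refine ⟨ψ, ?_, fun y hy => ?_⟩
  · rw [contDiff_iff_contDiffAt]
    intro y
    by_cases hy : -η < y
    · exact hcs.contDiffAt.mul (hgs.contDiffAt (Ioi_mem_nhds hy))
    · have : ψ =ᶠ[nhds y] fun _ => 0 := by
        have hy' : y < -η/2 := by linarith
        filter_upwards [Iio_mem_nhds hy'] with z hz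
        simp [hψ, hc0 z hz]
      exact contDiffAt_const.congr_of_eventuallyEq this
  · have hy' : -η/4 < y := by linarith
    have a0 : g y = φ y := by simp [hg, glueR, hy]
    have a1 : g1 y = φ1 y := by simp [hg1, glueR, hy]
    refine ⟨by rw [(hψe y hy').eq_of_nhds, a0], by rw [hd0 y hy', a1], ?_⟩
    rw [iteratedDeriv_succ, iteratedDeriv_succ, iteratedDeriv_one, hd2 y hy', a0, a1]

/-- The kernel `ρ_μ(u) = 1 - (2μ-1-u)/(μ-u)²`. -/
def rhoK (μ : ℂ) (u : ℝ) : ℂ := 1 - (2 * μ - 1 - (u:ℂ)) / (μ - (u:ℂ))^2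

lemma sub_real_ne {μ : ℂ} (hb : 0 < μ.im) (u : ℝ) : μ - (u:ℂ) ≠ 0 := fun h => by
  have := congrArg Complex.im h
  simp at this; linarith

lemma rhoK_continuous {μ : ℂ} (hb : 0 < μ.im) : Continuous (rhoK μ) := by
  unfold rhoK
  refine continuous_const.sub (Continuous.div (by fun_prop) (by fun_prop) fun u => ?_)
  exact pow_ne_zero 2 (sub_real_ne hb u)

/-- Cross product in the plane. -/
def crossC (z w : ℂ) : ℝ := z.re * w.im - z.im * w.re

lemma crossC_scale {z w z' w' : ℂ} {s t : ℝ} (hs : 0 < s) (ht : 0 < t)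
    (hz : z * (s:ℂ) = z') (hw : w * (t:ℂ) = w') (h : 0 < crossC z' w') : 0 < crossC z w := by
  have h1 : crossC z' w' = (s * t) * crossC z w := by
    rw [← hz, ← hw]
    simp only [crossC, Complex.mul_re, Complex.mul_im, Complex.ofReal_re, Complex.ofReal_im]
    ring
  rw [h1] at h
  exact (mul_pos_iff_of_pos_left (mul_pos hs ht)).1 h

lemma rho_cross {μ : ℂ} (ha : 0 < μ.re) (ha1 : μ.re < 1) (hb : 0 < μ.im)
    (hb1 : μ.im < Real.sqrt (3 * μ.re * (1 - μ.re) ^ 2 / (4 - 3 * μ.re))) :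
    ∃ x ∈ Icc (0:ℝ) 1, 0 < crossC (rhoK μ 0) (rhoK μ 1) ∧ 0 < crossC (rhoK μ 1) (rhoK μ x) ∧
      0 < crossC (rhoK μ x) (rhoK μ 0) := by
  set a := μ.re with hadef
  set b := μ.im with hbdef
  set c := 1 - a with hc
  have hc0 : 0 < c := by linarith
  have hkey : b^2 * (1 + 3 * c) < 3 * a * c^2 := by
    have h1 := (Real.lt_sqrt hb.le).1 hb1
    rw [lt_div_iff₀ (by linarith)] at h1
    have : 4 - 3 * a = 1 + 3 * c := by rw [hc]; ring
    rwa [this] at h1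
  have hbac : b^2 < a * c := by
    by_contra h
    push Not at h
    nlinarith [sq_nonneg b]
  set p := b^2 / c with hp
  have hp0 : 0 < p := by positivity
  have hpa : p < a := by rw [hp, div_lt_iff₀ hc0]; exact hbac
  have hpc : p * c = b^2 := by rw [hp]; field_simp
  have hμ : μ = (a:ℂ) + (b:ℂ) * Complex.I := (Complex.re_add_im μ).symm
  have hμ0 : μ ≠ 0 := by simpa using sub_real_ne hb 0
  have hμ1 : μ - 1 ≠ 0 := by simpa using sub_real_ne hb 1
  have hcj : (starRingEnd ℂ) μ ≠ 0 := by simpa using hμ0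
  have hcj1 : (starRingEnd ℂ) (μ - 1) ≠ 0 := by
    rw [Ne, map_eq_zero]; exact hμ1
  -- values
  have r0 : rhoK μ 0 * ((Complex.normSq μ ^ 2 : ℝ) : ℂ) =
      ⟨(b^2 - a * c)^2 - b^2, 2 * b * (b^2 - a*c)⟩ := by
    have e1 : rhoK μ 0 * ((Complex.normSq μ ^ 2 : ℝ) : ℂ) =
        ((μ - 1) * (starRingEnd ℂ) μ)^2 := by
      push_cast
      rw [← Complex.mul_conj, rhoK]
      simp only [Complex.ofReal_zero, sub_zero]
      field_simp
      ring
    rw [e1]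
    have e2 : (μ - 1) * (starRingEnd ℂ) μ = ⟨b^2 - a * c, b⟩ := by
      apply Complex.ext
      · simp [← hadef, ← hbdef, hc]; ring
      · simp [← hadef, ← hbdef]; ring
    rw [e2, pow_two]
    apply Complex.ext <;> simp <;> ring
  have r1 : rhoK μ 1 * ((Complex.normSq (μ - 1) : ℝ) : ℂ) =
      ⟨c^2 + b^2 + 2 * c, 2 * b⟩ := by
    have e1 : rhoK μ 1 * ((Complex.normSq (μ - 1) : ℝ) : ℂ) =
        (μ - 1) * (starRingEnd ℂ) (μ - 1) - 2 * (starRingEnd ℂ) (μ - 1) := by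
      rw [← Complex.mul_conj, rhoK]
      simp only [Complex.ofReal_one]
      have : 2 * μ - 1 - 1 = 2 * (μ - 1) := by ring
      rw [this]
      field_simp
    rw [e1]
    apply Complex.ext
    · simp [← hadef, ← hbdef, hc]; ring
    · simp [← hadef, ← hbdef, hc]; ring
  have rx : rhoK μ (a - p) * ((p : ℝ) : ℂ) = ⟨p - 1, 0⟩ := by
    have e1 : μ - ((a - p : ℝ) : ℂ) = p + b * Complex.I := by
      rw [hμ]; push_cast; ring
    have e2 : (2 * μ - 1 - ((a - p : ℝ) : ℂ)) = p - c + 2 * b * Complex.I := by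
      rw [hμ, hc]; push_cast; ring
    have e3 : ((p:ℂ) + b * Complex.I)^2 = p * (p - c + 2 * b * Complex.I) := by
      have : (p:ℂ) * c = (b:ℂ)^2 := by exact_mod_cast hpc
      have h2 := Complex.I_sq
      linear_combination this + (b:ℂ)^2 * h2
    have hne : ((p:ℂ) + b * Complex.I)^2 ≠ 0 := by
      rw [← e1]; exact pow_ne_zero 2 (sub_real_ne hb _)
    have hp0' : (p:ℂ) ≠ 0 := by exact_mod_cast hp0.ne'
    have hne2 : ((p:ℂ) - c + 2 * b * Complex.I) ≠ 0 := fun h => hne (by rw [e3, h, mul_zero])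
    rw [rhoK, e1, e2, e3]
    have : (⟨p - 1, 0⟩ : ℂ) = (p:ℂ) - 1 := by apply Complex.ext <;> simp
    rw [this]
    field_simp
  have hs0 : 0 < Complex.normSq μ ^ 2 := by
    have := Complex.normSq_pos.2 hμ0; positivity
  have hs1 : 0 < Complex.normSq (μ - 1) := Complex.normSq_pos.2 hμ1
  refine ⟨a - p, ⟨by linarith, by linarith⟩, crossC_scale hs0 hs1 r0 r1 ?_,
    crossC_scale hs1 hp0 r1 rx ?_, crossC_scale hp0 hs0 rx r0 ?_⟩
  · simp only [crossC]
    have : ((b^2 - a * c)^2 - b^2) * (2 * b) - 2 * b * (b^2 - a * c) * (c^2 + b^2 + 2 * c)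
      = 2 * b * (3 * a * c^2 - b^2 * (1 + 3 * c)) := by
      rw [show a = 1 - c by rw [hc]; ring]; ring
    rw [this]
    have : 0 < 3 * a * c^2 - b^2 * (1 + 3 * c) := by linarith
    positivity
  · simp only [crossC]
    nlinarith
  · simp only [crossC]
    have : 0 < (1 - p) * (b * (a * c - b^2)) :=
      mul_pos (by linarith) (mul_pos hb (by linarith))
    nlinarith

/-- Polynomial bump. -/
def bumpP (x : ℝ) : Polynomial ℝ :=
  (Polynomial.C 4 - (Polynomial.X^2 - Polynomial.C (x^2))^2)^2 + 1

lemma bumpP_eval (x u : ℝ) : (bumpP x).eval u = (4 - (u^2 - x^2)^2)^2 + 1 := by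
  simp [bumpP]

lemma bumpP_deriv (x : ℝ) (n : ℕ) : ((bumpP x)^n).derivative.eval 0 = 0 := by
  rw [Polynomial.derivative_pow]
  simp [bumpP, Polynomial.derivative_pow]

lemma bumpP_tendsto {μ : ℂ} (hb : 0 < μ.im) {x : ℝ} (hx : x ∈ Icc (0:ℝ) 1) :
    Tendsto (fun n : ℕ => (∫ u in Icc (0:ℝ) 1, (bumpP x).eval u ^ n)⁻¹ •
      ∫ u in Icc (0:ℝ) 1, ((bumpP x).eval u ^ n) • rhoK μ u) atTop (nhds (rhoK μ x)) := by
  refine tendsto_setIntegral_pow_smul_of_unique_maximum_of_isCompact_of_continuousOn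
    (μ := volume) isCompact_Icc (bumpP x).continuous.continuousOn ?_ ?_ ?_ ?_
    (rhoK_continuous hb).continuousOn
  · intro u hu hne
    rw [bumpP_eval, bumpP_eval]
    have h1 : 0 < (u^2 - x^2)^2 := by
      have : u^2 - x^2 ≠ 0 := fun h => hne (by
        have h2 : u^2 = x^2 := by linarith
        exact (sq_eq_sq₀ hu.1 hx.1).1 h2)
      positivity
    have h2 : (u^2 - x^2)^2 ≤ 1 := by
      have := hu.1; have := hu.2; have := hx.1; have := hx.2
      have h3 : u^2 ≤ 1 := by nlinarith
      have h4 : x^2 ≤ 1 := by nlinarith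
      rw [sq_le_one_iff_abs_le_one, abs_le]
      constructor <;> nlinarith [sq_nonneg u, sq_nonneg x]
    nlinarith
  · intro u hu; rw [bumpP_eval]; positivity
  · rw [bumpP_eval]; positivity
  · rw [interior_Icc, closure_Ioo (by norm_num)]; exact hx

lemma tendsto_crossC {u v : ℕ → ℂ} {z w : ℂ} (hu : Tendsto u atTop (nhds z))
    (hv : Tendsto v atTop (nhds w)) (h : 0 < crossC z w) : ∀ᶠ n in atTop, 0 < crossC (u n) (v n) := by
  have : Tendsto (fun n => crossC (u n) (v n)) atTop (nhds (crossC z w)) := by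
    have r := Complex.continuous_re.tendsto
    have i := Complex.continuous_im.tendsto
    exact (((r z).comp hu).mul ((i w).comp hv)).sub (((i z).comp hu).mul ((r w).comp hv))
  exact this.eventually (lt_mem_nhds h)

/-- Existence of the weight. -/
lemma exists_weight {μ : ℂ} (ha : 0 < μ.re) (ha1 : μ.re < 1) (hb : 0 < μ.im)
    (hb1 : μ.im < Real.sqrt (3 * μ.re * (1 - μ.re) ^ 2 / (4 - 3 * μ.re))) :
    ∃ P : Polynomial ℝ, (∃ h0 > 0, ∀ u, h0 ≤ P.eval u) ∧ P.derivative.eval 0 = 0 ∧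
      ∫ u in (0:ℝ)..1, rhoK μ u * ((P.eval u : ℝ) : ℂ) = 0 := by
  obtain ⟨x, hx, h01, h1x, hx0⟩ := rho_cross ha ha1 hb hb1
  have t0 := bumpP_tendsto hb (x := 0) ⟨le_rfl, zero_le_one⟩
  have t1 := bumpP_tendsto hb (x := 1) ⟨zero_le_one, le_rfl⟩
  have tx := bumpP_tendsto hb hx
  obtain ⟨n, e01, e1x, ex0⟩ := ((tendsto_crossC t0 t1 h01).and
    ((tendsto_crossC t1 tx h1x).and (tendsto_crossC tx t0 hx0))).exists
  have hIpos : ∀ x, 0 < (∫ u in Icc (0:ℝ) 1, (bumpP x).eval u ^ n) := fun x => by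
    have h1 : ∫ u in Icc (0:ℝ) 1, (1:ℝ) ≤ ∫ u in Icc (0:ℝ) 1, (bumpP x).eval u ^ n := by
      refine setIntegral_mono (by simp) ?_ fun u => ?_
      · exact (((bumpP x).continuous.pow n).continuousOn).integrableOn_Icc
      · apply one_le_pow₀
        rw [bumpP_eval]; nlinarith [sq_nonneg (4 - (u^2 - x^2)^2)]
    simp at h1
    linarith
  set z : ℝ → ℂ := fun x => (∫ u in Icc (0:ℝ) 1, (bumpP x).eval u ^ n)⁻¹ •
      ∫ u in Icc (0:ℝ) 1, ((bumpP x).eval u ^ n) • rhoK μ u with hz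
  set I : ℝ → ℝ := fun x => (∫ u in Icc (0:ℝ) 1, (bumpP x).eval u ^ n)⁻¹ with hI
  have hI0 : ∀ x, 0 < I x := fun x => inv_pos.2 (hIpos x)
  change 0 < crossC (z 0) (z 1) at e01
  change 0 < crossC (z 1) (z x) at e1x
  change 0 < crossC (z x) (z 0) at ex0
  set A0 := crossC (z 1) (z x) * I 0 with hA0
  set A1 := crossC (z x) (z 0) * I 1 with hA1
  set A2 := crossC (z 0) (z 1) * I x with hA2
  have p0 : 0 < A0 := mul_pos e1x (hI0 _)
  have p1 : 0 < A1 := mul_pos ex0 (hI0 _)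
  have p2 : 0 < A2 := mul_pos e01 (hI0 _)
  have hev : ∀ u, (Polynomial.C A0 * (bumpP 0)^n + Polynomial.C A1 * (bumpP 1)^n
    + Polynomial.C A2 * (bumpP x)^n).eval u = A0 * (bumpP 0).eval u ^n + A1 * (bumpP 1).eval u ^n
    + A2 * (bumpP x).eval u^n := fun u => by simp
  refine ⟨Polynomial.C A0 * (bumpP 0)^n + Polynomial.C A1 * (bumpP 1)^n
    + Polynomial.C A2 * (bumpP x)^n, ⟨A0, p0, fun u => ?_⟩, ?_, ?_⟩
  · rw [hev]
    have hone : ∀ x, 1 ≤ (bumpP x).eval u ^ n := fun x => by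
      apply one_le_pow₀
      rw [bumpP_eval]; nlinarith [sq_nonneg (4 - (u^2 - x^2)^2)]
    have := hone 0
    have := hone 1
    have := hone x
    nlinarith
  · simp only [Polynomial.derivative_add, Polynomial.derivative_C_mul, Polynomial.eval_add,
      Polynomial.eval_mul, bumpP_deriv, mul_zero, add_zero]
  · simp only [hev]
    rw [intervalIntegral.integral_of_le zero_le_one, ← integral_Icc_eq_integral_Ioc]
    have hintg : ∀ x, IntegrableOn (fun u => ((bumpP x).eval u ^ n) • rhoK μ u) (Icc (0:ℝ) 1) :=
      fun x => (((bumpP x).continuous.pow n).smul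
        (rhoK_continuous hb)).continuousOn.integrableOn_Icc
    have hfun : ∀ u, rhoK μ u * ((A0 * (bumpP 0).eval u ^n + A1 * (bumpP 1).eval u ^n
        + A2 * (bumpP x).eval u^n : ℝ) : ℂ) = (A0:ℂ) * (((bumpP 0).eval u ^ n) • rhoK μ u)
        + (A1:ℂ) * (((bumpP 1).eval u ^ n) • rhoK μ u)
        + (A2:ℂ) * (((bumpP x).eval u ^ n) • rhoK μ u) := fun u => by
      simp only [Complex.real_smul]; push_cast; ring
    simp only [hfun]
    rw [integral_add (Integrable.fun_add ((hintg _).const_mul _) ((hintg _).const_mul _))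
        ((hintg _).const_mul _), integral_add ((hintg _).const_mul _) ((hintg _).const_mul _),
      integral_const_mul, integral_const_mul, integral_const_mul]
    have hfac : ∀ (x t : ℝ), ((t * I x : ℝ) : ℂ) *
        ∫ u in Icc (0:ℝ) 1, ((bumpP x).eval u ^ n) • rhoK μ u = (t:ℂ) * z x := fun x t => by
      simp only [hz, hI, Complex.real_smul]; push_cast; ring
    rw [hA0, hA1, hA2, hfac, hfac, hfac]
    apply Complex.ext
    · simp [crossC]; ring
    · simp [crossC]; ring

lemma poly_contDiff (P : Polynomial ℝ) : ContDiff ℝ (⊤ : ℕ∞) (fun u => P.eval u) := by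
  simpa [Polynomial.aeval_def] using P.contDiff_aeval (𝕜 := ℝ) (⊤ : ℕ∞)

/-- Construction of the change of variables. -/
lemma exists_T {P : Polynomial ℝ} {h0 : ℝ} (hh : 0 < h0) (hP : ∀ u, h0 ≤ P.eval u) :
    ∃ T : ℝ → ℝ, T 0 = 0 ∧ (∀ y, HasDerivAt T (P.eval (1 - Real.exp (-T y)))⁻¹ y) ∧
      (∀ y, 0 ≤ y → 0 ≤ T y) ∧ StrictMono T ∧
      (∀ M, (∀ u ∈ Icc (0:ℝ) 1, P.eval u ≤ M) → ∀ y, 0 ≤ y → y ≤ M * T y) := by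
  set g : ℝ → ℝ := fun τ => P.eval (1 - Real.exp (-τ)) with hg
  have hgc : Continuous g := P.continuous.comp (by fun_prop)
  set Y : ℝ → ℝ := fun t => ∫ τ in (0:ℝ)..t, g τ with hY
  have hYd : ∀ t, HasDerivAt Y (g t) t := fun t =>
    intervalIntegral.integral_hasDerivAt_right (hgc.intervalIntegrable _ _)
      (hgc.stronglyMeasurableAtFilter _ _) hgc.continuousAt
  have hY0 : Y 0 = 0 := by simp [hY]
  have hgpos : ∀ t, h0 ≤ g t := fun t => hP _
  have hYm : StrictMono Y := strictMono_of_deriv_pos fun t => by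
    rw [(hYd t).deriv]; exact hh.trans_le (hgpos t)
  have hYc : Continuous Y := continuous_iff_continuousAt.2 fun t => (hYd t).continuousAt
  have hmono : Monotone (fun t => Y t - h0 * t) := by
    have hd : ∀ t, HasDerivAt (fun t => Y t - h0 * t) (g t - h0 * 1) t := fun t =>
      (hYd t).fun_sub ((hasDerivAt_id' t).const_mul h0)
    refine monotone_of_deriv_nonneg (fun t => (hd t).differentiableAt) fun t => ?_
    rw [(hd t).deriv]; linarith [hgpos t]
  have htop : Tendsto Y atTop atTop := by
    refine tendsto_atTop_mono' _ ?_ (tendsto_id.const_mul_atTop hh)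
    filter_upwards [eventually_ge_atTop 0] with t ht
    have := hmono ht
    simp [hY0] at this
    exact this
  have hbot : Tendsto Y atBot atBot := by
    refine tendsto_atBot_mono' _ ?_ (tendsto_id.const_mul_atBot hh)
    filter_upwards [eventually_le_atBot 0] with t ht
    have := hmono ht
    simp [hY0] at this
    exact this
  have hsurj : Function.Surjective Y := hYc.surjective htop hbot
  set e := hYm.orderIsoOfSurjective Y hsurj with he
  have heY : ∀ t, e t = Y t := fun t => rfl
  have h1 : ∀ y, Y (e.symm y) = y := fun y => e.apply_symm_apply y
  have h2 : ∀ t, e.symm (Y t) = t := fun t => e.symm_apply_apply t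
  have hT0 : e.symm 0 = 0 := by have := h2 0; rwa [hY0] at this
  refine ⟨e.symm, hT0, fun y => ?_, fun y hy => ?_, e.symm.strictMono, fun M hM y hy => ?_⟩
  · exact HasDerivAt.of_local_left_inverse e.symm.continuous.continuousAt
      (hYd (e.symm y)) (hh.trans_le (hgpos _)).ne' (Eventually.of_forall h1)
  · rw [← hT0]; exact e.symm.monotone hy
  · have hTy : 0 ≤ e.symm y := by rw [← hT0]; exact e.symm.monotone hy
    have : Y (e.symm y) ≤ ∫ τ in (0:ℝ)..(e.symm y), M := by
      refine intervalIntegral.integral_mono_on hTy (hgc.intervalIntegrable _ _)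
        (by simp) fun τ hτ => hM _ ⟨?_, ?_⟩
      · have := Real.exp_le_one_iff.2 (show -τ ≤ 0 by linarith [hτ.1])
        linarith
      · have := Real.exp_pos (-τ); linarith
    rw [h1] at this
    simp at this
    linarith

set_option maxHeartbeats 1000000 in
/-- The shear flow associated with a polynomial weight. -/
theorem exists_profile {P : Polynomial ℝ} {h0 : ℝ} (hh : 0 < h0) (hP : ∀ u, h0 ≤ P.eval u)
    (hP0 : P.derivative.eval 0 = 0) :
    ∃ (U U1 U2 U3 : ℝ → ℝ) (C δ : ℝ), 0 ≤ C ∧ 0 < δ ∧ U 0 = 0 ∧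
    (∀ y, HasDerivAt U (U1 y) y) ∧ (∀ y, HasDerivAt U1 (U2 y) y) ∧
    (∀ y, HasDerivAt U2 (U3 y) y) ∧ Continuous U3 ∧
    (∀ y, 0 ≤ y → (1 + y) * |1 - U y| ≤ C * Real.exp (-δ * y)) ∧
    (∀ y, 0 ≤ y → (1 + y) * |U1 y| ≤ C * Real.exp (-δ * y)) ∧
    (∀ y, 0 ≤ y → (1 + y) * |U2 y| ≤ C * Real.exp (-δ * y)) ∧
    (∀ y, 0 ≤ y → (1 + y) * |U3 y| ≤ C * Real.exp (-δ * y)) ∧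
    (∀ y, U1 y * P.eval (U y) = 1 - U y) ∧ AdmissibleShearFlow U := by
  obtain ⟨T, hT0, hTd, hTn, hTm, hTM⟩ := exists_T hh hP
  have hPpos : ∀ u, 0 < P.eval u := fun u => hh.trans_le (hP u)
  have hPne : ∀ u, P.eval u ≠ 0 := fun u => (hPpos u).ne'
  set U : ℝ → ℝ := fun y => 1 - Real.exp (-T y) with hU
  set q : ℝ → ℝ := fun u => (1 - u) / P.eval u with hq
  set q1 : ℝ → ℝ := fun u => (-P.eval u - (1 - u) * P.derivative.eval u) / (P.eval u)^2 with hq1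
  have hqs : ContDiff ℝ (⊤ : ℕ∞) q :=
    ContDiff.div (by fun_prop) (poly_contDiff P) hPne
  have hqd : ∀ u, HasDerivAt q (q1 u) u := fun u => by
    refine (((hasDerivAt_id' u).const_sub 1).fun_div (P.hasDerivAt u) (hPne u)).congr_deriv ?_
    simp only [hq1]; ring
  have hq1s : ContDiff ℝ (⊤ : ℕ∞) q1 := by
    refine ContDiff.div ?_ ((poly_contDiff P).pow 2) fun u => pow_ne_zero 2 (hPne u)
    exact (poly_contDiff P).neg.sub ((by fun_prop : ContDiff ℝ (⊤ : ℕ∞) (fun u : ℝ => 1 - u)).mul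
      (poly_contDiff P.derivative))
  have hq1d : ∀ u, HasDerivAt q1 (deriv q1 u) u := fun u =>
    (hq1s.differentiable (by simp)).differentiableAt.hasDerivAt
  have hq2c : Continuous (deriv q1) := hq1s.continuous_deriv (by exact_mod_cast le_top)
  have hUv : ∀ y, 1 - U y = Real.exp (-T y) := fun y => by simp [hU]
  have hvpos : ∀ y, 0 < 1 - U y := fun y => by rw [hUv]; exact Real.exp_pos _
  have hUd : ∀ y, HasDerivAt U (q (U y)) y := fun y => by
    have h1 := ((hTd y).fun_neg.exp).const_sub 1
    refine h1.congr_deriv ?_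
    simp only [hq, hUv]
    simp only [hU, div_eq_mul_inv]; ring
  have hUc : Continuous U := continuous_iff_continuousAt.2 fun y => (hUd y).continuousAt
  set U1 : ℝ → ℝ := fun y => q (U y) with hU1
  set U2 : ℝ → ℝ := fun y => q1 (U y) * q (U y) with hU2
  set U3 : ℝ → ℝ := fun y => (deriv q1 (U y) * q (U y)) * q (U y) + q1 (U y) * U2 y with hU3
  have hU1d : ∀ y, HasDerivAt U1 (U2 y) y := fun y => (hqd (U y)).comp y (hUd y)
  have hU2d : ∀ y, HasDerivAt U2 (U3 y) y := fun y =>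
    ((hq1d (U y)).comp y (hUd y)).fun_mul (hU1d y)
  have hU3c : Continuous U3 := by
    have a1 := hqs.continuous.comp hUc
    have a2 := hq1s.continuous.comp hUc
    have a3 := hq2c.comp hUc
    exact ((a3.mul a1).mul a1).add (a2.mul (a2.mul a1))
  have hUmem : ∀ y, 0 ≤ y → U y ∈ Icc (0:ℝ) 1 := fun y hy => by
    have h1 := hvpos y
    have h2 := hUv y
    have h3 := Real.exp_le_one_iff.2 (show -T y ≤ 0 by linarith [hTn y hy])
    exact ⟨by linarith, by linarith⟩
  have hU0 : U 0 = 0 := by simp [hU, hT0]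
  -- bounds on the compact
  obtain ⟨M, hM⟩ := isCompact_Icc.exists_bound_of_continuousOn
    (P.continuous.continuousOn (s := Icc (0:ℝ) 1))
  obtain ⟨M1, hM1⟩ := isCompact_Icc.exists_bound_of_continuousOn
    (hq1s.continuous.continuousOn (s := Icc (0:ℝ) 1))
  obtain ⟨M2, hM2⟩ := isCompact_Icc.exists_bound_of_continuousOn
    (hq2c.continuousOn (s := Icc (0:ℝ) 1))
  simp only [Real.norm_eq_abs] at hM hM1 hM2
  have hMpos : 0 < M := (hPpos 0).trans_le ((le_abs_self _).trans (hM 0 ⟨le_rfl, zero_le_one⟩))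
  have hM1n : 0 ≤ M1 := (abs_nonneg _).trans (hM1 0 ⟨le_rfl, zero_le_one⟩)
  have hM2n : 0 ≤ M2 := (abs_nonneg _).trans (hM2 0 ⟨le_rfl, zero_le_one⟩)
  set δ := 1 / (2 * M) with hδ
  have hδ0 : 0 < δ := by positivity
  have hvexp : ∀ y, 0 ≤ y → 1 - U y ≤ Real.exp (-(2*δ) * y) := fun y hy => by
    rw [hUv]
    apply Real.exp_le_exp.2
    have h1 := hTM M (fun u hu => (le_abs_self _).trans (hM u hu)) y hy
    have h2 : 2 * δ * y ≤ T y := by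
      have : 2 * δ = 1 / M := by rw [hδ]; field_simp
      rw [this, div_mul_eq_mul_div, one_mul, div_le_iff₀ hMpos]; linarith
    linarith
  have hvw : ∀ y, 0 ≤ y → (1 + y) * (1 - U y) ≤ (1 + 1/δ) * Real.exp (-δ * y) := fun y hy => by
    have h1 := hvexp y hy
    have h2 : Real.exp (-(2*δ) * y) = Real.exp (-δ*y) * Real.exp (-δ*y) := by
      rw [← Real.exp_add]; congr 1; ring
    have h3 : (1 + y) * Real.exp (-δ*y) ≤ 1 + 1/δ := by
      have e1 : Real.exp (-δ*y) ≤ 1 := Real.exp_le_one_iff.2 (by nlinarith)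
      have e2 : y * Real.exp (-δ*y) ≤ 1/δ := by
        rw [le_div_iff₀ hδ0]
        have e3 : δ * y ≤ Real.exp (δ*y) := by linarith [Real.add_one_le_exp (δ*y)]
        have e4 : Real.exp (δ*y) * Real.exp (-δ*y) = 1 := by
          rw [← Real.exp_add]; simp
        calc y * Real.exp (-δ*y) * δ = (δ * y) * Real.exp (-δ*y) := by ring
          _ ≤ Real.exp (δ*y) * Real.exp (-δ*y) := by gcongr
          _ = 1 := e4
      linarith
    calc (1 + y) * (1 - U y) ≤ (1 + y) * Real.exp (-(2*δ) * y) := by gcongr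
      _ = ((1 + y) * Real.exp (-δ*y)) * Real.exp (-δ*y) := by rw [h2]; ring
      _ ≤ _ := by gcongr
  -- bounds by the defect
  set N := 1 + 1/h0 + M1/h0 + (M2 * (1/h0) + M1 * M1) * (1/h0) with hN
  have hN0 : 0 ≤ N := by positivity
  have hqb : ∀ y, |q (U y)| ≤ (1/h0) * (1 - U y) := fun y => by
    simp only [hq]
    rw [abs_of_pos (div_pos (hvpos y) (hPpos _)), div_le_iff₀ (hPpos _)]
    have := hP (U y); have := hvpos y
    calc 1 - U y = 1/h0 * (1 - U y) * h0 := by field_simp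
      _ ≤ _ := by gcongr
  have hv1 : ∀ y, 0 ≤ y → 1 - U y ≤ 1 := fun y hy => by linarith [(hUmem y hy).1]
  have hB1 : ∀ y, 0 ≤ y → |U1 y| ≤ N * (1 - U y) := fun y hy => by
    refine (hqb y).trans ?_
    have := (hvpos y).le
    gcongr
    have : 0 ≤ M1/h0 + (M2 * (1/h0) + M1 * M1) * (1/h0) := by positivity
    rw [hN]; linarith
  have hB2' : ∀ y, 0 ≤ y → |U2 y| ≤ M1 * ((1/h0) * (1 - U y)) := fun y hy => by
    simp only [hU2]; rw [abs_mul]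
    exact mul_le_mul (hM1 _ (hUmem y hy)) (hqb y) (abs_nonneg _) hM1n
  have hB2 : ∀ y, 0 ≤ y → |U2 y| ≤ N * (1 - U y) := fun y hy => by
    refine (hB2' y hy).trans ?_
    have := (hvpos y).le
    rw [← mul_assoc]
    gcongr
    have : 0 ≤ 1/h0 + (M2 * (1/h0) + M1 * M1) * (1/h0) := by positivity
    have e : M1 * (1/h0) = M1/h0 := by ring
    rw [hN]; linarith
  have hB3 : ∀ y, 0 ≤ y → |U3 y| ≤ N * (1 - U y) := fun y hy => by
    simp only [hU3]
    refine (abs_add_le _ _).trans ?_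
    rw [abs_mul, abs_mul, abs_mul]
    have v0 := (hvpos y).le
    have e1 := hqb y
    have e2 : |q (U y)| ≤ 1/h0 := e1.trans (mul_le_of_le_one_right (by positivity) (hv1 y hy))
    have e3 := hM1 _ (hUmem y hy)
    have e4 := hM2 _ (hUmem y hy)
    have e5 := hB2' y hy
    calc _ ≤ M2 * (1/h0) * ((1/h0) * (1 - U y)) + M1 * (M1 * ((1/h0) * (1 - U y))) := by gcongr
      _ = ((M2 * (1/h0) + M1 * M1) * (1/h0)) * (1 - U y) := by ring
      _ ≤ _ := by
        gcongr
        have : 0 ≤ 1/h0 + M1/h0 := by positivity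
        rw [hN]; linarith
  set C := (1 + N) * (1 + 1/δ) with hC
  have hwt : ∀ (f : ℝ → ℝ), (∀ y, 0 ≤ y → |f y| ≤ (1 + N) * (1 - U y)) →
      ∀ y, 0 ≤ y → (1 + y) * |f y| ≤ C * Real.exp (-δ * y) := fun f hf y hy => by
    have h1 := hvw y hy
    calc (1 + y) * |f y| ≤ (1 + y) * ((1 + N) * (1 - U y)) := by gcongr; exact hf y hy
      _ = (1 + N) * ((1 + y) * (1 - U y)) := by ring
      _ ≤ (1 + N) * ((1 + 1/δ) * Real.exp (-δ * y)) := by gcongr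
      _ = _ := by rw [hC]; ring
  have hw0 : ∀ y, 0 ≤ y → (1 + y) * |1 - U y| ≤ C * Real.exp (-δ * y) :=
    hwt (fun y => 1 - U y) (fun y hy => by
      rw [abs_of_pos (hvpos y)]; have := hvpos y; nlinarith)
  have hrel : ∀ y, N * (1 - U y) ≤ (1 + N) * (1 - U y) := fun y => by
    have := hvpos y; nlinarith
  refine ⟨U, U1, U2, U3, C, δ, by positivity, hδ0, hU0, hUd, hU1d, hU2d, hU3c, hw0,
    hwt _ fun y hy => (hB1 y hy).trans (hrel y), hwt _ fun y hy => (hB2 y hy).trans (hrel y),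
    hwt _ fun y hy => (hB3 y hy).trans (hrel y), fun y => ?_, ?_⟩
  · simp only [hU1, hq]; have := hPne (U y); field_simp
  have hdU : deriv U = U1 := funext fun y => (hUd y).deriv
  have hd2 : iteratedDeriv 2 U = U2 := by
    rw [iteratedDeriv_succ, iteratedDeriv_one, hdU]
    exact funext fun y => (hU1d y).deriv
  have hd3 : iteratedDeriv 3 U = U3 := by
    rw [iteratedDeriv_succ, hd2]
    exact funext fun y => (hU2d y).deriv
  have hU1pos : ∀ y, 0 < U1 y := fun y => div_pos (hvpos y) (hPpos _)
  have hexp0 : ∀ c : ℝ, 0 < c → Tendsto (fun y => Real.exp (-c * y)) atTop (nhds 0) :=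
    fun c hc => by
      have h1 : Tendsto (fun y : ℝ => -c * y) atTop atBot :=
        tendsto_id.const_mul_atTop_of_neg (by linarith)
      exact Real.tendsto_exp_atBot.comp h1
  have hvlim : Tendsto (fun y => 1 - U y) atTop (nhds 0) := by
    refine squeeze_zero' (Eventually.of_forall fun y => (hvpos y).le) ?_ (hexp0 (2*δ) (by positivity))
    filter_upwards [eventually_ge_atTop 0] with y hy using hvexp y hy
  have hUlim : Tendsto U atTop (nhds 1) := by
    have := hvlim.const_sub 1
    simpa using this
  have hintg : IntegrableOn (fun y => Real.exp (-(2*δ) * y)) (Ioi (0:ℝ)) :=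
    exp_neg_integrableOn_Ioi 0 (by positivity)
  have hUm : StrictMono U := strictMono_of_deriv_pos fun y => by rw [hdU]; exact hU1pos y
  have hPb : ∀ y, 0 ≤ y → P.eval (U y) ≤ M := fun y hy =>
    (le_abs_self _).trans (hM _ (hUmem y hy))
  refine ⟨?_, fun y hy => ⟨(hUmem y hy).1, by linarith [hvpos y]⟩, hU0,
    fun y hy => by rw [hdU]; exact hU1pos y, hUlim, ?_, ?_, ?_, ?_, ?_, ?_, ?_, ?_⟩
  · rw [contDiff_infty]
    intro n
    induction n with
    | zero => simpa using hUc
    | succ n ih =>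
      have hn : ((n : ℕ∞) : WithTop ℕ∞) ≤ ((⊤ : ℕ∞) : WithTop ℕ∞) := by
        exact_mod_cast le_top
      push_cast
      rw [contDiff_succ_iff_deriv]
      refine ⟨fun y => (hUd y).differentiableAt, by simp, ?_⟩
      rw [hdU]
      exact (hqs.of_le hn).comp ih
  · rw [hd2]
    simp only [hU2, hU0, hq1, hq, hP0]
    have := hPne 0
    refine mul_ne_zero (div_ne_zero ?_ (pow_ne_zero 2 this)) (div_ne_zero (by norm_num) this)
    simpa using this
  · set S : Polynomial ℝ := P + (1 - Polynomial.X) * P.derivative with hS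
    have hSne : S ≠ 0 := fun h => by
      have h1 : S.eval 1 = P.eval 1 := by simp [hS]
      rw [h] at h1; simp at h1
      exact hPne 1 h1.symm
    have hfin : {u : ℝ | S.IsRoot u}.Finite := Polynomial.finite_setOf_isRoot hSne
    refine (hfin.preimage (f := U) hUm.injective.injOn).subset ?_
    rintro y ⟨hy, h2⟩
    rw [hd2] at h2
    simp only [mem_preimage, mem_setOf_eq, Polynomial.IsRoot]
    have hne : q (U y) ≠ 0 := (hU1pos y).ne'
    have h3 := (mul_eq_zero.1 h2).resolve_right hne
    simp only [hq1] at h3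
    have h4 := (div_eq_zero_iff.1 h3).resolve_right (pow_ne_zero 2 (hPne _))
    simp [hS]
    linarith
  · refine hintg.mono' (by fun_prop) ?_
    filter_upwards [ae_restrict_mem measurableSet_Ioi] with y hy
    rw [Real.norm_eq_abs, abs_of_pos (hvpos y)]
    exact hvexp y (le_of_lt hy)
  · intro j hj1 hj3
    refine ⟨N, fun y hy => ?_⟩
    have hle : N * (1 - U y) ≤ N := mul_le_of_le_one_right hN0 (hv1 y hy)
    interval_cases j
    · rw [iteratedDeriv_one, hdU]; exact (hB1 y hy).trans hle
    · rw [hd2]; exact (hB2 y hy).trans hle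
    · rw [hd3]; exact (hB3 y hy).trans hle
  · have heq : (fun y => (1 - U y)^2 / deriv U y) = fun y => (1 - U y) * P.eval (U y) := by
      funext y
      rw [hdU]
      simp only [hU1, hq]
      have := hPne (U y); have := (hvpos y).ne'
      field_simp
    rw [heq]
    have := hvlim.mul ((P.continuous.tendsto 1).comp hUlim)
    simpa using this
  · have h1 : Tendsto (fun y => C * Real.exp (-δ * y)) atTop (nhds 0) := by
      simpa using (hexp0 δ hδ0).const_mul C
    refine squeeze_zero' ?_ ?_ h1
    · filter_upwards [eventually_ge_atTop 0] with y hy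
      exact mul_nonneg hy (hvpos y).le
    · filter_upwards [eventually_ge_atTop 0] with y hy
      have := hw0 y hy
      rw [abs_of_pos (hvpos y)] at this
      have := hvpos y
      nlinarith
  · have heq : (fun y => (1 - U y)^2 * iteratedDeriv 2 U y / (deriv U y)^2) =
        fun y => (1 - U y) * P.eval (U y) * q1 (U y) := by
      funext y
      rw [hdU, hd2]
      simp only [hU1, hU2]
      have h1 : q (U y) = (1 - U y) / P.eval (U y) := rfl
      rw [h1]
      have := hPne (U y); have := (hvpos y).ne'
      field_simp
    rw [heq]
    refine (hintg.const_mul (M * M1)).mono' ?_ ?_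
    · have := P.continuous
      have := hq1s.continuous
      exact Continuous.aestronglyMeasurable (by fun_prop)
    · filter_upwards [ae_restrict_mem measurableSet_Ioi] with y hy
      have hy0 : 0 ≤ y := le_of_lt hy
      rw [Real.norm_eq_abs, abs_mul, abs_mul, abs_of_pos (hvpos y)]
      have e1 := hM _ (hUmem y hy0)
      have e2 := hM1 _ (hUmem y hy0)
      have e3 := hvexp y hy0
      have e4 := (hvpos y).le
      calc _ ≤ Real.exp (-(2*δ) * y) * M * M1 := by gcongr
        _ = _ := by ring
  · refine ⟨1/4, by norm_num, by norm_num, ?_⟩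
    have hq11 : q1 1 = -(1 / P.eval 1) := by
      simp only [hq1]; have := hPne 1; field_simp; ring
    have hev : ∀ᶠ y in atTop, q1 (U y) < -(1 / (2 * P.eval 1)) := by
      have h1 : Tendsto (fun y => q1 (U y)) atTop (nhds (q1 1)) :=
        (hq1s.continuous.tendsto 1).comp hUlim
      refine h1.eventually (gt_mem_nhds ?_)
      rw [hq11]
      have := hPpos 1
      apply neg_lt_neg
      apply one_div_lt_one_div_of_lt this
      linarith
    obtain ⟨y0, hy0⟩ := eventually_atTop.1 hev
    refine ⟨max y0 1, by positivity, h0^2 / (2 * P.eval 1), by have := hPpos 1; positivity,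
      fun y hy => ?_⟩
    have hyy := hy0 y ((le_max_left _ _).trans hy)
    have hy1 : 0 ≤ y := zero_le_one.trans ((le_max_right _ _).trans hy)
    rw [hd2, hdU]
    simp only [hU1, hU2]
    have hv := hvpos y
    have hP1 := hPpos 1
    have hPU := hPpos (U y)
    set v := 1 - U y with hvd
    have e1 : v^2 ≤ v ^ ((2:ℝ) - 1/4) := by
      rw [← Real.rpow_natCast]
      exact Real.rpow_le_rpow_of_exponent_ge hv (hv1 y hy1) (by norm_num)
    have hqe : q (U y) = v / P.eval (U y) := rfl
    have hq0 : 0 < q (U y) := hU1pos y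
    have e2 : v ^ ((2:ℝ) - 1/4) * q1 (U y) ≤ -(h0^2 / (2 * P.eval 1)) * q (U y)^2 := by
      have e3 : v ^ ((2:ℝ) - 1/4) * q1 (U y) ≤ v^2 * (-(1 / (2 * P.eval 1))) := by
        have hpos : 0 ≤ v ^ ((2:ℝ) - 1/4) := by positivity
        have hk : 0 < 1 / (2 * P.eval 1) := by positivity
        nlinarith
      refine e3.trans ?_
      rw [hqe, div_pow]
      have e4 : h0^2 * (v^2 / P.eval (U y)^2) ≤ v^2 := by
        rw [← mul_div_assoc, div_le_iff₀ (by positivity)]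
        have : h0^2 ≤ P.eval (U y)^2 := by have := hP (U y); gcongr
        nlinarith [sq_nonneg v]
      have e5 : -(h0^2 / (2 * P.eval 1)) * (v^2 / P.eval (U y)^2)
        = -(1 / (2 * P.eval 1)) * (h0^2 * (v^2 / P.eval (U y)^2)) := by ring
      rw [e5]
      have hk : 0 < 1 / (2 * P.eval 1) := by positivity
      nlinarith
    calc v ^ ((2:ℝ) - 1/4) * (q1 (U y) * q (U y)) = (v ^ ((2:ℝ) - 1/4) * q1 (U y)) * q (U y) := by
          ring
      _ ≤ (-(h0^2 / (2 * P.eval 1)) * q (U y)^2) * q (U y) := by gcongr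
      _ = _ := by ring

/-- The dispersion function. -/
def Dfun (P : Polynomial ℝ) (μ : ℂ) : ℂ := ∫ u in (0:ℝ)..1, rhoK μ u * ((P.eval u : ℝ) : ℂ)

lemma polyC_continuous (P : Polynomial ℝ) : Continuous (fun u : ℝ => ((P.eval u : ℝ) : ℂ)) :=
  Complex.continuous_ofReal.comp P.continuous

lemma Dfun_differentiable (P : Polynomial ℝ) :
    DifferentiableOn ℂ (Dfun P) {z : ℂ | 0 < z.im} := by
  intro z0 hz0
  set b := z0.im with hb
  have hb0 : 0 < b := hz0
  obtain ⟨M, hM⟩ := isCompact_Icc.exists_bound_of_continuousOn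
    ((polyC_continuous P).continuousOn (s := Icc (0:ℝ) 1))
  have him : ∀ z ∈ Metric.ball z0 (b/2), b/2 < z.im := fun z hz => by
    have h1 : |(z - z0).im| < b/2 := (Complex.abs_im_le_norm _).trans_lt (by
      rwa [← dist_eq_norm])
    rw [Complex.sub_im] at h1
    have := (abs_lt.1 h1).1
    linarith
  set F' : ℂ → ℝ → ℂ := fun z u =>
    -(2 * ((z - (u:ℂ))⁻¹)^2 - 2 * (2 * z - 1 - (u:ℂ)) * ((z - (u:ℂ))⁻¹)^3)
      * ((P.eval u : ℝ) : ℂ) with hF'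
  have hc : ∀ z : ℂ, 0 < z.im → Continuous (fun u : ℝ => rhoK z u * ((P.eval u : ℝ) : ℂ)) :=
    fun z hz => (rhoK_continuous hz).mul (polyC_continuous P)
  have hF'c : Continuous (F' z0) := by
    have h1 : Continuous (fun u : ℝ => (z0 - (u:ℂ))⁻¹) :=
      Continuous.inv₀ (by fun_prop) (fun u => sub_real_ne hb0 u)
    have h2 := polyC_continuous P
    simp only [hF']
    fun_prop
  have := intervalIntegral.hasDerivAt_integral_of_dominated_loc_of_deriv_le (μ := volume)
    (a := 0) (b := 1)
    (F := fun z u => rhoK z u * ((P.eval u : ℝ) : ℂ)) (F' := F') (x₀ := z0)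
    (bound := fun _ => (2 * (2/b)^2 + 2 * (2 * (‖z0‖ + b/2) + 2) * (2/b)^3) * M)
    (Metric.ball_mem_nhds z0 (show 0 < b/2 by linarith))
    (by
      filter_upwards [Metric.ball_mem_nhds z0 (show 0 < b/2 by linarith)] with z hz
      exact (hc z (by linarith [him z hz])).aestronglyMeasurable)
    ((hc z0 hb0).intervalIntegrable _ _)
    hF'c.aestronglyMeasurable
    (by
      refine Eventually.of_forall fun u hu z hz => ?_
      rw [uIoc_of_le zero_le_one] at hu
      have h1 := hM u ⟨hu.1.le, hu.2⟩
      have hi : ‖(z - (u:ℂ))⁻¹‖ ≤ 2 / b := by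
        rw [norm_inv]
        have h2 : b/2 ≤ ‖z - (u:ℂ)‖ := by
          have h3 := Complex.abs_im_le_norm (z - (u:ℂ))
          have h4 := le_abs_self (z - (u:ℂ)).im
          simp at h4 h3
          linarith [him z hz]
        calc ‖z - (u:ℂ)‖⁻¹ ≤ (b/2)⁻¹ := by gcongr
          _ = 2/b := by field_simp
      have hz' : ‖z‖ ≤ ‖z0‖ + b/2 := by
        have h2 : ‖z - z0‖ < b/2 := by rwa [← dist_eq_norm]
        have h3 := norm_add_le z0 (z - z0)
        rw [add_sub_cancel] at h3
        linarith
      have hu' : ‖(u:ℂ)‖ ≤ 1 := by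
        rw [Complex.norm_real, Real.norm_eq_abs, abs_of_pos hu.1]; exact hu.2
      have hl : ‖2 * z - 1 - (u:ℂ)‖ ≤ 2 * (‖z0‖ + b/2) + 2 := by
        refine (norm_sub_le _ _).trans ?_
        have h3 := norm_sub_le (2 * z) 1
        rw [norm_mul, Complex.norm_ofNat, norm_one] at h3
        linarith
      simp only [hF']
      rw [norm_mul, norm_neg]
      have hM0 : 0 ≤ M := (norm_nonneg _).trans h1
      refine mul_le_mul ?_ h1 (norm_nonneg _) (by positivity)
      refine (norm_sub_le _ _).trans ?_
      rw [norm_mul, norm_mul, norm_mul, norm_pow, norm_pow, Complex.norm_ofNat]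
      gcongr)
    (by simp)
    (by
      refine Eventually.of_forall fun u hu z hz => ?_
      have hne := sub_real_ne (show 0 < z.im by linarith [him z hz]) u
      have h1 : HasDerivAt (fun z : ℂ => 2 * z - 1 - (u:ℂ)) (2 * 1) z :=
        (((hasDerivAt_id' z).const_mul 2).sub_const 1).sub_const _
      have h2 : HasDerivAt (fun z : ℂ => (z - (u:ℂ))^2) ((2:ℕ) * (z - (u:ℂ))^(2-1) * 1) z :=
        ((hasDerivAt_id' z).sub_const _).fun_pow 2
      have h3 := (((h1.fun_div h2 (pow_ne_zero 2 hne)).const_sub 1).mul_const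
        ((P.eval u : ℝ) : ℂ))
      refine h3.congr_deriv ?_
      simp only [hF']
      field_simp
      push_cast
      ring)
  exact this.2.differentiableAt.differentiableWithinAt

lemma Dfun_ne {P : Polynomial ℝ} {h0 : ℝ} (hh : 0 < h0) (hP : ∀ u, h0 ≤ P.eval u) :
    Dfun P (4 * Complex.I) ≠ 0 := by
  have hb : 0 < (4 * Complex.I : ℂ).im := by simp
  have hPI : h0 ≤ ∫ u in (0:ℝ)..1, P.eval u := by
    have := intervalIntegral.integral_mono_on (μ := volume) (f := fun _ => h0) (g := fun u => P.eval u)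
      zero_le_one (by simp) (P.continuous.intervalIntegrable _ _) (fun u _ => hP u)
    simpa using this
  have e1 : Dfun P (4 * Complex.I) - ((∫ u in (0:ℝ)..1, P.eval u : ℝ) : ℂ) =
      ∫ u in (0:ℝ)..1, (rhoK (4 * Complex.I) u - 1) * ((P.eval u : ℝ) : ℂ) := by
    rw [Dfun, ← intervalIntegral.integral_ofReal, ← intervalIntegral.integral_sub]
    · congr 1; funext u; ring
    · exact ((rhoK_continuous hb).mul (polyC_continuous P)).intervalIntegrable _ _
    · exact (polyC_continuous P).intervalIntegrable _ _
  have e2 : ‖∫ u in (0:ℝ)..1, (rhoK (4 * Complex.I) u - 1) * ((P.eval u : ℝ) : ℂ)‖ ≤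
      ∫ u in (0:ℝ)..1, (10/16) * P.eval u := by
    refine intervalIntegral.norm_integral_le_of_norm_le zero_le_one
      (Eventually.of_forall fun u hu => ?_)
      ((continuous_const.mul P.continuous).intervalIntegrable _ _)
    rw [norm_mul, Complex.norm_real, Real.norm_eq_abs, abs_of_pos (hh.trans_le (hP u))]
    have := hh.trans_le (hP u)
    gcongr
    rw [rhoK, sub_sub_cancel_left, norm_neg, norm_div, norm_pow]
    have h4 : 4 ≤ ‖4 * Complex.I - (u:ℂ)‖ := by
      have h3 := Complex.abs_im_le_norm (4 * Complex.I - (u:ℂ))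
      simp at h3
      exact h3
    have hn : ‖2 * (4 * Complex.I) - 1 - (u:ℂ)‖ ≤ 10 := by
      refine (norm_sub_le _ _).trans ?_
      have h3 := norm_sub_le (2 * (4 * Complex.I)) 1
      rw [norm_mul, norm_mul, Complex.norm_ofNat, Complex.norm_ofNat, Complex.norm_I,
        norm_one] at h3
      have hu' : ‖(u:ℂ)‖ ≤ 1 := by
        rw [Complex.norm_real, Real.norm_eq_abs, abs_of_pos hu.1]; exact hu.2
      linarith
    rw [div_le_div_iff₀ (by positivity) (by norm_num)]
    nlinarith
  intro h
  rw [h, zero_sub] at e1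
  rw [← e1, norm_neg, Complex.norm_real, intervalIntegral.integral_const_mul] at e2
  have := (le_abs_self _).trans e2
  linarith

lemma Dfun_isolated {P : Polynomial ℝ} {h0 : ℝ} (hh : 0 < h0) (hP : ∀ u, h0 ≤ P.eval u)
    {μ : ℂ} (hb : 0 < μ.im) : ∀ᶠ z in nhdsWithin μ {μ}ᶜ, Dfun P z ≠ 0 := by
  have hop : IsOpen {z : ℂ | 0 < z.im} := isOpen_lt continuous_const Complex.continuous_im
  have han := (Dfun_differentiable P).analyticOnNhd hop
  rcases (han μ hb).eventually_eq_zero_or_eventually_ne_zero with h | h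
  · exfalso
    have := han.eqOn_zero_of_preconnected_of_eventuallyEq_zero
      (convex_halfSpace_im_gt 0).isPreconnected hb h
      (show (4 * Complex.I : ℂ) ∈ {z : ℂ | 0 < z.im} by simp)
    exact Dfun_ne hh hP this
  · exact h

/-- Limit of the inviscid integral. -/
lemma inviscid_limit {P : Polynomial ℝ} {U U1 : ℝ → ℝ} (hU0 : U 0 = 0)
    (hU : ∀ y, HasDerivAt U (U1 y) y) (hU1c : Continuous U1)
    (hrel : ∀ y, U1 y * P.eval (U y) = 1 - U y)
    (hlim : Tendsto U atTop (nhds 1)) (hy : Tendsto (fun y => y * (1 - U y)) atTop (nhds 0))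
    (hintg : IntegrableOn (fun y => 1 - U y) (Ioi (0:ℝ))) {μ : ℂ} (hb : 0 < μ.im) :
    Tendsto (fun y => ∫ s in (0:ℝ)..y, ((1 - U s + s * U1 s : ℝ) : ℂ) / (μ - (U s:ℂ))^2)
      atTop (nhds ((((∫ y in Ioi (0:ℝ), (1 - U y) : ℝ) : ℂ) - Dfun P μ) / (μ - 1))) := by
  have hUc : Continuous U := continuous_iff_continuousAt.2 fun y => (hU y).continuousAt
  have hμ1 : μ - 1 ≠ 0 := by simpa using sub_real_ne hb 1
  set J : ℝ → ℂ := fun y => ∫ s in (0:ℝ)..y, ((1 - U s + s * U1 s : ℝ) : ℂ) / (μ - (U s:ℂ))^2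
    with hJ
  set R : ℝ → ℂ := fun x => ∫ u in (0:ℝ)..x, rhoK μ u * ((P.eval u : ℝ) : ℂ) with hR
  set V : ℝ → ℝ := fun y => ∫ s in (0:ℝ)..y, (1 - U s) with hV
  have hJd : ∀ y, HasDerivAt J (((1 - U y + y * U1 y : ℝ) : ℂ) / (μ - (U y:ℂ))^2) y :=
    primitive_hasDerivAt (Continuous.div (by fun_prop) (by fun_prop)
      fun y => pow_ne_zero 2 (sub_real_ne hb _))
  have hRd : ∀ x, HasDerivAt R (rhoK μ x * ((P.eval x : ℝ) : ℂ)) x :=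
    primitive_hasDerivAt ((rhoK_continuous hb).mul (polyC_continuous P))
  have hVd : ∀ y, HasDerivAt V (1 - U y) y := fun y =>
    intervalIntegral.integral_hasDerivAt_right ((by fun_prop :
      Continuous fun s => 1 - U s).intervalIntegrable _ _)
      ((by fun_prop : Continuous fun s => 1 - U s).stronglyMeasurableAtFilter _ _)
      (by fun_prop : Continuous fun s => 1 - U s).continuousAt
  set G : ℝ → ℂ := fun y => (μ - 1) * J y - (V y : ℂ) + R (U y)
    - (y:ℂ) * ((μ - 1) / (μ - (U y:ℂ))) + (y:ℂ) with hG
  have hGd : ∀ y, HasDerivAt G 0 y := fun y => by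
    have hne := sub_real_ne hb (U y)
    have hw : HasDerivAt (fun y => μ - (U y:ℂ)) (-(U1 y:ℂ)) y :=
      (hU y).ofReal_comp.const_sub μ
    have hid : HasDerivAt (fun y : ℝ => (y:ℂ)) 1 y := Complex.ofRealCLM.hasDerivAt
    have h1 := (((hJd y).const_mul (μ - 1)).fun_sub (hVd y).ofReal_comp).fun_add
      ((hRd (U y)).scomp y (hU y))
    have h2 := hid.fun_mul ((hasDerivAt_const y (μ - 1)).fun_div hw hne)
    have h3 := (h1.fun_sub h2).fun_add hid
    refine h3.congr_deriv ?_
    have hr : (U1 y:ℂ) * ((P.eval (U y) : ℝ) : ℂ) = 1 - (U y:ℂ) := by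
      rw [← Complex.ofReal_mul, hrel]; push_cast; ring
    have hr2 : U1 y • (rhoK μ (U y) * ((P.eval (U y) : ℝ) : ℂ)) =
        rhoK μ (U y) * (1 - (U y:ℂ)) := by
      rw [← hr, Complex.real_smul]; ring
    rw [hr2, rhoK]
    push_cast
    field_simp
    ring
  have hG0 : ∀ y, G y = 0 := fun y => by
    have h1 := is_const_of_deriv_eq_zero (fun y => (hGd y).differentiableAt)
      (fun y => (hGd y).deriv) y 0
    rw [h1]
    simp [hG, hJ, hV, hR, hU0]
  have hJe : ∀ y, J y = ((V y : ℂ) - R (U y) - ((y * (1 - U y) : ℝ) : ℂ) * (-(μ - (U y:ℂ))⁻¹)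
      * (-1)) / (μ - 1) := fun y => by
    rw [eq_div_iff hμ1]
    have h1 := hG0 y
    simp only [hG] at h1
    have hne := sub_real_ne hb (U y)
    have h2 : ((y * (1 - U y) : ℝ) : ℂ) * (-(μ - (U y:ℂ))⁻¹) * (-1) =
        (y:ℂ) - (y:ℂ) * ((μ - 1) / (μ - (U y:ℂ))) := by
      push_cast; field_simp; ring
    rw [h2]
    linear_combination h1
  have l1 : Tendsto (fun y => (V y:ℂ)) atTop (nhds ((∫ y in Ioi (0:ℝ), (1 - U y) : ℝ) : ℂ)) :=
    (Complex.continuous_ofReal.tendsto _).comp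
      (intervalIntegral_tendsto_integral_Ioi 0 hintg tendsto_id)
  have l2 : Tendsto (fun y => R (U y)) atTop (nhds (Dfun P μ)) :=
    ((hRd 1).continuousAt.tendsto).comp hlim
  have l3 : Tendsto (fun y => ((y * (1 - U y) : ℝ) : ℂ)) atTop (nhds 0) := by
    have := (Complex.continuous_ofReal.tendsto _).comp hy
    rwa [Complex.ofReal_zero] at this
  have l4 : Tendsto (fun y => (-(μ - (U y:ℂ))⁻¹)) atTop (nhds (-(μ - (1:ℂ))⁻¹)) := by
    have h1 : Tendsto (fun y => (U y:ℂ)) atTop (nhds 1) := by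
      have := (Complex.continuous_ofReal.tendsto _).comp hlim
      rwa [Complex.ofReal_one] at this
    exact ((h1.const_sub μ).inv₀ hμ1).neg
  have l5 := (((l1.sub l2).sub ((l3.mul l4).mul_const (-1))).div_const (μ - 1))
  simp only [zero_mul, sub_zero] at l5
  exact l5.congr fun y => (hJe y).symm

/-- Theorem (construction of unstable shear flows for PDT, spectral domain `Γ₁`). -/
theorem pdt_construction_gamma1 (μ : ℂ) (ha : 0 < μ.re) (ha1 : μ.re < 1)
    (hb : 0 < μ.im)
    (hb1 : μ.im < Real.sqrt (3 * μ.re * (1 - μ.re) ^ 2 / (4 - 3 * μ.re))) :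
    ∃ U : ℝ → ℝ, AdmissibleShearFlow U ∧ ∃ K : ℝ, 0 < K ∧ ∃ μseq : ℕ → ℂ,
      Tendsto μseq atTop (nhds μ) ∧
      ∀ k : ℕ, K ≤ (k : ℝ) → 0 < (μseq k).im ∧
        ∃ φ : ℝ → ℂ, IsEigSolution U (μseq k) (k : ℝ) ((deltaS U : ℝ) : ℂ) φ := by
  obtain ⟨P, ⟨h0, hh, hP⟩, hP0, hD⟩ := exists_weight ha ha1 hb hb1
  obtain ⟨U, U1, U2, U3, C, δ, hC, hδ, hU0, hU, hU1, hU2, hU3, hb0, hbb1, hbb2, hbb3, hrel, hadm⟩ :=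
    exists_profile hh hP hP0
  obtain ⟨r, hr, hrb, C', κ0, H⟩ :=
    viscous_family hC hδ hU0 hU hU1 hU2 hU3 hb0 hbb1 hbb2 hbb3 hb
  have hU1c : Continuous U1 := continuous_iff_continuousAt.2 fun y => (hU1 y).continuousAt
  have hdU : deriv U = U1 := funext fun y => (hU y).deriv
  have him : ∀ ν ∈ Metric.ball (0:ℂ) r, 0 < (μ + ν).im := fun ν hν => by
    rw [mem_ball_zero_iff] at hν
    have h1 := (Complex.abs_im_le_norm ν).trans_lt hν
    have h2 := (abs_lt.1 h1).1
    rw [Complex.add_im]; linarith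
  choose! f hf using H
  set Δ : ℂ := ((deltaS U : ℝ) : ℂ) with hΔ
  set K0 : ℕ := ⌈κ0 ^ 2⌉₊ + 1 with hK0
  have hsq : ∀ n : ℕ, K0 ≤ n → κ0 ≤ Real.sqrt n := fun n hn => by
    apply Real.le_sqrt_of_sq_le
    have h1 := Nat.le_ceil (κ0 ^ 2)
    have h2 : ((K0 : ℕ) : ℝ) ≤ n := by exact_mod_cast hn
    rw [hK0] at h2; push_cast at h2
    linarith
  have hε : Tendsto (fun n : ℕ => C' / Real.sqrt n) atTop (nhds 0) :=
    (Real.tendsto_sqrt_atTop.comp tendsto_natCast_atTop_atTop).const_div_atTop C'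
  have hadd : ContinuousOn (fun ν : ℂ => μ + ν) (Metric.ball 0 r) := by fun_prop
  obtain ⟨N, ν, hν, hνz⟩ := hurwitz_zeros hr (fun n z => f (Real.sqrt n) z - Δ)
    (fun z => -Dfun P (μ + z)) K0 (fun n => C' / Real.sqrt n) hε
    (fun n hn => (hf _ (hsq n hn)).1.sub_const _)
    (((Dfun_differentiable P).continuousOn.comp hadd him).neg)
    (by simp only [add_zero, neg_eq_zero]; exact hD)
    (by
      have h1 := Dfun_isolated hh hP hb
      have h2 : Tendsto (fun z : ℂ => μ + z) (nhdsWithin 0 {0}ᶜ) (nhdsWithin μ {μ}ᶜ) := by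
        refine tendsto_nhdsWithin_of_tendsto_nhds_of_eventually_within _ ?_ ?_
        · have : Tendsto (fun z : ℂ => μ + z) (nhds 0) (nhds (μ + 0)) :=
            (continuous_const.add continuous_id).tendsto 0
          rw [add_zero] at this
          exact this.mono_left nhdsWithin_le_nhds
        · filter_upwards [self_mem_nhdsWithin] with z hz
          simpa using hz
      filter_upwards [h2.eventually h1] with z hz
      exact neg_ne_zero.2 hz)
    (fun n hn z hz => by
      have hμ1 : μ + z - 1 ≠ 0 := by simpa using sub_real_ne (him z hz) 1
      have h1 := ((hf _ (hsq n hn)).2 z hz).1 _ (inviscid_limit hU0 hU hU1c hrel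
        hadm.tendsto_one hadm.decay_ratio₂ hadm.integrable_defect (him z hz))
      rw [mul_div_cancel₀ _ hμ1] at h1
      convert h1 using 2
      simp only [hΔ, deltaS]
      ring)
  refine ⟨U, hadm, ((max N K0 : ℕ) : ℝ) + 1, by positivity, fun n => μ + ν n, ?_, fun k hk => ?_⟩
  · simpa using hν.const_add μ
  have hk' : max N K0 + 1 ≤ k := by exact_mod_cast hk
  have hkN : N ≤ k := by have := le_max_left N K0; omega
  have hkK : K0 ≤ k := by have := le_max_right N K0; omega
  have hk0 : (k:ℂ) ≠ 0 := by
    have : k ≠ 0 := by omega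
    exact_mod_cast this
  obtain ⟨hνb, hν0⟩ := hνz k hkN
  refine ⟨him _ hνb, ?_⟩
  obtain ⟨φ, φ1, φ2, d0, d1, d2, e0, e1, t1, t0⟩ := ((hf _ (hsq k hkK)).2 _ hνb).2
  have hκ : ((Real.sqrt k : ℝ) : ℂ)^2 = (k:ℂ) := by
    rw [← Complex.ofReal_pow, Real.sq_sqrt (Nat.cast_nonneg k)]; simp
  have hfΔ : f (Real.sqrt k) (ν k) = Δ := sub_eq_zero.1 hν0
  rw [hfΔ] at t0
  have hUs : ContDiff ℝ (⊤ : ℕ∞) (fun y => (U y : ℂ)) := Complex.ofRealCLM.contDiff.comp hadm.smooth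
  have hU1s' : ContDiff ℝ (⊤ : ℕ∞) U1 := by
    rw [← hdU]; exact (contDiff_infty_iff_deriv.1 hadm.smooth).2
  have hU1s : ContDiff ℝ (⊤ : ℕ∞) (fun y => (U1 y : ℂ)) := Complex.ofRealCLM.contDiff.comp hU1s'
  have hFs : ContDiff ℝ (⊤ : ℕ∞) (fun y => ((1 - U y + y * U1 y : ℝ) : ℂ)) :=
    Complex.ofRealCLM.contDiff.comp
      ((contDiff_const.sub hadm.smooth).add (contDiff_id.mul hU1s'))
  obtain ⟨ψ, hψs, hψ⟩ := smooth_extension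
    (p0 := fun y => -Complex.I * (k:ℂ) * (U1 y:ℂ))
    (p1 := fun y => -Complex.I * (k:ℂ) * (μ + ν k - (U y:ℂ)))
    (q := fun y => Complex.I * (k:ℂ) * ((1 - U y + y * U1 y : ℝ) : ℂ))
    (contDiff_const.mul hU1s) (contDiff_const.mul (contDiff_const.sub hUs))
    (contDiff_const.mul hFs) d0 d1 (fun y hy => by
      refine (d2 y hy).congr_deriv ?_
      rw [hκ]; ring)
  refine ⟨ψ, hψs, fun y hy => ?_, ?_, ?_, ?_, ?_⟩
  · obtain ⟨a0, a1, a2⟩ := hψ y hy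
    rw [a0, a1, a2, hdU, srcF, hdU]
    have hII := Complex.I_sq
    push_cast
    field_simp
    linear_combination ((μ + ν k - (U y:ℂ)) * φ1 y + (U1 y:ℂ) * φ y - (1 - (U y:ℂ))
      - y * (U1 y:ℂ)) * hII
  · rw [(hψ 0 le_rfl).1, e0]
  · rw [(hψ 0 le_rfl).2.1, e1]
  · refine t1.congr' ?_
    filter_upwards [eventually_ge_atTop 0] with y hy using (hψ y hy).2.1.symm
  · refine t0.congr' ?_
    filter_upwards [eventually_ge_atTop 0] with y hy using (hψ y hy).1.symm

end
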